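/- For every integer n ≥ 2 and every 0 < δ < 2/n there is a constant C = C(δ,n) > 0 with the following property. Let g be a smooth time-dependent metric on ℝ^n over [0,T] solving the Ricci flow, let x₀ ∈ ℝ^n, r₀ > 0, A ≥ 2, K > 0, and assume: (a) for every t ∈ [0,T] the closure of the ball B_t(x₀, A r₀) is compact; (b) Ric ≤ (n−1) r₀^{−2} at (x,t) for every x ∈ B_t(x₀, r₀) and every t ∈ [0,T]; (c) R(x,0) ≥ −K for every x ∈ B_0(x₀, A r₀). Then R(x,t) ≥ min{ −1/((2/n − δ) t + 1/K), −C/(A r₀²) } for every t ∈ [0,T] and every x ∈ B_t(x₀, (3A/4) r₀). -/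

import Mathlib

open Set MeasureTheory
open scoped BigOperators Matrix

noncomputable section

variable {n : ℕ}

/-- Partial derivative of `f` at `x` in the `i`-th coordinate direction. -/
def pd (f : (Fin n → ℝ) → ℝ) (i : Fin n) (x : Fin n → ℝ) : ℝ :=
  fderiv ℝ f x (Pi.single i 1)

/-- Christoffel symbols `Γ^k_{ij}` of a (time-independent) metric `G`. -/
def christoffel (G : (Fin n → ℝ) → Matrix (Fin n) (Fin n) ℝ)
    (x : Fin n → ℝ) (k i j : Fin n) : ℝ :=
  (1/2) * ∑ l, (G x)⁻¹ k l *
    (pd (fun y => G y j l) i x + pd (fun y => G y i l) j x - pd (fun y => G y i j) l x)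

/-- Ricci tensor `R_{jk}`. -/
def ricci (G : (Fin n → ℝ) → Matrix (Fin n) (Fin n) ℝ)
    (x : Fin n → ℝ) (j k : Fin n) : ℝ :=
  ∑ i, (pd (fun y => christoffel G y i j k) i x
      - pd (fun y => christoffel G y i i k) j x
      + ∑ p, (christoffel G x i i p * christoffel G x p j k
            - christoffel G x i j p * christoffel G x p i k))

/-- Scalar curvature. -/
def scalarCurv (G : (Fin n → ℝ) → Matrix (Fin n) (Fin n) ℝ) (x : Fin n → ℝ) : ℝ :=
  ∑ j, ∑ k, (G x)⁻¹ j k * ricci G x j k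

/-- Riemann tensor `R_{ijkl}`. -/
def riemann (G : (Fin n → ℝ) → Matrix (Fin n) (Fin n) ℝ)
    (x : Fin n → ℝ) (i j k l : Fin n) : ℝ :=
  ∑ m, G x l m *
    (pd (fun y => christoffel G y m j k) i x - pd (fun y => christoffel G y m i k) j x
      + ∑ p, (christoffel G x m i p * christoffel G x p j k
            - christoffel G x m j p * christoffel G x p i k))

/-- Norm of the Riemann tensor. -/
def riemNorm (G : (Fin n → ℝ) → Matrix (Fin n) (Fin n) ℝ) (x : Fin n → ℝ) : ℝ :=
  Real.sqrt (∑ i, ∑ j, ∑ k, ∑ l, ∑ a, ∑ b, ∑ c, ∑ d,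
    (G x)⁻¹ i a * (G x)⁻¹ j b * (G x)⁻¹ k c * (G x)⁻¹ l d *
      riemann G x i j k l * riemann G x a b c d)

/-- Sectional curvature of the plane spanned by `u`, `v`. -/
def sectionalCurv (G : (Fin n → ℝ) → Matrix (Fin n) (Fin n) ℝ)
    (x : Fin n → ℝ) (u v : Fin n → ℝ) : ℝ :=
  (∑ i, ∑ j, ∑ k, ∑ l, riemann G x i j k l * u i * v j * v k * u l) /
    ((∑ i, ∑ j, G x i j * u i * u j) * (∑ i, ∑ j, G x i j * v i * v j)
      - (∑ i, ∑ j, G x i j * u i * v j) ^ 2)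

/-- Length of a path with respect to the metric `G`. -/
def pathLength (G : (Fin n → ℝ) → Matrix (Fin n) (Fin n) ℝ)
    (γ : ℝ → (Fin n → ℝ)) : ℝ :=
  ∫ s in (0:ℝ)..1, Real.sqrt (∑ i, ∑ j, G (γ s) i j * deriv γ s i * deriv γ s j)

/-- Riemannian distance: infimum of lengths of C¹ paths. -/
def riemDist (G : (Fin n → ℝ) → Matrix (Fin n) (Fin n) ℝ)
    (x y : Fin n → ℝ) : ℝ :=
  sInf {L : ℝ | ∃ γ : ℝ → (Fin n → ℝ),
    ContDiffOn ℝ 1 γ (Icc 0 1) ∧ γ 0 = x ∧ γ 1 = y ∧ L = pathLength G γ}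

/-- Metric ball. -/
def rBall (G : (Fin n → ℝ) → Matrix (Fin n) (Fin n) ℝ)
    (x₀ : Fin n → ℝ) (r : ℝ) : Set (Fin n → ℝ) :=
  {x | riemDist G x₀ x < r}

/-- Completeness of `(ℝⁿ, riemDist G)`. -/
def riemComplete (G : (Fin n → ℝ) → Matrix (Fin n) (Fin n) ℝ) : Prop :=
  ∀ u : ℕ → (Fin n → ℝ),
    (∀ ε > (0:ℝ), ∃ N, ∀ p ≥ N, ∀ q ≥ N, riemDist G (u p) (u q) < ε) →
    ∃ x, ∀ ε > (0:ℝ), ∃ N, ∀ p ≥ N, riemDist G (u p) x < ε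

/-- Riemannian volume of a set. -/
def riemVol (G : (Fin n → ℝ) → Matrix (Fin n) (Fin n) ℝ)
    (S : Set (Fin n → ℝ)) : ℝ :=
  ∫ x in S, Real.sqrt ((G x).det)

/-- A smooth (time-independent) Riemannian metric. -/
def SmoothMetric (G : (Fin n → ℝ) → Matrix (Fin n) (Fin n) ℝ) : Prop :=
  (∀ i j, ContDiff ℝ (⊤ : ℕ∞) (fun x => G x i j)) ∧ ∀ x, (G x).IsSymm ∧ (G x).PosDef

/-- A smooth time-dependent metric over the time interval `I`. -/
def SmoothMetricFamily (g : (Fin n → ℝ) → ℝ → Matrix (Fin n) (Fin n) ℝ)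
    (I : Set ℝ) : Prop :=
  (∀ i j, ContDiffOn ℝ (⊤ : ℕ∞) (fun p : (Fin n → ℝ) × ℝ => g p.1 p.2 i j) (univ ×ˢ I)) ∧
  ∀ x : Fin n → ℝ, ∀ t ∈ I, (g x t).IsSymm ∧ (g x t).PosDef

/-- The Ricci flow equation `∂ₜ g = -2 Ric` over the time interval `I`. -/
def IsRicciFlow (g : (Fin n → ℝ) → ℝ → Matrix (Fin n) (Fin n) ℝ)
    (I : Set ℝ) : Prop :=
  ∀ x : Fin n → ℝ, ∀ t ∈ I, ∀ j k,
    derivWithin (fun s => g x s j k) I t = -2 * ricci (fun y => g y t) x j k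

/-- `lam ≥ mu ≥ nu` are the eigenvalues of the 3×3 matrix `M`
(characterized via the characteristic polynomial). -/
def IsEigTriple (M : Matrix (Fin 3) (Fin 3) ℝ) (lam mu nu : ℝ) : Prop :=
  nu ≤ mu ∧ mu ≤ lam ∧
  ∀ z : ℝ, (z • (1 : Matrix (Fin 3) (Fin 3) ℝ) - M).det = (z - lam) * (z - mu) * (z - nu)

/-- Hamilton's curvature operator `g^{il}(R g_{lj} - 2 R_{lj})` in dimension 3. -/
def curvOp (G : (Fin 3 → ℝ) → Matrix (Fin 3) (Fin 3) ℝ) (x : Fin 3 → ℝ) :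
    Matrix (Fin 3) (Fin 3) ℝ :=
  Matrix.of fun i j => ∑ l, (G x)⁻¹ i l * (scalarCurv G x * G x l j - 2 * ricci G x l j)


lemma Matrix.map_derivation_mul {m 𝒜 : Type*} [Fintype m] [CommRing 𝒜] [Algebra ℝ 𝒜]
    (d : Derivation ℝ 𝒜 𝒜) (A B : Matrix m m 𝒜) :
    (A * B).map d = A.map d * B + A * B.map d := by
  ext i j
  simp only [Matrix.map_apply, Matrix.mul_apply, map_sum, Derivation.leibniz, Matrix.add_apply,
    ← Finset.sum_add_distrib, smul_eq_mul]
  exact Finset.sum_congr rfl fun k _ => by ring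

lemma Matrix.map_derivation_one {m 𝒜 : Type*} [Fintype m] [DecidableEq m] [CommRing 𝒜]
    [Algebra ℝ 𝒜] (d : Derivation ℝ 𝒜 𝒜) : (1 : Matrix m m 𝒜).map d = 0 := by
  ext i j
  by_cases h : i = j <;> simp [h]

/-- A metric with entries in a commutative algebra carrying commuting derivations, together with
its inverse. -/
structure FormalMetric (n : ℕ) (𝒜 : Type*) [CommRing 𝒜] [Algebra ℝ 𝒜] where
  /-- the coordinate derivations -/
  D : Fin n → Derivation ℝ 𝒜 𝒜
  comm : ∀ i j f, D i (D j f) = D j (D i f)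
  /-- the metric -/
  g : Matrix (Fin n) (Fin n) 𝒜
  /-- the inverse metric -/
  h : Matrix (Fin n) (Fin n) 𝒜
  symm : gᵀ = g
  gh : g * h = 1

namespace FormalMetric

variable {n : ℕ} {𝒜 : Type*} [CommRing 𝒜] [Algebra ℝ 𝒜] (M : FormalMetric n 𝒜)

/-- Christoffel symbols. -/
def Γ (k i j : Fin n) : 𝒜 :=
  (1 / 2 : ℝ) • ∑ l, M.h k l * (M.D i (M.g j l) + M.D j (M.g i l) - M.D l (M.g i j))

/-- Connection matrices. -/
def conn (i : Fin n) : Matrix (Fin n) (Fin n) 𝒜 := Matrix.of fun k j => M.Γ k i j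

/-- Curvature matrices. -/
def F (i j : Fin n) : Matrix (Fin n) (Fin n) 𝒜 :=
  (M.conn j).map (M.D i) - (M.conn i).map (M.D j) + M.conn i * M.conn j - M.conn j * M.conn i

/-- Ricci tensor. -/
def Ric (j k : Fin n) : 𝒜 :=
  ∑ i, (M.D i (M.Γ i j k) - M.D j (M.Γ i i k)
    + ∑ p, (M.Γ i i p * M.Γ p j k - M.Γ i j p * M.Γ p i k))

/-- Scalar curvature. -/
def scal : 𝒜 := ∑ j, ∑ k, M.h j k * M.Ric j k

lemma hg : M.h * M.g = 1 := mul_eq_one_comm.mp M.gh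

lemma g_comm (i j : Fin n) : M.g i j = M.g j i := congrFun (congrFun M.symm j) i

lemma h_symm : M.hᵀ = M.h := by
  have h1 : M.g * M.hᵀ = 1 := by
    have := congrArg Matrix.transpose M.hg
    rwa [Matrix.transpose_mul, M.symm, Matrix.transpose_one] at this
  calc M.hᵀ = (M.h * M.g) * M.hᵀ := by rw [M.hg, one_mul]
    _ = M.h := by rw [mul_assoc, h1, mul_one]

lemma h_comm (i j : Fin n) : M.h i j = M.h j i := congrFun (congrFun M.h_symm j) i

lemma Γ_comm (k i j : Fin n) : M.Γ k i j = M.Γ k j i := by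
  unfold Γ
  congr 1
  refine Finset.sum_congr rfl fun l _ => ?_
  rw [M.g_comm i j]; ring

lemma lower_Γ (l i j : Fin n) : ∑ k, M.g l k * M.Γ k i j =
    (1 / 2 : ℝ) • (M.D i (M.g j l) + M.D j (M.g i l) - M.D l (M.g i j)) := by
  set c : Fin n → 𝒜 := fun l => M.D i (M.g j l) + M.D j (M.g i l) - M.D l (M.g i j)
  have h1 : (fun k => M.Γ k i j) = (1 / 2 : ℝ) • M.h.mulVec c := by
    ext k; simp [Γ, Matrix.mulVec, dotProduct, c]
  have h2 : M.g.mulVec (fun k => M.Γ k i j) = (1 / 2 : ℝ) • c := by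
    rw [h1, Matrix.mulVec_smul, Matrix.mulVec_mulVec, M.gh, Matrix.one_mulVec]
  exact congrFun h2 l

lemma map_g (m : Fin n) : M.g.map (M.D m) = (M.conn m)ᵀ * M.g + M.g * M.conn m := by
  ext j k
  have h1 := M.lower_Γ k m j
  have h2 := M.lower_Γ j m k
  have e1 : ((M.conn m)ᵀ * M.g) j k = ∑ p, M.g k p * M.Γ p m j := by
    simp only [Matrix.mul_apply, conn, Matrix.transpose_apply, Matrix.of_apply]
    exact Finset.sum_congr rfl fun p _ => by rw [M.g_comm p k]; ring
  have e2 : (M.g * M.conn m) j k = ∑ p, M.g j p * M.Γ p m k := by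
    simp only [Matrix.mul_apply, conn, Matrix.of_apply]
  rw [Matrix.add_apply, e1, e2, h1, h2, ← smul_add, Matrix.map_apply, M.g_comm k j]
  have : M.D m (M.g j k) + M.D j (M.g m k) - M.D k (M.g m j) +
      (M.D m (M.g j k) + M.D k (M.g m j) - M.D j (M.g m k)) = (2 : ℝ) • M.D m (M.g j k) := by
    rw [two_smul]; ring
  rw [this, smul_smul]; norm_num

lemma map_h (m : Fin n) : M.h.map (M.D m) = -(M.conn m * M.h) - M.h * (M.conn m)ᵀ := by
  have h1 := congrArg (fun A => Matrix.map A (M.D m)) M.gh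
  simp only [Matrix.map_derivation_mul, Matrix.map_derivation_one, M.map_g] at h1
  have h2 : M.h * (((M.conn m)ᵀ * M.g + M.g * M.conn m) * M.h + M.g * M.h.map (M.D m)) = 0 := by
    rw [h1, mul_zero]
  have h3 : M.h * (((M.conn m)ᵀ * M.g + M.g * M.conn m) * M.h + M.g * M.h.map (M.D m))
      = M.h * (M.conn m)ᵀ * (M.g * M.h) + (M.h * M.g) * M.conn m * M.h
        + (M.h * M.g) * M.h.map (M.D m) := by noncomm_ring
  rw [h3, M.gh, M.hg, mul_one, one_mul, one_mul] at h2
  rw [eq_sub_iff_add_eq, eq_neg_iff_add_eq_zero]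
  rw [← h2]; abel

lemma map_map_comm (A : Matrix (Fin n) (Fin n) 𝒜) (i j : Fin n) :
    (A.map (M.D i)).map (M.D j) = (A.map (M.D j)).map (M.D i) := by
  ext a b; simp [M.comm i j]

lemma map_add' (A B : Matrix (Fin n) (Fin n) 𝒜) (i : Fin n) :
    (A + B).map (M.D i) = A.map (M.D i) + B.map (M.D i) := by
  ext a b; simp

lemma map_sub' (A B : Matrix (Fin n) (Fin n) 𝒜) (i : Fin n) :
    (A - B).map (M.D i) = A.map (M.D i) - B.map (M.D i) := by
  ext a b; simp

lemma map_transpose' (A : Matrix (Fin n) (Fin n) 𝒜) (i : Fin n) :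
    (Aᵀ).map (M.D i) = (A.map (M.D i))ᵀ := rfl

lemma g_mul_F (i j : Fin n) : M.g * M.F i j + (M.F i j)ᵀ * M.g = 0 := by
  have h1 := M.map_map_comm M.g j i
  rw [M.map_g j, M.map_g i, M.map_add', M.map_add'] at h1
  simp only [Matrix.map_derivation_mul, M.map_g, M.map_transpose'] at h1
  have h2 := sub_eq_zero.mpr h1
  rw [← h2]
  simp only [F, Matrix.transpose_add, Matrix.transpose_sub, Matrix.transpose_mul]
  noncomm_ring

lemma F_neg (i j : Fin n) : M.F j i = - M.F i j := by
  unfold F; noncomm_ring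

/-- The curvature matrices with the last index raised. -/
def P (i j : Fin n) : Matrix (Fin n) (Fin n) 𝒜 := M.F i j * M.h

lemma P_transpose (i j : Fin n) : (M.P i j)ᵀ = - M.P i j := by
  have h1 := M.g_mul_F i j
  have h2 : M.h * (M.g * M.F i j + (M.F i j)ᵀ * M.g) * M.h = 0 := by rw [h1]; simp
  have h3 : M.h * (M.g * M.F i j + (M.F i j)ᵀ * M.g) * M.h
    = (M.h * M.g) * M.F i j * M.h + M.h * (M.F i j)ᵀ * (M.g * M.h) := by noncomm_ring
  rw [h3, M.gh, M.hg, mul_one, one_mul] at h2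
  unfold P
  rw [Matrix.transpose_mul, M.h_symm, eq_neg_iff_add_eq_zero, ← h2, add_comm]

lemma P_swap (i j a b : Fin n) : M.P i j a b = - M.P i j b a := by
  have := congrFun (congrFun (M.P_transpose i j) b) a
  simpa using this

lemma P_neg (i j a b : Fin n) : M.P j i a b = - M.P i j a b := by
  unfold P; rw [M.F_neg]; simp

lemma Ric_eq (j k : Fin n) : M.Ric j k = ∑ i, M.F i j i k := by
  unfold Ric F
  refine Finset.sum_congr rfl fun i _ => ?_
  simp only [Matrix.sub_apply, Matrix.add_apply, Matrix.map_apply, conn, Matrix.of_apply,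
    Matrix.mul_apply, Finset.sum_sub_distrib]
  ring

/-- First Bianchi identity. -/
lemma bianchi_first (i j k l : Fin n) : M.F i j l k + M.F j k l i + M.F k i l j = 0 := by
  simp only [F, Matrix.sub_apply, Matrix.add_apply, Matrix.map_apply, conn, Matrix.of_apply,
    Matrix.mul_apply]
  rw [M.Γ_comm l k i, M.Γ_comm l k j, M.Γ_comm l j i]
  simp only [M.Γ_comm _ k i, M.Γ_comm _ k j, M.Γ_comm _ j i]
  ring

lemma trace_F (i j : Fin n) : ∑ a, M.F i j a a = 0 := by
  have h1 : M.F i j = M.P i j * M.g := by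
    unfold P; rw [mul_assoc, M.hg, mul_one]
  have h2 : (M.P i j * M.g).trace = -(M.P i j * M.g).trace := by
    conv_lhs => rw [← Matrix.trace_transpose, Matrix.transpose_mul, M.symm, M.P_transpose,
      Matrix.mul_neg, Matrix.trace_neg, Matrix.trace_mul_comm]
  have h3 : (M.F i j).trace = 0 := by
    have h4 : (2 : ℝ) • (M.P i j * M.g).trace = 0 := by
      rw [two_smul]; nth_rewrite 1 [h2]; simp
    have h5 := congrArg (fun x => (1 / 2 : ℝ) • x) h4
    simp only [smul_smul, smul_zero] at h5
    rw [h1]; norm_num at h5; exact h5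
  exact h3

lemma Ric_comm (j k : Fin n) : M.Ric j k = M.Ric k j := by
  rw [← sub_eq_zero, M.Ric_eq, M.Ric_eq, ← Finset.sum_sub_distrib, ← M.trace_F k j,
    ← sub_eq_zero, ← Finset.sum_sub_distrib]
  refine Finset.sum_eq_zero fun i _ => ?_
  have := M.bianchi_first i j k i
  have h1 : M.F k i i j = - M.F i k i j := by rw [M.F_neg]; rfl
  have h2 : M.F k j i i = - M.F j k i i := by rw [M.F_neg]; rfl
  rw [h2, ← this, h1]; ring

/-- Second Bianchi identity. -/
lemma bianchi_second (i j k : Fin n) :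
    ((M.F j k).map (M.D i) + M.conn i * M.F j k - M.F j k * M.conn i)
    + ((M.F k i).map (M.D j) + M.conn j * M.F k i - M.F k i * M.conn j)
    + ((M.F i j).map (M.D k) + M.conn k * M.F i j - M.F i j * M.conn k) = 0 := by
  simp only [F, M.map_sub', M.map_add', Matrix.map_derivation_mul]
  rw [M.map_map_comm (M.conn k) j i, M.map_map_comm (M.conn j) k i, M.map_map_comm (M.conn i) k j]
  noncomm_ring

lemma map_P (i j k : Fin n) : (M.P j k).map (M.D i) + M.P j k * (M.conn i)ᵀ + M.conn i * M.P j k =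
    ((M.F j k).map (M.D i) + M.conn i * M.F j k - M.F j k * M.conn i) * M.h := by
  simp only [P, Matrix.map_derivation_mul, M.map_h]
  noncomm_ring

lemma bianchi_P (i j k : Fin n) :
    ((M.P j k).map (M.D i) + M.P j k * (M.conn i)ᵀ + M.conn i * M.P j k)
    + ((M.P k i).map (M.D j) + M.P k i * (M.conn j)ᵀ + M.conn j * M.P k i)
    + ((M.P i j).map (M.D k) + M.P i j * (M.conn k)ᵀ + M.conn k * M.P i j) = 0 := by
  simp only [M.map_P, ← add_mul, M.bianchi_second, zero_mul]

/-- Ricci tensor with the second index raised. -/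
def Q (k b : Fin n) : 𝒜 := ∑ m, M.Ric k m * M.h m b

lemma Q_eq (k b : Fin n) : M.Q k b = ∑ i, M.P i k i b := by
  simp only [Q, P, M.Ric_eq, Matrix.mul_apply, Finset.sum_mul]
  exact Finset.sum_comm

lemma Q_eq' (k b : Fin n) : M.Q k b = - ∑ i, M.P i k b i := by
  rw [M.Q_eq, ← Finset.sum_neg_distrib]
  exact Finset.sum_congr rfl fun i _ => M.P_swap _ _ _ _

lemma scal_eq : M.scal = ∑ j, M.Q j j := by
  unfold scal Q
  refine Finset.sum_congr rfl fun j _ => Finset.sum_congr rfl fun k _ => ?_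
  rw [M.h_comm]; ring

lemma sum_antisymm (X Y : Fin n → Fin n → 𝒜) (hX : ∀ i j, X i j = X j i)
    (hY : ∀ i j, Y i j = - Y j i) : ∑ i, ∑ j, X i j * Y i j = 0 := by
  have h2 : ∑ i, ∑ j, X i j * Y i j = - ∑ i, ∑ j, X i j * Y i j := by
    conv_lhs => rw [Finset.sum_comm]
    simp only [← Finset.sum_neg_distrib]
    refine Finset.sum_congr rfl fun j _ => Finset.sum_congr rfl fun k _ => ?_
    rw [hX, hY]; ring
  have h4 : (2 : ℝ) • ∑ i, ∑ j, X i j * Y i j = 0 := by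
    rw [two_smul]; nth_rewrite 1 [h2]; simp
  have h5 := congrArg (fun x => (1 / 2 : ℝ) • x) h4
  simp only [smul_smul, smul_zero] at h5
  norm_num at h5; exact h5

/-- Contracted second Bianchi identity. -/
lemma contracted_bianchi (k : Fin n) : M.D k M.scal + 2 * ∑ i, ∑ p, M.Γ i k p * M.Q i p =
    2 * ∑ i, M.D i (M.Q k i) + 2 * ∑ i, ∑ p, M.Γ i i p * M.Q k p := by
  have h0 : ∑ i, ∑ j, (((M.P j k).map (M.D i) + M.P j k * (M.conn i)ᵀ + M.conn i * M.P j k)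
    + ((M.P k i).map (M.D j) + M.P k i * (M.conn j)ᵀ + M.conn j * M.P k i)
    + ((M.P i j).map (M.D k) + M.P i j * (M.conn k)ᵀ + M.conn k * M.P i j)) i j = 0 := by
    simp only [M.bianchi_P, Matrix.zero_apply, Finset.sum_const_zero]
  simp only [Matrix.add_apply, Finset.sum_add_distrib] at h0
  have a1 : ∑ i, ∑ j, ((M.P j k).map (M.D i)) i j = - ∑ i, M.D i (M.Q k i) := by
    simp only [Matrix.map_apply, M.Q_eq', ← map_sum, map_neg, Finset.sum_neg_distrib, neg_neg]
  have a2 : ∑ i, ∑ j, (M.P j k * (M.conn i)ᵀ) i j = 0 := by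
    simp only [Matrix.mul_apply, Matrix.transpose_apply, conn, Matrix.of_apply]
    have : ∀ i j, ∑ p, M.P j k i p * M.Γ j i p = ∑ p, M.Γ j i p * M.P j k i p := fun i j =>
      Finset.sum_congr rfl fun p _ => mul_comm _ _
    simp only [this]
    rw [Finset.sum_comm]
    exact Finset.sum_eq_zero fun j _ => sum_antisymm _ _ (fun a b => M.Γ_comm _ _ _)
      (fun a b => M.P_swap _ _ _ _)
  have a3 : ∑ i, ∑ j, (M.conn i * M.P j k) i j = - ∑ i, ∑ p, M.Γ i i p * M.Q k p := by
    simp only [Matrix.mul_apply, conn, Matrix.of_apply, M.Q_eq', mul_neg, Finset.sum_neg_distrib,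
      neg_neg, Finset.mul_sum]
    exact Finset.sum_congr rfl fun i _ => Finset.sum_comm
  have b1 : ∑ i, ∑ j, ((M.P k i).map (M.D j)) i j = - ∑ i, M.D i (M.Q k i) := by
    rw [Finset.sum_comm]
    simp only [Matrix.map_apply, M.P_neg _ k, map_neg, Finset.sum_neg_distrib, M.Q_eq, ← map_sum]
  have b2 : ∑ i, ∑ j, (M.P k i * (M.conn j)ᵀ) i j = - ∑ i, ∑ p, M.Γ i i p * M.Q k p := by
    rw [Finset.sum_comm]
    simp only [Matrix.mul_apply, Matrix.transpose_apply, conn, Matrix.of_apply, M.P_neg _ k,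
      M.Q_eq, Finset.mul_sum, ← Finset.sum_neg_distrib]
    refine Finset.sum_congr rfl fun j _ => ?_
    rw [Finset.sum_comm]
    refine Finset.sum_congr rfl fun p _ => Finset.sum_congr rfl fun i _ => by ring
  have b3 : ∑ i, ∑ j, (M.conn j * M.P k i) i j = 0 := by
    simp only [Matrix.mul_apply, conn, Matrix.of_apply]
    exact Finset.sum_eq_zero fun i _ => sum_antisymm _ _ (fun a b => M.Γ_comm _ _ _)
      (fun a b => M.P_swap _ _ _ _)
  have c1 : ∑ i, ∑ j, ((M.P i j).map (M.D k)) i j = M.D k M.scal := by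
    rw [Finset.sum_comm]
    simp only [Matrix.map_apply, M.scal_eq, M.Q_eq, map_sum]
  have c2 : ∑ i, ∑ j, (M.P i j * (M.conn k)ᵀ) i j = ∑ i, ∑ p, M.Γ i k p * M.Q i p := by
    rw [Finset.sum_comm]
    simp only [Matrix.mul_apply, Matrix.transpose_apply, conn, Matrix.of_apply,
      M.Q_eq, Finset.mul_sum]
    refine Finset.sum_congr rfl fun j _ => ?_
    rw [Finset.sum_comm]
    refine Finset.sum_congr rfl fun p _ => Finset.sum_congr rfl fun i _ => by ring
  have c3 : ∑ i, ∑ j, (M.conn k * M.P i j) i j = ∑ i, ∑ p, M.Γ i k p * M.Q i p := by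
    simp only [Matrix.mul_apply, conn, Matrix.of_apply, M.Q_eq, Finset.mul_sum]
    refine Finset.sum_congr rfl fun i _ => ?_
    rw [Finset.sum_comm]
    refine Finset.sum_congr rfl fun p _ => Finset.sum_congr rfl fun j _ => ?_
    rw [M.P_neg j i, M.P_swap j i p j]; ring
  rw [a1, a2, a3, b1, b2, b3, c1, c2, c3] at h0
  linear_combination h0

end FormalMetric

namespace FormalMetric

variable {n : ℕ} {𝒜 : Type*} [CommRing 𝒜] [Algebra ℝ 𝒜] (M : FormalMetric n 𝒜)

/-- The Ricci tensor as a matrix. -/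
def ricM : Matrix (Fin n) (Fin n) 𝒜 := Matrix.of M.Ric

/-- The Ricci tensor with both indices raised. -/
def Z : Matrix (Fin n) (Fin n) 𝒜 := M.h * M.ricM * M.h

lemma Z_eq (i j : Fin n) : M.Z i j = ∑ k, M.h i k * M.Q k j := by
  unfold Z; rw [mul_assoc, Matrix.mul_apply]; rfl

lemma ricM_symm : M.ricMᵀ = M.ricM := by
  ext i j; exact M.Ric_comm j i

lemma Z_symm : M.Zᵀ = M.Z := by
  unfold Z; rw [Matrix.transpose_mul, Matrix.transpose_mul, M.h_symm, M.ricM_symm, mul_assoc]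

lemma Z_comm (i j : Fin n) : M.Z i j = M.Z j i := congrFun (congrFun M.Z_symm j) i

lemma map_h_gen (d : Derivation ℝ 𝒜 𝒜) : M.h.map d = - (M.h * M.g.map d * M.h) := by
  have h1 := congrArg (fun A => Matrix.map A d) M.hg
  simp only [Matrix.map_derivation_mul, Matrix.map_derivation_one] at h1
  have h2 : (M.h.map d * M.g + M.h * M.g.map d) * M.h = 0 := by rw [h1, zero_mul]
  rw [add_mul, mul_assoc, M.gh, mul_one] at h2
  exact eq_neg_of_add_eq_zero_left h2

lemma sum_rotate {R : Type*} [AddCommMonoid R] (f : Fin n → Fin n → Fin n → R) :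
    ∑ j, ∑ k, ∑ i, f j k i = ∑ i, ∑ j, ∑ k, f j k i :=
  (Finset.sum_congr rfl fun _ _ => Finset.sum_comm).trans Finset.sum_comm

omit [Algebra ℝ 𝒜] in
lemma sum_sum_mul_eq_trace (A B : Matrix (Fin n) (Fin n) 𝒜) (hB : Bᵀ = B) :
    ∑ j, ∑ l, A j l * B j l = (A * B).trace := by
  simp only [Matrix.trace, Matrix.diag, Matrix.mul_apply]
  refine Finset.sum_congr rfl fun j _ => Finset.sum_congr rfl fun l _ => ?_
  rw [show B j l = B l j from congrFun (congrFun hB l) j]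

lemma trace_Γ (p : Fin n) :
    ∑ j, M.Γ j j p = (1 / 2 : ℝ) • ∑ j, ∑ l, M.h j l * M.D p (M.g j l) := by
  simp only [Γ, ← Finset.smul_sum]
  congr 1
  have h1 : ∑ j, ∑ l, M.h j l * (M.D j (M.g p l) - M.D l (M.g j p)) = 0 :=
    sum_antisymm _ _ (fun a b => M.h_comm _ _) fun a b => by
      rw [M.g_comm p b, M.g_comm a p]; ring
  rw [← sub_eq_zero, ← h1, ← Finset.sum_sub_distrib]
  refine Finset.sum_congr rfl fun j _ => ?_
  rw [← Finset.sum_sub_distrib]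
  exact Finset.sum_congr rfl fun l _ => by ring

lemma h_contract_Γ (i : Fin n) : ∑ j, ∑ k, M.h j k * M.Γ i j k =
    - ∑ j, M.D j (M.h i j) - ∑ j, ∑ p, M.h i p * M.Γ j j p := by
  have h1 : ∀ j, M.D j (M.h i j) = - ∑ p, M.Γ i j p * M.h p j - ∑ p, M.h i p * M.Γ j j p := by
    intro j
    have := congrFun (congrFun (M.map_h j) i) j
    simpa [Matrix.mul_apply, conn] using this
  simp only [h1, Finset.sum_sub_distrib, Finset.sum_neg_distrib]
  rw [Finset.sum_congr rfl fun j _ => Finset.sum_congr rfl fun k _ =>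
    show M.h j k * M.Γ i j k = M.Γ i j k * M.h k j by rw [M.h_comm]; ring]
  ring

variable (dt : Derivation ℝ 𝒜 𝒜) (hcomm : ∀ i f, dt (M.D i f) = M.D i (dt f))
  (hflow : ∀ j k, dt (M.g j k) = -2 * M.Ric j k)

include hflow in
lemma map_h_time (i j : Fin n) : dt (M.h i j) = 2 * M.Z i j := by
  have h1 : M.g.map dt = (-2 : 𝒜) • M.ricM := by
    ext j k; simp [hflow, ricM]
  have := congrFun (congrFun (M.map_h_gen dt) i) j
  rw [h1] at this
  simpa [Z] using this

include hcomm hflow in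
lemma trace_Γ_time (p : Fin n) : ∑ j, dt (M.Γ j j p) = - M.D p M.scal := by
  rw [← map_sum, M.trace_Γ, Derivation.map_smul]
  simp only [map_sum, Derivation.leibniz, smul_eq_mul, hcomm, hflow, M.map_h_time dt hflow]
  have d2 : M.D p (-2 : 𝒜) = 0 := by
    rw [map_neg, neg_eq_zero]; exact_mod_cast Derivation.map_natCast (M.D p) 2
  have h3 : ∀ j l, M.h j l * (-2 * M.D p (M.Ric j l) + M.Ric j l * M.D p (-2))
      + M.D p (M.g j l) * (2 * M.Z j l)
      = (2 : ℝ) • (M.Z j l * M.D p (M.g j l) - M.h j l * M.D p (M.Ric j l)) := by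
    intro j l
    rw [two_smul, d2]; ring
  simp only [h3, ← Finset.smul_sum, smul_smul]
  norm_num
  have h4 : ∑ j, ∑ l, M.Z j l * M.D p (M.g j l)
      = - ∑ j, ∑ l, M.D p (M.h j l) * M.Ric j l := by
    have e1 := sum_sum_mul_eq_trace M.Z (M.g.map (M.D p))
      (by rw [← M.map_transpose', M.symm])
    have e2 := sum_sum_mul_eq_trace (M.h.map (M.D p)) M.ricM M.ricM_symm
    simp only [Matrix.map_apply] at e1 e2
    rw [e1]
    have e3 : ∑ j, ∑ l, M.D p (M.h j l) * M.Ric j l = ((M.h.map (M.D p)) * M.ricM).trace := e2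
    rw [e3, M.map_h_gen, Matrix.neg_mul, Matrix.trace_neg, neg_neg, Z]
    rw [Matrix.mul_assoc M.h M.ricM, Matrix.trace_mul_comm, ← Matrix.mul_assoc,
      Matrix.trace_mul_comm]
    simp only [Matrix.mul_assoc]
    rw [Matrix.trace_mul_comm]
    simp only [Matrix.mul_assoc]
  have h5 : M.D p M.scal = ∑ j, ∑ l, M.h j l * M.D p (M.Ric j l) +
      ∑ j, ∑ l, M.D p (M.h j l) * M.Ric j l := by
    simp only [scal, map_sum, Derivation.leibniz, smul_eq_mul, ← Finset.sum_add_distrib]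
    exact Finset.sum_congr rfl fun j _ => Finset.sum_congr rfl fun l _ => by ring
  rw [h4, h5]; ring

include hcomm hflow in
lemma h_contract_Γ_time (i : Fin n) : ∑ j, ∑ k, M.h j k * dt (M.Γ i j k) = 0 := by
  have h1 := congrArg dt (M.h_contract_Γ i)
  simp only [map_sum, map_sub, map_neg, Derivation.leibniz, smul_eq_mul, hcomm,
    M.map_h_time dt hflow] at h1
  simp only [Finset.sum_add_distrib] at h1
  have h2 : ∑ j, ∑ p, M.h i p * dt (M.Γ j j p) = - ∑ p, M.h i p * M.D p M.scal := by
    rw [Finset.sum_comm]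
    simp only [← Finset.mul_sum, M.trace_Γ_time dt hcomm hflow, mul_neg, Finset.sum_neg_distrib]
  have h4 : ∀ j, M.D j (M.Z i j) = ∑ k, M.h i k * M.D j (M.Q k j) - ∑ p, M.Γ i j p * M.Z p j
      - ∑ p, M.h i p * ∑ k, M.Γ k j p * M.Q k j := by
    intro j
    have e1 : ∀ k, M.D j (M.h i k) = - ∑ p, M.Γ i j p * M.h p k - ∑ p, M.h i p * M.Γ k j p := by
      intro k
      have := congrFun (congrFun (M.map_h j) i) k
      simpa [Matrix.mul_apply, conn] using this
    simp only [M.Z_eq, map_sum, Derivation.leibniz, smul_eq_mul, e1, Finset.sum_add_distrib]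
    have e2 : ∑ k, M.Q k j * (- ∑ p, M.Γ i j p * M.h p k - ∑ p, M.h i p * M.Γ k j p) =
      - ∑ p, M.Γ i j p * (∑ k, M.h p k * M.Q k j) - ∑ p, M.h i p * ∑ k, M.Γ k j p * M.Q k j := by
      simp only [mul_sub, mul_neg, Finset.sum_sub_distrib, Finset.sum_neg_distrib, Finset.mul_sum]
      congr 1
      · congr 1
        rw [Finset.sum_comm]
        exact Finset.sum_congr rfl fun j _ => Finset.sum_congr rfl fun l _ => by ring
      · rw [Finset.sum_comm]
        exact Finset.sum_congr rfl fun j _ => Finset.sum_congr rfl fun l _ => by ring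
    rw [e2]; ring
  have h5 := Finset.sum_congr rfl fun k (_ : k ∈ Finset.univ) =>
    congrArg (fun x => M.h i k * x) (M.contracted_bianchi k)
  simp only [mul_add, Finset.sum_add_distrib] at h5
  have d2 : ∀ j, M.D j (2 : 𝒜) = 0 := fun j => by exact_mod_cast Derivation.map_natCast (M.D j) 2
  simp only [d2, mul_zero, Finset.sum_const_zero, add_zero, ← Finset.mul_sum] at h1
  rw [h2] at h1
  simp only [h4, Finset.sum_sub_distrib] at h1
  have s1 : ∑ k, M.h i k * (2 * ∑ a, M.D a (M.Q k a)) =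
      2 * ∑ j, ∑ k, M.h i k * M.D j (M.Q k j) := by
    rw [Finset.sum_comm]
    simp only [Finset.mul_sum]
    exact Finset.sum_congr rfl fun j _ => Finset.sum_congr rfl fun l _ => by ring
  have s2 : ∑ k, M.h i k * (2 * ∑ a, ∑ p, M.Γ a a p * M.Q k p) =
      ∑ j, ∑ p, M.Γ j j p * (2 * M.Z i p) := by
    simp only [M.Z_eq, Finset.mul_sum]
    rw [Finset.sum_comm]
    refine Finset.sum_congr rfl fun j _ => ?_
    rw [Finset.sum_comm]
    refine Finset.sum_congr rfl fun l _ => Finset.sum_congr rfl fun l _ => by ring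
  have s3 : ∑ k, M.h i k * (2 * ∑ a, ∑ p, M.Γ a k p * M.Q a p) =
      2 * ∑ j, ∑ p, M.h i p * ∑ k, M.Γ k j p * M.Q k j := by
    simp only [Finset.mul_sum]
    refine (sum_rotate _).trans (Finset.sum_congr rfl fun j _ => Finset.sum_congr rfl fun p _ =>
      Finset.sum_congr rfl fun k _ => ?_)
    rw [M.Γ_comm k p j]; ring
  have s4 : ∑ j, ∑ k, M.Γ i j k * (2 * M.Z j k) = 2 * ∑ j, ∑ p, M.Γ i j p * M.Z p j := by
    simp only [Finset.mul_sum]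
    refine Finset.sum_congr rfl fun j _ => Finset.sum_congr rfl fun l _ => ?_
    rw [M.Z_comm]; ring
  rw [s1, s2, s3] at h5
  rw [s4] at h1
  linear_combination h1 + h5

include hcomm hflow in
/-- Evolution of the scalar curvature under Ricci flow. -/
theorem scal_time : dt M.scal =
    ∑ j, ∑ k, M.h j k * (M.D j (M.D k M.scal) - ∑ p, M.Γ p j k * M.D p M.scal)
      + 2 * ∑ j, ∑ k, M.Z j k * M.Ric j k := by
  have h1 : dt M.scal = ∑ j, ∑ k, M.h j k * dt (M.Ric j k) +
      2 * ∑ j, ∑ k, M.Z j k * M.Ric j k := by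
    simp only [scal, map_sum, Derivation.leibniz, smul_eq_mul, Finset.mul_sum,
      M.map_h_time dt hflow, ← Finset.sum_add_distrib]
    exact Finset.sum_congr rfl fun j _ => Finset.sum_congr rfl fun l _ => by ring
  rw [h1]
  congr 1
  have h2 : ∀ j k, dt (M.Ric j k) = ∑ i, (M.D i (dt (M.Γ i j k)))
      - M.D j (∑ i, dt (M.Γ i i k)) + ∑ p, (∑ i, dt (M.Γ i i p)) * M.Γ p j k
      + ∑ i, ∑ p, M.Γ i i p * dt (M.Γ p j k) - ∑ i, ∑ p, dt (M.Γ i j p) * M.Γ p i k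
      - ∑ i, ∑ p, M.Γ i j p * dt (M.Γ p i k) := by
    intro j k
    simp only [Ric, map_sum, map_add, map_sub, Derivation.leibniz, smul_eq_mul, hcomm,
      Finset.sum_add_distrib, Finset.sum_sub_distrib, Finset.sum_mul]
    rw [Finset.sum_comm (f := fun p i => dt (M.Γ i i p) * M.Γ p j k)]
    simp only [mul_comm (dt _)]
    ring
  simp only [M.trace_Γ_time dt hcomm hflow] at h2
  have h3 : ∀ i, ∑ j, ∑ k, M.h j k * M.D i (dt (M.Γ i j k)) =
      ∑ j, ∑ k, ∑ p, (M.Γ j i p * M.h p k + M.h j p * M.Γ k i p) * dt (M.Γ i j k) := by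
    intro i
    have e1 : ∀ j k, M.D i (M.h j k) = - ∑ p, (M.Γ j i p * M.h p k + M.h j p * M.Γ k i p) := by
      intro j k
      have := congrFun (congrFun (M.map_h i) j) k
      rw [Finset.sum_add_distrib, neg_add]
      simpa [Matrix.mul_apply, conn, sub_eq_add_neg] using this
    have e2 := congrArg (M.D i) (M.h_contract_Γ_time dt hcomm hflow i)
    simp only [map_sum, map_zero, Derivation.leibniz, smul_eq_mul, e1, Finset.sum_add_distrib,
      mul_neg, Finset.sum_neg_distrib] at e2
    rw [add_neg_eq_zero] at e2
    rw [e2]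
    simp only [Finset.mul_sum, Finset.sum_add_distrib, add_mul, mul_add]
    congr 1 <;> exact Finset.sum_congr rfl fun j _ => Finset.sum_congr rfl fun l _ =>
      Finset.sum_congr rfl fun l _ => by ring
  have h4 : ∑ j, ∑ k, M.h j k * ∑ i, M.D i (dt (M.Γ i j k)) =
      ∑ j, ∑ k, M.h j k * (∑ i, ∑ p, dt (M.Γ i j p) * M.Γ p i k) +
      ∑ j, ∑ k, M.h j k * (∑ i, ∑ p, M.Γ i j p * dt (M.Γ p i k)) := by
    simp only [Finset.mul_sum]
    rw [Finset.sum_congr rfl fun (p : Fin n) _ => Finset.sum_comm, Finset.sum_comm]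
    simp only [h3]
    simp only [add_mul, Finset.sum_add_distrib]
    rw [add_comm]
    refine congrArg₂ (· + ·) ?_ ?_
    · refine Finset.sum_comm.trans (Finset.sum_congr rfl fun j _ =>
        (sum_rotate _).trans (Finset.sum_congr rfl fun p _ =>
          Finset.sum_congr rfl fun i _ => Finset.sum_congr rfl fun k _ => ?_))
      ring
    · refine ((Finset.sum_congr rfl fun i _ => sum_rotate _).trans Finset.sum_comm).trans
        (Finset.sum_congr rfl fun p _ => (sum_rotate _).trans (Finset.sum_congr rfl fun k _ =>
          Finset.sum_comm.trans (Finset.sum_congr rfl fun j _ =>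
            Finset.sum_congr rfl fun i _ => ?_)))
      rw [M.Γ_comm j i p, M.Γ_comm i j k]; ring
  have h5 : ∑ j, ∑ k, M.h j k * (∑ i, ∑ p, M.Γ i i p * dt (M.Γ p j k)) = 0 := by
    simp only [Finset.mul_sum]
    refine (sum_rotate _).trans (Finset.sum_eq_zero fun i _ => (sum_rotate _).trans
      (Finset.sum_eq_zero fun p _ => ?_))
    have := M.h_contract_Γ_time dt hcomm hflow p
    rw [← mul_zero (M.Γ i i p), ← this]
    simp only [Finset.mul_sum]
    exact Finset.sum_congr rfl fun j _ => Finset.sum_congr rfl fun l _ => by ring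
  simp only [h2]
  simp only [mul_add, mul_sub, Finset.sum_add_distrib, Finset.sum_sub_distrib]
  rw [h4, h5]
  simp only [map_neg, neg_mul, Finset.sum_neg_distrib, mul_neg, mul_comm (M.D _ M.scal)]
  ring

end FormalMetric

section Smooth

variable {X : Type*} [NormedAddCommGroup X] [NormedSpace ℝ X] {n : ℕ}

lemma contDiffOn_det {S : Set X} {G : X → Matrix (Fin n) (Fin n) ℝ}
    (hG : ∀ i j, ContDiffOn ℝ (⊤ : ℕ∞) (fun x => G x i j) S) :
    ContDiffOn ℝ (⊤ : ℕ∞) (fun x => (G x).det) S := by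
  simp only [Matrix.det_apply']
  exact ContDiffOn.sum fun σ _ => contDiffOn_const.mul (contDiffOn_prod fun i _ => hG _ _)

lemma contDiffOn_inv_entry {S : Set X} {G : X → Matrix (Fin n) (Fin n) ℝ}
    (hG : ∀ i j, ContDiffOn ℝ (⊤ : ℕ∞) (fun x => G x i j) S) (hdet : ∀ x ∈ S, (G x).det ≠ 0)
    (i j : Fin n) : ContDiffOn ℝ (⊤ : ℕ∞) (fun x => (G x)⁻¹ i j) S := by
  simp only [Matrix.inv_def, Ring.inverse_eq_inv', Matrix.smul_apply, smul_eq_mul,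
    Matrix.adjugate_apply]
  refine ((contDiffOn_det hG).inv hdet).mul (contDiffOn_det fun a b => ?_)
  simp only [Matrix.updateRow_apply]
  split_ifs
  · exact contDiffOn_const
  · exact hG _ _

/-- Partial differentiation in the first variable preserves smoothness up to the boundary in
time. -/
lemma contDiffOn_fderiv_fst {F : Type*} [NormedAddCommGroup F] [NormedSpace ℝ F] {T : ℝ}
    (hT : 0 < T) {f : X × ℝ → F}
    (hf : ContDiffOn ℝ (⊤ : ℕ∞) f (univ ×ˢ Icc 0 T)) (v : X) :
    ContDiffOn ℝ (⊤ : ℕ∞) (fun p : X × ℝ => fderiv ℝ (fun y => f (y, p.2)) p.1 v)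
      (univ ×ˢ Icc 0 T) := by
  have hu : UniqueDiffOn ℝ ((univ : Set X) ×ˢ Icc (0 : ℝ) T) :=
    uniqueDiffOn_univ.prod (uniqueDiffOn_Icc hT)
  have h1 : ContDiffOn ℝ (⊤ : ℕ∞)
      (fun p : X × ℝ => fderivWithin ℝ f (univ ×ˢ Icc 0 T) p (v, 0)) (univ ×ˢ Icc 0 T) :=
    (hf.fderivWithin hu (by exact le_rfl)).clm_apply contDiffOn_const
  refine h1.congr fun p hp => ?_
  have hd : DifferentiableWithinAt ℝ f (univ ×ˢ Icc 0 T) p :=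
    (hf p hp).differentiableWithinAt (by simp)
  have h2 := hd.hasFDerivWithinAt.comp (x := p.1) (s := univ) (f := fun y => (y, p.2))
    (f' := ContinuousLinearMap.inl ℝ X ℝ)
    ((hasFDerivAt_prodMk_left p.1 p.2).hasFDerivWithinAt) (fun y _ => ⟨trivial, hp.2⟩)
  rw [hasFDerivWithinAt_univ] at h2
  have h3 := h2.fderiv
  change fderiv ℝ (fun y => f (y, p.2)) p.1 = _ at h3
  rw [h3]; rfl

lemma ContDiffOn.slice {F : Type*} [NormedAddCommGroup F] [NormedSpace ℝ F] {I : Set ℝ}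
    {f : X × ℝ → F} (hf : ContDiffOn ℝ (⊤ : ℕ∞) f (univ ×ˢ I)) {t : ℝ} (ht : t ∈ I) :
    ContDiff ℝ (⊤ : ℕ∞) (fun y => f (y, t)) := by
  rw [← contDiffOn_univ]
  exact hf.comp (by fun_prop) fun y _ => ⟨trivial, ht⟩

/-- The algebra of smooth functions. -/
def SmoothAlg (X : Type*) [NormedAddCommGroup X] [NormedSpace ℝ X] : Subalgebra ℝ (X → ℝ) where
  carrier := {f | ContDiff ℝ (⊤ : ℕ∞) f}
  mul_mem' {a b} (ha : ContDiff ℝ (⊤ : ℕ∞) a) (hb : ContDiff ℝ (⊤ : ℕ∞) b) := ha.mul hb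
  add_mem' {a b} (ha : ContDiff ℝ (⊤ : ℕ∞) a) (hb : ContDiff ℝ (⊤ : ℕ∞) b) := ha.add hb
  algebraMap_mem' r := show ContDiff ℝ (⊤ : ℕ∞) (fun _ => r) from contDiff_const

lemma SmoothAlg.contDiff (f : SmoothAlg X) : ContDiff ℝ (⊤ : ℕ∞) f.1 := f.2

lemma SmoothAlg.differentiableAt (f : SmoothAlg X) (p : X) : DifferentiableAt ℝ f.1 p :=
  (SmoothAlg.contDiff f).differentiable (by simp) p

lemma contDiff_fderiv_apply_const {f : X → ℝ} (hf : ContDiff ℝ (⊤ : ℕ∞) f) (v : X) :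
    ContDiff ℝ (⊤ : ℕ∞) (fun p => fderiv ℝ f p v) :=
  (hf.fderiv_right (by exact le_rfl)).clm_apply contDiff_const

/-- Directional derivative as a derivation of the algebra of smooth functions. -/
def dirD (v : X) : Derivation ℝ (SmoothAlg X) (SmoothAlg X) :=
  Derivation.mk'
    { toFun := fun f => ⟨fun p => fderiv ℝ f.1 p v, contDiff_fderiv_apply_const f.2 v⟩
      map_add' := fun a b => by
        ext p
        have ha := SmoothAlg.differentiableAt a p
        have hb := SmoothAlg.differentiableAt b p
        change fderiv ℝ (a.1 + b.1) p v = fderiv ℝ a.1 p v + fderiv ℝ b.1 p v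
        rw [fderiv_add ha hb]; rfl
      map_smul' := fun c a => by
        ext p
        have ha := SmoothAlg.differentiableAt a p
        change fderiv ℝ (c • a.1) p v = c • fderiv ℝ a.1 p v
        rw [fderiv_const_smul ha]; rfl }
    fun a b => by
      ext p
      have ha := SmoothAlg.differentiableAt a p
      have hb := SmoothAlg.differentiableAt b p
      change fderiv ℝ (a.1 * b.1) p v = a.1 p * fderiv ℝ b.1 p v + b.1 p * fderiv ℝ a.1 p v
      rw [fderiv_mul ha hb]; rfl

lemma dirD_comm (v w : X) (f : SmoothAlg X) : dirD v (dirD w f) = dirD w (dirD v f) := by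
  ext p
  change fderiv ℝ (fun q => fderiv ℝ f.1 q w) p v = fderiv ℝ (fun q => fderiv ℝ f.1 q v) p w
  have hf : ContDiff ℝ (⊤ : ℕ∞) f.1 := f.2
  have hd : DifferentiableAt ℝ (fderiv ℝ f.1) p :=
    ((hf.fderiv_right (m := (⊤ : ℕ∞)) (by exact le_rfl)).differentiable (by simp)) p
  have hs : IsSymmSndFDerivAt ℝ f.1 p :=
    (hf.contDiffAt).isSymmSndFDerivAt (by
      simp only [minSmoothness_of_isRCLikeNormedField]
      exact show ((2 : ℕ∞) : WithTop ℕ∞) ≤ _ from WithTop.coe_le_coe.2 le_top)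
  rw [fderiv_clm_apply hd (differentiableAt_const w),
    fderiv_clm_apply hd (differentiableAt_const v)]
  simp
  exact hs v w

/-- Evaluation at a point. -/
def evalAt (p : X) : SmoothAlg X →ₐ[ℝ] ℝ := (Pi.evalAlgHom ℝ (fun _ : X => ℝ) p).comp (SmoothAlg X).val

lemma evalAt_apply (p : X) (f : SmoothAlg X) : evalAt p f = f.1 p := rfl

end Smooth

section Link

variable {n : ℕ}

/-- Coordinate direction in space-time. -/
def spaceDir (i : Fin n) : (Fin n → ℝ) × ℝ := (Pi.single i 1, 0)

/-- A smooth family of metrics on all of space-time as a formal metric. -/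
def toFormal (G : (Fin n → ℝ) × ℝ → Matrix (Fin n) (Fin n) ℝ)
    (hG : ∀ i j, ContDiff ℝ (⊤ : ℕ∞) (fun p => G p i j)) (hs : ∀ p, (G p).IsSymm)
    (hdet : ∀ p, (G p).det ≠ 0) : FormalMetric n (SmoothAlg ((Fin n → ℝ) × ℝ)) where
  D i := dirD (spaceDir i)
  comm i j f := dirD_comm _ _ f
  g := Matrix.of fun i j => ⟨fun p => G p i j, hG i j⟩
  h := Matrix.of fun i j => ⟨fun p => (G p)⁻¹ i j, contDiffOn_univ.1
    (contDiffOn_inv_entry (fun i j => (hG i j).contDiffOn) (fun p _ => hdet p) i j)⟩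
  symm := by
    ext i j p
    exact congrFun (congrFun (hs p) i) j
  gh := by
    ext i j p
    have h1 : (G p * (G p)⁻¹) i j = (1 : Matrix (Fin n) (Fin n) ℝ) i j := by
      rw [Matrix.mul_nonsing_inv _ (hdet p).isUnit]
    rw [← evalAt_apply, ← evalAt_apply, Matrix.mul_apply, map_sum]
    simp only [map_mul]
    rw [Matrix.mul_apply] at h1
    refine h1.trans ?_
    by_cases hij : i = j <;> simp [Matrix.one_apply, hij]

variable (G : (Fin n → ℝ) × ℝ → Matrix (Fin n) (Fin n) ℝ)
    (hG : ∀ i j, ContDiff ℝ (⊤ : ℕ∞) (fun p => G p i j)) (hs : ∀ p, (G p).IsSymm)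
    (hdet : ∀ p, (G p).det ≠ 0)

lemma eval_D (i : Fin n) (f : SmoothAlg ((Fin n → ℝ) × ℝ)) (x : Fin n → ℝ) (s : ℝ) :
    evalAt (x, s) ((toFormal G hG hs hdet).D i f) = pd (fun y => f.1 (y, s)) i x := by
  have h0 : HasFDerivAt f.1 (fderiv ℝ f.1 (x, s)) ((fun y => (y, s)) x) :=
    (SmoothAlg.differentiableAt f (x, s)).hasFDerivAt
  have h1 := h0.comp x (hasFDerivAt_prodMk_left (𝕜 := ℝ) x s)
  change fderiv ℝ f.1 (x, s) (Pi.single i 1, 0) = fderiv ℝ (fun y => f.1 (y, s)) x (Pi.single i 1)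
  have h2 := h1.fderiv
  change fderiv ℝ (fun y => f.1 (y, s)) x = _ at h2
  rw [h2]; rfl

lemma eval_g (j k : Fin n) (p : (Fin n → ℝ) × ℝ) :
    evalAt p ((toFormal G hG hs hdet).g j k) = G p j k := rfl

lemma eval_h (j k : Fin n) (p : (Fin n → ℝ) × ℝ) :
    evalAt p ((toFormal G hG hs hdet).h j k) = (G p)⁻¹ j k := rfl

lemma eval_Γ (k i j : Fin n) (x : Fin n → ℝ) (s : ℝ) :
    evalAt (x, s) ((toFormal G hG hs hdet).Γ k i j) =
      christoffel (fun y => G (y, s)) x k i j := by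
  simp only [FormalMetric.Γ, map_smul, map_sum, map_mul, map_sub, map_add, eval_D, eval_h,
    smul_eq_mul, christoffel]
  rfl

lemma eval_Γ_fun (k i j : Fin n) (s : ℝ) :
    (fun y => ((toFormal G hG hs hdet).Γ k i j).1 (y, s)) =
      fun y => christoffel (fun y => G (y, s)) y k i j :=
  funext fun y => eval_Γ G hG hs hdet k i j y s

lemma eval_Ric (j k : Fin n) (x : Fin n → ℝ) (s : ℝ) :
    evalAt (x, s) ((toFormal G hG hs hdet).Ric j k) = ricci (fun y => G (y, s)) x j k := by
  simp only [FormalMetric.Ric, map_sum, map_mul, map_sub, map_add, eval_D, eval_Γ, eval_Γ_fun,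
    ricci]

lemma eval_scal (x : Fin n → ℝ) (s : ℝ) :
    evalAt (x, s) ((toFormal G hG hs hdet).scal) = scalarCurv (fun y => G (y, s)) x := by
  simp only [FormalMetric.scal, map_sum, map_mul, eval_h, eval_Ric, scalarCurv]

lemma eval_scal_fun (s : ℝ) : (fun y => ((toFormal G hG hs hdet).scal).1 (y, s)) =
      fun y => scalarCurv (fun y => G (y, s)) y :=
  funext fun y => eval_scal G hG hs hdet y s

end Link

/-- Curvature matrices of a metric. -/
def curvMat {n : ℕ} (G : (Fin n → ℝ) → Matrix (Fin n) (Fin n) ℝ) (x : Fin n → ℝ) (i j : Fin n) :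
    Matrix (Fin n) (Fin n) ℝ :=
  Matrix.of fun k l => pd (fun y => christoffel G y k j l) i x
    - pd (fun y => christoffel G y k i l) j x
    + ∑ p, christoffel G x k i p * christoffel G x p j l
    - ∑ p, christoffel G x k j p * christoffel G x p i l

namespace SmoothMetric

variable {n : ℕ} {G : (Fin n → ℝ) → Matrix (Fin n) (Fin n) ℝ} (hG : SmoothMetric G)

/-- The formal metric of a smooth metric. -/
def formal : FormalMetric n (SmoothAlg ((Fin n → ℝ) × ℝ)) :=
  toFormal (fun p => G p.1) (fun i j => (hG.1 i j).comp contDiff_fst) (fun p => (hG.2 p.1).1)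
    (fun p => (hG.2 p.1).2.det_pos.ne')

include hG

lemma christoffel_comm (x : Fin n → ℝ) (k i j : Fin n) :
    christoffel G x k i j = christoffel G x k j i := by
  have := congrArg (evalAt (x, 0)) (hG.formal.Γ_comm k i j)
  simpa only [formal, eval_Γ] using this

lemma pd_metric (x : Fin n → ℝ) (m j k : Fin n) : pd (fun y => G y j k) m x =
    ∑ p, christoffel G x p m j * G x p k + ∑ p, G x j p * christoffel G x p m k := by
  have := congrArg (evalAt (x, 0)) (congrFun (congrFun (hG.formal.map_g m) j) k)
  simp only [formal, Matrix.map_apply, Matrix.add_apply, Matrix.mul_apply, eval_D, eval_g,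
    FormalMetric.conn, Matrix.transpose_apply, Matrix.of_apply, map_add, map_sum, map_mul,
    eval_Γ] at this
  exact this

lemma eval_F (x : Fin n → ℝ) (i j k l : Fin n) :
    evalAt (x, 0) (hG.formal.F i j k l) = curvMat G x i j k l := by
  simp only [formal, FormalMetric.F, Matrix.sub_apply, Matrix.add_apply, Matrix.map_apply,
    FormalMetric.conn, Matrix.of_apply, Matrix.mul_apply, map_sub, map_add, map_sum, map_mul,
    eval_D, eval_Γ, eval_Γ_fun, curvMat]

lemma metric_mul_curvMat (x : Fin n → ℝ) (i j a b : Fin n) :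
    (G x * curvMat G x i j) a b = - (G x * curvMat G x i j) b a := by
  have := congrArg (evalAt (x, 0)) (congrFun (congrFun (hG.formal.g_mul_F i j) a) b)
  simp only [Matrix.add_apply, Matrix.mul_apply, Matrix.transpose_apply, map_add, map_sum, map_mul,
    eval_F, Matrix.zero_apply, map_zero] at this
  rw [eq_neg_iff_add_eq_zero, Matrix.mul_apply, Matrix.mul_apply, ← this]
  congr 1
  refine Finset.sum_congr rfl fun p _ => ?_
  rw [mul_comm]
  congr 1
  exact congrFun (congrFun (hG.2 x).1 p) b

lemma ricci_eq_sum_curvMat (x : Fin n → ℝ) (j k : Fin n) :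
    ricci G x j k = ∑ i, curvMat G x i j i k := by
  have := congrArg (evalAt (x, 0)) (hG.formal.Ric_eq j k)
  simp only [map_sum, eval_F] at this
  rw [← this]
  simp only [formal, eval_Ric]

end SmoothMetric

/-- The Laplace-Beltrami operator. -/
def lapl {n : ℕ} (G : (Fin n → ℝ) → Matrix (Fin n) (Fin n) ℝ) (f : (Fin n → ℝ) → ℝ)
    (x : Fin n → ℝ) : ℝ :=
  ∑ j, ∑ k, (G x)⁻¹ j k *
    (pd (fun y => pd f k y) j x - ∑ p, christoffel G x p j k * pd f p x)

/-- Squared norm of the Ricci tensor. -/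
def ricSq {n : ℕ} (G : (Fin n → ℝ) → Matrix (Fin n) (Fin n) ℝ) (x : Fin n → ℝ) : ℝ :=
  ∑ j, ∑ k, ((G x)⁻¹ * Matrix.of (ricci G x) * (G x)⁻¹) j k * ricci G x j k

lemma SmoothMetricFamily.slice {n : ℕ} {I : Set ℝ}
    {g : (Fin n → ℝ) → ℝ → Matrix (Fin n) (Fin n) ℝ} (hg : SmoothMetricFamily g I) {t : ℝ}
    (ht : t ∈ I) : SmoothMetric (fun y => g y t) :=
  ⟨fun i j => (hg.1 i j).slice ht, fun x => hg.2 x t ht⟩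

section

variable {n : ℕ} {T : ℝ}

lemma contDiffOn_pd (hT : 0 < T) {f : (Fin n → ℝ) → ℝ → ℝ}
    (hf : ContDiffOn ℝ (⊤ : ℕ∞) (fun p : (Fin n → ℝ) × ℝ => f p.1 p.2) (univ ×ˢ Icc 0 T))
    (i : Fin n) :
    ContDiffOn ℝ (⊤ : ℕ∞) (fun p : (Fin n → ℝ) × ℝ => pd (fun y => f y p.2) i p.1)
      (univ ×ˢ Icc 0 T) :=
  contDiffOn_fderiv_fst hT hf _

variable (hT : 0 < T) {g : (Fin n → ℝ) → ℝ → Matrix (Fin n) (Fin n) ℝ}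
  (hg : SmoothMetricFamily g (Icc 0 T))
include hg

lemma contDiffOn_inv_metric (i j : Fin n) :
    ContDiffOn ℝ (⊤ : ℕ∞) (fun p : (Fin n → ℝ) × ℝ => (g p.1 p.2)⁻¹ i j) (univ ×ˢ Icc 0 T) :=
  contDiffOn_inv_entry hg.1 (fun p hp => (hg.2 p.1 p.2 hp.2).2.det_pos.ne') i j

include hT

lemma contDiffOn_christoffel (k i j : Fin n) :
    ContDiffOn ℝ (⊤ : ℕ∞) (fun p : (Fin n → ℝ) × ℝ => christoffel (fun y => g y p.2) p.1 k i j)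
      (univ ×ˢ Icc 0 T) := by
  have h := fun i j k => contDiffOn_pd hT (f := fun x t => g x t i j) (hg.1 i j) k
  unfold christoffel
  exact contDiffOn_const.mul (ContDiffOn.sum fun l _ => (contDiffOn_inv_metric hg k l).mul
    (((h j l i).add (h i l j)).sub (h i j l)))

lemma contDiffOn_ricci (j k : Fin n) :
    ContDiffOn ℝ (⊤ : ℕ∞) (fun p : (Fin n → ℝ) × ℝ => ricci (fun y => g y p.2) p.1 j k)
      (univ ×ˢ Icc 0 T) := by
  have h := contDiffOn_christoffel hT hg
  have h' := fun k i j l => contDiffOn_pd hT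
    (f := fun x t => christoffel (fun y => g y t) x k i j) (h k i j) l
  unfold ricci
  exact ContDiffOn.sum fun i _ => ((h' _ _ _ _).sub (h' _ _ _ _)).add
    (ContDiffOn.sum fun p _ => ((h _ _ _).mul (h _ _ _)).sub ((h _ _ _).mul (h _ _ _)))

lemma contDiffOn_scalarCurv :
    ContDiffOn ℝ (⊤ : ℕ∞) (fun p : (Fin n → ℝ) × ℝ => scalarCurv (fun y => g y p.2) p.1)
      (univ ×ˢ Icc 0 T) := by
  unfold scalarCurv
  exact ContDiffOn.sum fun i _ => ContDiffOn.sum fun j _ =>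
    (contDiffOn_inv_metric hg _ _).mul (contDiffOn_ricci hT hg _ _)

lemma contDiffOn_lapl {f : (Fin n → ℝ) → ℝ → ℝ}
    (hf : ContDiffOn ℝ (⊤ : ℕ∞) (fun p : (Fin n → ℝ) × ℝ => f p.1 p.2) (univ ×ˢ Icc 0 T)) :
    ContDiffOn ℝ (⊤ : ℕ∞)
      (fun p : (Fin n → ℝ) × ℝ => lapl (fun y => g y p.2) (fun y => f y p.2) p.1)
      (univ ×ˢ Icc 0 T) := by
  have h1 := contDiffOn_pd hT hf
  have h2 := fun k => contDiffOn_pd hT (f := fun x t => pd (fun y => f y t) k x) (h1 k)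
  unfold lapl
  exact ContDiffOn.sum fun i _ => ContDiffOn.sum fun j _ =>
    (contDiffOn_inv_metric hg _ _).mul ((h2 _ _).sub (ContDiffOn.sum fun p _ =>
      (contDiffOn_christoffel hT hg _ _ _).mul (h1 _)))

lemma contDiffOn_ricSq :
    ContDiffOn ℝ (⊤ : ℕ∞) (fun p : (Fin n → ℝ) × ℝ => ricSq (fun y => g y p.2) p.1)
      (univ ×ˢ Icc 0 T) := by
  unfold ricSq
  simp only [Matrix.mul_apply, Matrix.of_apply]
  have h1 := contDiffOn_inv_metric hg
  have h2 := contDiffOn_ricci hT hg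
  exact ContDiffOn.sum fun i _ => ContDiffOn.sum fun j _ =>
    (ContDiffOn.sum fun k _ => (ContDiffOn.sum fun l _ => (h1 _ _).mul (h2 _ _)).mul (h1 _ _)).mul
      (h2 _ _)

omit hT in
lemma IsRicciFlow.hasDerivAt (hflow : IsRicciFlow g (Icc 0 T)) (x : Fin n → ℝ) {t : ℝ}
    (ht : t ∈ Ioo 0 T) (j k : Fin n) :
    HasDerivAt (fun s => g x s j k) (-2 * ricci (fun y => g y t) x j k) t := by
  have hn : Icc 0 T ∈ nhds t := Icc_mem_nhds ht.1 ht.2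
  have h1 : DifferentiableWithinAt ℝ (fun s => g x s j k) (Icc 0 T) t := by
    have h2 : ContDiffOn ℝ (⊤ : ℕ∞) (fun s => g x s j k) (Icc 0 T) :=
      (hg.1 j k).comp (f := fun s : ℝ => (x, s)) (by fun_prop) fun y hy => ⟨trivial, hy⟩
    exact h2.differentiableOn (by simp) t (Ioo_subset_Icc_self ht)
  have h3 := h1.hasDerivWithinAt.hasDerivAt hn
  rwa [hflow x t (Ioo_subset_Icc_self ht)] at h3

/-- Evolution of the scalar curvature under the Ricci flow. -/
theorem IsRicciFlow.hasDerivAt_scalarCurv (hflow : IsRicciFlow g (Icc 0 T)) (x : Fin n → ℝ) {t : ℝ}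
    (ht : t ∈ Ioo 0 T) :
    HasDerivAt (fun s => scalarCurv (fun y => g y s) x)
      (lapl (fun y => g y t) (fun y => scalarCurv (fun z => g z t) y) x
        + 2 * ricSq (fun y => g y t) x) t := by
  obtain ⟨ρ, hρ0, hρ1, hρ2⟩ : ∃ ρ > 0, 2 * ρ < t ∧ 2 * ρ < T - t := by
    refine ⟨min t (T - t) / 4, ?_, ?_, ?_⟩
    · have := lt_min ht.1 (sub_pos.2 ht.2); positivity
    · have := lt_min ht.1 (sub_pos.2 ht.2); linarith [min_le_left t (T - t)]
    · have := lt_min ht.1 (sub_pos.2 ht.2); linarith [min_le_right t (T - t)]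
  set φ : ℝ → ℝ := fun s => t + ρ * Real.arctan s with hφ
  have hφm : ∀ s, φ s ∈ Ioo 0 T := by
    intro s
    have h1 := Real.arctan_lt_pi_div_two s
    have h2 := Real.neg_pi_div_two_lt_arctan s
    have h3 := Real.pi_le_four
    constructor <;> simp only [hφ] <;> nlinarith
  have hφs : ContDiff ℝ (⊤ : ℕ∞) φ := contDiff_const.add (contDiff_const.mul Real.contDiff_arctan)
  have hφd : ∀ s, HasDerivAt φ (ρ * (1 / (1 + s ^ 2))) s := fun s =>
    ((Real.hasDerivAt_arctan s).const_mul ρ).const_add t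
  have hG : ∀ i j, ContDiff ℝ (⊤ : ℕ∞) (fun p : (Fin n → ℝ) × ℝ => g p.1 (φ p.2) i j) := by
    intro i j
    rw [← contDiffOn_univ]
    exact (hg.1 i j).comp (f := fun p : (Fin n → ℝ) × ℝ => (p.1, φ p.2))
      (contDiff_fst.prodMk (hφs.comp contDiff_snd)).contDiffOn
      fun p _ => ⟨trivial, Ioo_subset_Icc_self (hφm _)⟩
  have hI := fun (p : (Fin n → ℝ) × ℝ) => hg.2 p.1 (φ p.2) (Ioo_subset_Icc_self (hφm p.2))
  set M := toFormal (fun p => g p.1 (φ p.2)) hG (fun p => (hI p).1) (fun p => (hI p).2.det_pos.ne')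
    with hM
  let c : SmoothAlg ((Fin n → ℝ) × ℝ) := ⟨fun p => (1 + p.2 ^ 2) / ρ,
    show ContDiff ℝ (⊤ : ℕ∞) _ by fun_prop⟩
  let dt : Derivation ℝ (SmoothAlg ((Fin n → ℝ) × ℝ)) (SmoothAlg ((Fin n → ℝ) × ℝ)) :=
    c • dirD ((0 : Fin n → ℝ), (1 : ℝ))
  have hdt : ∀ f : SmoothAlg ((Fin n → ℝ) × ℝ), ∀ x s d, HasDerivAt (fun s => f.1 (x, s)) d s →
      evalAt (x, s) (dt f) = (1 + s ^ 2) / ρ * d := by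
    intro f x s d hd
    have h0 : HasFDerivAt f.1 (fderiv ℝ f.1 (x, s)) ((fun s => (x, s)) s) :=
      (SmoothAlg.differentiableAt f (x, s)).hasFDerivAt
    have h1 := (h0.comp s (hasFDerivAt_prodMk_right (𝕜 := ℝ) x s)).hasDerivAt
    rw [hd.unique h1]; rfl
  have hcomm : ∀ i f, dt (M.D i f) = M.D i (dt f) := by
    intro i f
    have hc : M.D i c = 0 := by
      ext ⟨y, s⟩
      rw [← evalAt_apply, hM, eval_D]
      simp [pd, c]
    change c * dirD _ (dirD _ f) = dirD (spaceDir i) (c * dirD _ f)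
    rw [Derivation.leibniz, smul_eq_mul, smul_eq_mul, show dirD (spaceDir i) c = 0 from hc,
      mul_zero, add_zero, dirD_comm]
  have hfl : ∀ j k, dt (M.g j k) = -2 * M.Ric j k := by
    intro j k
    ext ⟨y, s⟩
    rw [← evalAt_apply, ← evalAt_apply]
    have h1 : HasDerivAt (fun s => g y (φ s) j k)
        (-2 * ricci (fun z => g z (φ s)) y j k * (ρ * (1 / (1 + s ^ 2)))) s :=
      (IsRicciFlow.hasDerivAt hg hflow y (hφm s) j k).comp s (hφd s)
    rw [hdt (M.g j k) y s _ h1, map_mul, hM, eval_Ric, map_neg, map_ofNat]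
    have : 0 < 1 + s ^ 2 := by positivity
    field_simp
  have hev := congrArg (evalAt (x, (0 : ℝ))) (M.scal_time dt hcomm hfl)
  have hφ0 : φ 0 = t := by simp [hφ]
  have hsc : DifferentiableAt ℝ (fun s => scalarCurv (fun y => g y s) x) t := by
    have h2 : ContDiffOn ℝ (⊤ : ℕ∞) (fun s => scalarCurv (fun y => g y s) x) (Icc 0 T) :=
      (contDiffOn_scalarCurv hT hg).comp (f := fun s : ℝ => (x, s)) (by fun_prop)
        fun y hy => ⟨trivial, hy⟩
    exact (h2.differentiableOn (by simp) t (Ioo_subset_Icc_self ht)).differentiableAt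
      (Icc_mem_nhds ht.1 ht.2)
  have hsd := hsc.hasDerivAt
  have h5 : HasDerivAt (fun s => (M.scal).1 (x, s))
      (deriv (fun s => scalarCurv (fun y => g y s) x) t * (ρ * (1 / (1 + 0 ^ 2)))) 0 := by
    have h6 : (fun s => (M.scal).1 (x, s)) = (fun s => scalarCurv (fun y => g y s) x) ∘ φ :=
      funext fun s => eval_scal _ _ _ _ x s
    rw [h6]
    rw [← hφ0] at hsd
    have := hsd.comp 0 (hφd 0)
    rwa [hφ0] at this
  rw [hdt _ _ _ _ h5] at hev
  have h7 : deriv (fun s => scalarCurv (fun y => g y s) x) t =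
      lapl (fun y => g y t) (fun y => scalarCurv (fun z => g z t) y) x
        + 2 * ricSq (fun y => g y t) x := by
    have h8 : ∀ f : SmoothAlg ((Fin n → ℝ) × ℝ), ∀ j k,
        evalAt (x, (0 : ℝ)) (M.D j (M.D k f)) =
          pd (fun y => pd (fun z => f.1 (z, 0)) k y) j x := by
      intro f j k
      rw [hM, eval_D]
      congr 1
      funext y
      exact eval_D (fun p => g p.1 (φ p.2)) hG (fun p => (hI p).1)
        (fun p => (hI p).2.det_pos.ne') k f y 0
    simp only [map_add, map_sum, map_mul, map_sub, h8, FormalMetric.Z, Matrix.mul_apply,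
      FormalMetric.ricM, Matrix.of_apply, map_ofNat] at hev
    simp only [hM, eval_D, eval_h, eval_Ric, eval_Γ, eval_scal_fun, hφ0] at hev
    simp only [lapl, ricSq, Matrix.mul_apply, Matrix.of_apply]
    rw [← hev]
    field_simp
  rwa [h7] at hsd

end

section

variable {n : ℕ}

/-- The bilinear form of a matrix. -/
def bil (A : Matrix (Fin n) (Fin n) ℝ) : (Fin n → ℝ) →ₗ[ℝ] (Fin n → ℝ) →ₗ[ℝ] ℝ :=
  LinearMap.mk₂ ℝ (fun u w => ∑ i, ∑ j, A i j * u i * w j)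
    (fun u u' w => by
      simp only [← Finset.sum_add_distrib, Pi.add_apply]
      exact Finset.sum_congr rfl fun _ _ => Finset.sum_congr rfl fun _ _ => by ring)
    (fun c u w => by
      simp only [Pi.smul_apply, smul_eq_mul, Finset.mul_sum]
      exact Finset.sum_congr rfl fun _ _ => Finset.sum_congr rfl fun _ _ => by ring)
    (fun u w w' => by
      simp only [← Finset.sum_add_distrib, Pi.add_apply]
      exact Finset.sum_congr rfl fun _ _ => Finset.sum_congr rfl fun _ _ => by ring)
    (fun c u w => by
      simp only [Pi.smul_apply, smul_eq_mul, Finset.mul_sum]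
      exact Finset.sum_congr rfl fun _ _ => Finset.sum_congr rfl fun _ _ => by ring)

lemma bil_apply (A : Matrix (Fin n) (Fin n) ℝ) (u w : Fin n → ℝ) :
    bil A u w = ∑ i, ∑ j, A i j * u i * w j := rfl

/-- The vector valued bilinear map with given coefficients. -/
def vbil (c : Fin n → Fin n → Fin n → ℝ) : (Fin n → ℝ) →ₗ[ℝ] (Fin n → ℝ) →ₗ[ℝ] (Fin n → ℝ) :=
  LinearMap.mk₂ ℝ (fun u w k => bil (Matrix.of (c k)) u w)
    (fun u u' w => by ext k; simp) (fun a u w => by ext k; simp)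
    (fun u w w' => by ext k; simp) (fun a u w => by ext k; simp)

lemma vbil_apply (c : Fin n → Fin n → Fin n → ℝ) (u w : Fin n → ℝ) (k : Fin n) :
    vbil c u w k = ∑ i, ∑ j, c k i j * u i * w j := rfl

variable (G : (Fin n → ℝ) → Matrix (Fin n) (Fin n) ℝ)

/-- The Christoffel symbols as a bilinear map. -/
def chr (x : Fin n → ℝ) : (Fin n → ℝ) →ₗ[ℝ] (Fin n → ℝ) →ₗ[ℝ] (Fin n → ℝ) :=
  vbil (christoffel G x)

/-- Directional derivative of the Christoffel symbols. -/
def dchr (x z : Fin n → ℝ) : (Fin n → ℝ) →ₗ[ℝ] (Fin n → ℝ) →ₗ[ℝ] (Fin n → ℝ) :=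
  vbil fun k i j => fderiv ℝ (fun y => christoffel G y k i j) x z

lemma fderiv_eq_sum_pd (f : (Fin n → ℝ) → ℝ) (x v : Fin n → ℝ) :
    fderiv ℝ f x v = ∑ m, v m * pd f m x := by
  have h : v = ∑ m, v m • (Pi.single m (1 : ℝ) : Fin n → ℝ) := by
    ext k; simp [Finset.sum_apply, Pi.single_apply]
  conv_lhs => rw [h]
  simp only [map_sum, map_smul, smul_eq_mul, pd]

variable {G} (hG : SmoothMetric G)
include hG

lemma bil_comm (x u w : Fin n → ℝ) : bil (G x) u w = bil (G x) w u := by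
  simp only [bil_apply]
  rw [Finset.sum_comm]
  refine Finset.sum_congr rfl fun i _ => Finset.sum_congr rfl fun j _ => ?_
  rw [show G x j i = G x i j from congrFun (congrFun (hG.2 x).1 i) j]; ring

lemma chr_comm (x u w : Fin n → ℝ) : chr G x u w = chr G x w u := by
  ext k
  simp only [chr, vbil_apply]
  rw [Finset.sum_comm]
  refine Finset.sum_congr rfl fun i _ => Finset.sum_congr rfl fun j _ => ?_
  rw [hG.christoffel_comm x k j i]; ring

lemma dchr_comm (x z u w : Fin n → ℝ) : dchr G x z u w = dchr G x z w u := by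
  ext k
  simp only [dchr, vbil_apply]
  rw [Finset.sum_comm]
  refine Finset.sum_congr rfl fun i _ => Finset.sum_congr rfl fun j _ => ?_
  simp only [fun y => hG.christoffel_comm y k j i]; ring

/-- Metric compatibility of the connection in bilinear form. -/
lemma fderiv_metric (x z u w : Fin n → ℝ) :
    ∑ i, ∑ j, fderiv ℝ (fun y => G y i j) x z * u i * w j
      = bil (G x) (chr G x z u) w + bil (G x) u (chr G x z w) := by
  have h1 : ∀ i j, fderiv ℝ (fun y => G y i j) x z =
      (∑ p, G x p j * ∑ m, christoffel G x p m i * z m) +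
        ∑ p, G x i p * ∑ m, christoffel G x p m j * z m := by
    intro i j
    simp only [fderiv_eq_sum_pd, hG.pd_metric, mul_add, Finset.sum_add_distrib, Finset.mul_sum]
    congr 1
    · rw [Finset.sum_comm]
      exact Finset.sum_congr rfl fun _ _ => Finset.sum_congr rfl fun _ _ => by ring
    · rw [Finset.sum_comm]
      exact Finset.sum_congr rfl fun _ _ => Finset.sum_congr rfl fun _ _ => by ring
  simp only [h1, add_mul, Finset.sum_add_distrib]
  congr 1
  · simp only [bil_apply, chr, vbil_apply, Finset.sum_mul, Finset.mul_sum]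
    have e : ∀ i : Fin n, ∑ j, ∑ p, ∑ m, G x p j * (christoffel G x p m i * z m) * u i * w j
        = ∑ p, ∑ j, ∑ m, G x p j * (christoffel G x p m i * z m) * u i * w j :=
      fun i => Finset.sum_comm
    rw [Finset.sum_congr rfl fun i _ => e i, Finset.sum_comm]
    refine Finset.sum_congr rfl fun p _ => ?_
    rw [Finset.sum_comm]
    refine Finset.sum_congr rfl fun j _ => ?_
    rw [Finset.sum_comm]
    exact Finset.sum_congr rfl fun _ _ => Finset.sum_congr rfl fun _ _ => by ring
  · simp only [bil_apply, chr, vbil_apply, Finset.sum_mul, Finset.mul_sum]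
    refine Finset.sum_congr rfl fun i _ => ?_
    rw [Finset.sum_comm]
    refine Finset.sum_congr rfl fun p _ => ?_
    rw [Finset.sum_comm]
    exact Finset.sum_congr rfl fun _ _ => Finset.sum_congr rfl fun _ _ => by ring

lemma contDiff_christoffel (k i j : Fin n) :
    ContDiff ℝ (⊤ : ℕ∞) (fun y => christoffel G y k i j) := by
  have h := (SmoothAlg.contDiff (hG.formal.Γ k i j)).comp
    (contDiff_prodMk_left (𝕜 := ℝ) (n := (⊤ : ℕ∞)) (E := Fin n → ℝ) (0 : ℝ))
  have h2 : (hG.formal.Γ k i j).1 ∘ (fun y => (y, (0 : ℝ))) = fun y => christoffel G y k i j :=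
    funext fun y => eval_Γ _ _ _ _ k i j y 0
  rwa [h2] at h

lemma hasDerivAt_bil {x V W : ℝ → Fin n → ℝ} {x' V' W' : Fin n → ℝ} {a : ℝ}
    (hx : HasDerivAt x x' a) (hV : HasDerivAt V V' a) (hW : HasDerivAt W W' a) :
    HasDerivAt (fun a => bil (G (x a)) (V a) (W a))
      (bil (G (x a)) (V' + chr G (x a) x' (V a)) (W a)
        + bil (G (x a)) (V a) (W' + chr G (x a) x' (W a))) a := by
  simp only [map_add, LinearMap.add_apply]
  have h1 : ∀ i j, HasDerivAt (fun a => G (x a) i j) (fderiv ℝ (fun y => G y i j) (x a) x') a :=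
    fun i j => (((hG.1 i j).differentiable (by simp) (x a)).hasFDerivAt).comp_hasDerivAt a hx
  rw [hasDerivAt_pi] at hV hW
  have h2 := HasDerivAt.fun_sum (u := Finset.univ) fun i _ =>
    HasDerivAt.fun_sum (u := Finset.univ) fun j _ =>
      (((h1 i j).mul (hV i)).mul (hW j))
  refine h2.congr_deriv ?_
  have h3 := fderiv_metric hG (x a) x' (V a) (W a)
  rw [show ∀ p q r s : ℝ, p + q + (r + s) = (q + s) + p + r from fun p q r s => by ring, ← h3]
  simp only [bil_apply, ← Finset.sum_add_distrib]
  exact Finset.sum_congr rfl fun _ _ => Finset.sum_congr rfl fun _ _ => by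
    simp only [Pi.mul_apply]; ring

lemma hasDerivAt_chr {x V W : ℝ → Fin n → ℝ} {x' V' W' : Fin n → ℝ} {a : ℝ}
    (hx : HasDerivAt x x' a) (hV : HasDerivAt V V' a) (hW : HasDerivAt W W' a) :
    HasDerivAt (fun a => chr G (x a) (V a) (W a))
      (dchr G (x a) x' (V a) (W a) + chr G (x a) V' (W a) + chr G (x a) (V a) W') a := by
  rw [hasDerivAt_pi] at hV hW ⊢
  intro k
  have h1 : ∀ i j, HasDerivAt (fun a => christoffel G (x a) k i j)
      (fderiv ℝ (fun y => christoffel G y k i j) (x a) x') a :=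
    fun i j => (((contDiff_christoffel hG k i j).differentiable (by simp)
      (x a)).hasFDerivAt).comp_hasDerivAt a hx
  have h2 := HasDerivAt.fun_sum (u := Finset.univ) fun i _ =>
    HasDerivAt.fun_sum (u := Finset.univ) fun j _ =>
      (((h1 i j).mul (hV i)).mul (hW j))
  refine h2.congr_deriv ?_
  simp only [chr, dchr, vbil_apply, ← Finset.sum_add_distrib, Pi.add_apply]
  exact Finset.sum_congr rfl fun _ _ => Finset.sum_congr rfl fun _ _ => by
    simp only [Pi.mul_apply]; ring

omit hG in
lemma hasDerivAt_quadratic (x u q : Fin n → ℝ) (a : ℝ) :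
    HasDerivAt (fun a : ℝ => x + a • u + (a ^ 2 / 2) • q) (u + a • q) a := by
  have h1 := ((hasDerivAt_id a).smul_const u).const_add x
  have h2 := (((hasDerivAt_id a).pow 2).div_const 2).smul_const q
  refine (h1.add h2).congr_deriv ?_
  simp

/-- The energy density along a quadratic variation. -/
def edens (G : (Fin n → ℝ) → Matrix (Fin n) (Fin n) ℝ) (x u q v p r : Fin n → ℝ) (a : ℝ) : ℝ :=
  bil (G (x + a • u + (a ^ 2 / 2) • q)) (v + a • p + (a ^ 2 / 2) • r)
    (v + a • p + (a ^ 2 / 2) • r)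

lemma hasDerivAt_edens (x u q v p r : Fin n → ℝ) (a : ℝ) :
    HasDerivAt (edens G x u q v p r)
      (2 * bil (G (x + a • u + (a ^ 2 / 2) • q)) (p + a • r +
        chr G (x + a • u + (a ^ 2 / 2) • q) (u + a • q) (v + a • p + (a ^ 2 / 2) • r))
        (v + a • p + (a ^ 2 / 2) • r)) a := by
  refine (hasDerivAt_bil hG (hasDerivAt_quadratic x u q a) (hasDerivAt_quadratic v p r a)
    (hasDerivAt_quadratic v p r a)).congr_deriv ?_
  rw [bil_comm hG _ (v + a • p + (a ^ 2 / 2) • r)]; ring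

lemma deriv_edens_zero (x u q v p r : Fin n → ℝ) :
    deriv (edens G x u q v p r) 0 = 2 * bil (G x) (p + chr G x u v) v := by
  rw [(hasDerivAt_edens hG x u q v p r 0).deriv]; simp

lemma deriv_deriv_edens_zero (x u q v p r : Fin n → ℝ) :
    deriv (deriv (edens G x u q v p r)) 0 =
      2 * bil (G x) (r + dchr G x u u v + chr G x q v + chr G x u p + chr G x u (p + chr G x u v)) v
        + 2 * bil (G x) (p + chr G x u v) (p + chr G x u v) := by
  have h0 : deriv (edens G x u q v p r) = _ := funext fun a => (hasDerivAt_edens hG x u q v p r a).deriv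
  rw [h0]
  have hx := hasDerivAt_quadratic x u q 0
  have hv := hasDerivAt_quadratic v p r 0
  have hu : HasDerivAt (fun a : ℝ => u + a • q) q 0 := by
    simpa using ((hasDerivAt_id (0 : ℝ)).smul_const q).const_add u
  have hp : HasDerivAt (fun a : ℝ => p + a • r) r 0 := by
    simpa using ((hasDerivAt_id (0 : ℝ)).smul_const r).const_add p
  have h1 := (hasDerivAt_bil hG hx (hp.add (hasDerivAt_chr hG hx hu hv)) hv).const_mul 2
  have h2 := h1.deriv
  simp only [Pi.add_apply] at h2
  refine h2.trans ?_
  simp only [zero_smul, add_zero, ne_eq, OfNat.ofNat_ne_zero, not_false_eq_true, zero_pow,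
    zero_div, map_add, LinearMap.add_apply]
  ring

/-- The first derivative for the parallel variation. -/
lemma deriv_edens_parallel (x v e q r : Fin n → ℝ) (φ φ' : ℝ) :
    deriv (edens G x (φ • e) q v (φ' • e - chr G x v (φ • e)) r) 0
      = 2 * φ' * bil (G x) e v := by
  rw [deriv_edens_zero hG, chr_comm hG x (φ • e) v]
  simp only [sub_add_cancel, map_smul, LinearMap.smul_apply, smul_eq_mul]; ring

/-- The second derivative for the parallel variation. -/
lemma deriv_deriv_edens_parallel (x v e : Fin n → ℝ) (φ φ' : ℝ) :
    deriv (deriv (edens G x (φ • e) (- chr G x (φ • e) (φ • e)) v (φ' • e - chr G x v (φ • e))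
      (- dchr G x v (φ • e) (φ • e) - (2 * φ') • chr G x e (φ • e)
        + (2 : ℝ) • chr G x (chr G x v (φ • e)) (φ • e)))) 0
      = 2 * φ' ^ 2 * bil (G x) e e + 2 * φ ^ 2 *
        bil (G x) (dchr G x e v e - dchr G x v e e + chr G x e (chr G x v e)
          - chr G x v (chr G x e e)) v := by
  rw [deriv_deriv_edens_zero hG, chr_comm hG x (φ • e) v, sub_add_cancel]
  have hd : dchr G x (φ • e) (φ • e) v = φ ^ 2 • dchr G x e v e := by
    rw [dchr_comm hG]
    ext k
    simp only [dchr, vbil_apply, map_smul, smul_eq_mul, Pi.smul_apply, Finset.mul_sum]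
    exact Finset.sum_congr rfl fun _ _ => Finset.sum_congr rfl fun _ _ => by ring
  rw [hd, chr_comm hG x (chr G x v (φ • e)) (φ • e), map_neg, LinearMap.neg_apply,
    chr_comm hG x (chr G x (φ • e) (φ • e)) v]
  simp only [map_add, map_sub, map_neg, map_smul, LinearMap.add_apply, LinearMap.sub_apply,
    LinearMap.smul_apply, LinearMap.neg_apply, smul_eq_mul]
  ring

omit hG in
lemma curvature_vector (x v e : Fin n → ℝ) (k : Fin n) :
    (dchr G x e v e - dchr G x v e e + chr G x e (chr G x v e) - chr G x v (chr G x e e)) k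
      = ∑ i, ∑ j, ∑ l, curvMat G x i j k l * e i * v j * e l := by
  have h1 : dchr G x e v e k
      = ∑ i, ∑ j, ∑ l, pd (fun y => christoffel G y k j l) i x * e i * v j * e l := by
    simp only [dchr, vbil_apply, fderiv_eq_sum_pd, Finset.sum_mul]
    rw [Finset.sum_congr rfl fun _ _ => Finset.sum_comm, Finset.sum_comm]
    exact Finset.sum_congr rfl fun _ _ => Finset.sum_congr rfl fun _ _ =>
      Finset.sum_congr rfl fun _ _ => by ring
  have h2 : dchr G x v e e k
      = ∑ i, ∑ j, ∑ l, pd (fun y => christoffel G y k i l) j x * e i * v j * e l := by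
    simp only [dchr, vbil_apply, fderiv_eq_sum_pd, Finset.sum_mul]
    rw [Finset.sum_congr rfl fun _ _ => Finset.sum_comm]
    exact Finset.sum_congr rfl fun _ _ => Finset.sum_congr rfl fun _ _ =>
      Finset.sum_congr rfl fun _ _ => by ring
  have h3 : chr G x e (chr G x v e) k = ∑ i, ∑ j, ∑ l,
      (∑ p, christoffel G x k i p * christoffel G x p j l) * e i * v j * e l := by
    simp only [chr, vbil_apply, Finset.sum_mul, Finset.mul_sum]
    refine Finset.sum_congr rfl fun i _ => ?_
    rw [Finset.sum_comm]
    refine Finset.sum_congr rfl fun j _ => ?_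
    rw [Finset.sum_comm]
    exact Finset.sum_congr rfl fun _ _ => Finset.sum_congr rfl fun _ _ => by ring
  have h4 : chr G x v (chr G x e e) k = ∑ i, ∑ j, ∑ l,
      (∑ p, christoffel G x k j p * christoffel G x p i l) * e i * v j * e l := by
    simp only [chr, vbil_apply, Finset.sum_mul, Finset.mul_sum]
    rw [Finset.sum_comm (s := (Finset.univ : Finset (Fin n)))]
    rw [Finset.sum_congr rfl fun _ _ => Finset.sum_comm, Finset.sum_comm]
    refine Finset.sum_congr rfl fun i _ => ?_
    rw [Finset.sum_comm]
    refine Finset.sum_congr rfl fun j _ => ?_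
    rw [Finset.sum_comm]
    exact Finset.sum_congr rfl fun _ _ => Finset.sum_congr rfl fun _ _ => by ring
  simp only [Pi.sub_apply, Pi.add_apply, h1, h2, h3, h4, curvMat, Matrix.of_apply, add_mul,
    sub_mul, Finset.sum_add_distrib, Finset.sum_sub_distrib]

end

section

variable {n : ℕ}

/-- `E` is an orthonormal frame for the matrix `G`. -/
def IsFrame (G : Matrix (Fin n) (Fin n) ℝ) (E : Fin n → Fin n → ℝ) : Prop :=
  ∀ a b, ∑ c, E c a * E c b = G⁻¹ a b

lemma isFrame_iff_mul {G : Matrix (Fin n) (Fin n) ℝ} {E : Fin n → Fin n → ℝ} :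
    IsFrame G E ↔ (Matrix.of E)ᵀ * Matrix.of E = G⁻¹ := by
  constructor
  · intro h; ext a b; simpa [Matrix.mul_apply] using h a b
  · intro h a b; rw [← h]; simp [Matrix.mul_apply]

lemma bil_eq_mul (A : Matrix (Fin n) (Fin n) ℝ) (E F : Fin n → Fin n → ℝ) (c d : Fin n) :
    bil A (E c) (F d) = (Matrix.of E * A * (Matrix.of F)ᵀ) c d := by
  simp only [bil_apply, Matrix.mul_apply, Matrix.of_apply, Matrix.transpose_apply, Finset.sum_mul]
  rw [Finset.sum_comm]
  exact Finset.sum_congr rfl fun _ _ => Finset.sum_congr rfl fun _ _ => by ring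

/-- A family of vectors with identity Gram matrix is a frame. -/
lemma isFrame_of_orthonormal {G : Matrix (Fin n) (Fin n) ℝ} {E : Fin n → Fin n → ℝ}
    (h : ∀ c d, bil G (E c) (E d) = if c = d then 1 else 0) : IsFrame G E := by
  rw [isFrame_iff_mul]
  have h1 : Matrix.of E * (G * (Matrix.of E)ᵀ) = 1 := by
    ext c d; rw [← Matrix.mul_assoc, ← bil_eq_mul, h, Matrix.one_apply]
  have h2 := mul_eq_one_comm.1 h1
  rw [Matrix.mul_assoc] at h2
  exact (Matrix.inv_eq_right_inv h2).symm

lemma exists_orthonormal {G : Matrix (Fin n) (Fin n) ℝ} (hG : G.PosDef) :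
    ∃ E : Fin n → Fin n → ℝ, ∀ c d, bil G (E c) (E d) = if c = d then 1 else 0 := by
  have hH := hG.1
  refine ⟨fun c => (Real.sqrt (hH.eigenvalues c))⁻¹ • (hH.eigenvectorBasis c).ofLp, fun c d => ?_⟩
  have hb : ∀ u w : Fin n → ℝ, bil G u w = u ⬝ᵥ (G *ᵥ w) := fun u w => by
    simp only [bil_apply, Matrix.mulVec, dotProduct, Finset.mul_sum]
    exact Finset.sum_congr rfl fun _ _ => Finset.sum_congr rfl fun _ _ => by ring
  have ho : (hH.eigenvectorBasis c).ofLp ⬝ᵥ (hH.eigenvectorBasis d).ofLp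
      = if c = d then 1 else 0 := by
    have := orthonormal_iff_ite.1 hH.eigenvectorBasis.orthonormal d c
    rw [EuclideanSpace.inner_eq_star_dotProduct] at this
    simpa [eq_comm] using this
  have hl : ∀ c, Real.sqrt (hH.eigenvalues c) ^ 2 = hH.eigenvalues c :=
    fun c => Real.sq_sqrt (hG.eigenvalues_pos c).le
  have hl0 : ∀ c, Real.sqrt (hH.eigenvalues c) ≠ 0 :=
    fun c => (Real.sqrt_pos.2 (hG.eigenvalues_pos c)).ne'
  rw [map_smul, map_smul, LinearMap.smul_apply, hb, hH.mulVec_eigenvectorBasis, dotProduct_smul, ho]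
  split_ifs with h
  · subst h
    simp only [smul_eq_mul]
    have h1 := hl c
    have h2 := hl0 c
    field_simp
    simpa using h1.symm
  · simp

lemma IsFrame.sum_bil {G : Matrix (Fin n) (Fin n) ℝ} {E : Fin n → Fin n → ℝ} (h : IsFrame G E)
    (A : Matrix (Fin n) (Fin n) ℝ) : ∑ c, bil A (E c) (E c) = ∑ a, ∑ b, G⁻¹ a b * A a b := by
  simp only [bil_apply]
  rw [Finset.sum_comm]
  refine Finset.sum_congr rfl fun a _ => ?_
  rw [Finset.sum_comm]
  refine Finset.sum_congr rfl fun b _ => ?_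
  rw [← h, Finset.sum_mul]
  exact Finset.sum_congr rfl fun _ _ => by ring

lemma IsFrame.sum_bil_self {G : Matrix (Fin n) (Fin n) ℝ} {E : Fin n → Fin n → ℝ}
    (h : IsFrame G E) (hs : G.IsSymm) (hG : G.PosDef) : ∑ c, bil G (E c) (E c) = n := by
  rw [h.sum_bil]
  have : ∀ a, ∑ b, G⁻¹ a b * G a b = 1 := fun a => by
    have h1 := congrFun (congrFun (Matrix.nonsing_inv_mul G hG.det_pos.ne'.isUnit) a) a
    rw [Matrix.mul_apply, Matrix.one_apply_eq] at h1
    rw [← h1]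
    exact Finset.sum_congr rfl fun b _ => by rw [show G a b = G b a from (congrFun (congrFun hs b) a)]
  simp [this]

lemma IsFrame.sum_bil_sq {G : Matrix (Fin n) (Fin n) ℝ} {E : Fin n → Fin n → ℝ}
    (h : IsFrame G E) (hs : G.IsSymm) (hG : G.PosDef) (v : Fin n → ℝ) :
    ∑ c, bil G (E c) v ^ 2 = bil G v v := by
  have e : ∀ c, bil G (E c) v ^ 2
      = bil (Matrix.vecMulVec (G *ᵥ v) (G *ᵥ v)) (E c) (E c) := fun c => by
    have : bil G (E c) v = ∑ i, E c i * (G *ᵥ v) i := by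
      simp only [bil_apply, Matrix.mulVec, dotProduct, Finset.mul_sum]
      exact Finset.sum_congr rfl fun _ _ => Finset.sum_congr rfl fun _ _ => by ring
    rw [this, sq, Finset.sum_mul_sum, bil_apply]
    exact Finset.sum_congr rfl fun _ _ => Finset.sum_congr rfl fun _ _ => by
      rw [Matrix.vecMulVec_apply]; ring
  simp only [e]
  rw [h.sum_bil]
  have h1 : G⁻¹ *ᵥ (G *ᵥ v) = v := by
    rw [Matrix.mulVec_mulVec, Matrix.nonsing_inv_mul G hG.det_pos.ne'.isUnit, Matrix.one_mulVec]
  calc ∑ a, ∑ b, G⁻¹ a b * Matrix.vecMulVec (G *ᵥ v) (G *ᵥ v) a b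
      = ∑ a, (G *ᵥ v) a * (G⁻¹ *ᵥ (G *ᵥ v)) a := by
        refine Finset.sum_congr rfl fun a _ => ?_
        rw [show (G⁻¹ *ᵥ (G *ᵥ v)) a = ∑ b, G⁻¹ a b * (G *ᵥ v) b from rfl, Finset.mul_sum]
        exact Finset.sum_congr rfl fun _ _ => by rw [Matrix.vecMulVec_apply]; ring
    _ = bil G v v := by
        rw [h1, bil_apply]
        simp only [Matrix.mulVec, dotProduct, Finset.sum_mul]
        rw [Finset.sum_comm]
        exact Finset.sum_congr rfl fun _ _ => Finset.sum_congr rfl fun _ _ => by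
          rw [← hs.apply]

variable {G : (Fin n → ℝ) → Matrix (Fin n) (Fin n) ℝ}

lemma IsFrame.scalarCurv_eq {x : Fin n → ℝ} {E : Fin n → Fin n → ℝ} (h : IsFrame (G x) E) :
    scalarCurv G x = ∑ c, bil (Matrix.of (ricci G x)) (E c) (E c) := by
  rw [h.sum_bil]; rfl

lemma IsFrame.ricSq_eq {x : Fin n → ℝ} {E : Fin n → Fin n → ℝ} (h : IsFrame (G x) E) :
    ricSq G x = ∑ c, ∑ d, bil (Matrix.of (ricci G x)) (E c) (E d) ^ 2 := by
  set S := Matrix.of (ricci G x) with hS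
  have h1 : ricSq G x = (((G x)⁻¹ * S * (G x)⁻¹) * Sᵀ).trace := by
    simp only [ricSq, Matrix.trace, Matrix.diag, Matrix.mul_apply (N := Sᵀ), Matrix.transpose_apply]
    rfl
  rw [h1, ← isFrame_iff_mul.1 h]
  set M := Matrix.of E
  have h2 : (Mᵀ * M * S * (Mᵀ * M) * Sᵀ).trace = ((M * S * Mᵀ) * (M * S * Mᵀ)ᵀ).trace := by
    simp only [Matrix.transpose_mul, Matrix.transpose_transpose]
    rw [show Mᵀ * M * S * (Mᵀ * M) * Sᵀ = Mᵀ * (M * S * Mᵀ * M * Sᵀ) by simp only [Matrix.mul_assoc],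
      Matrix.trace_mul_comm]
    simp only [Matrix.mul_assoc]
  rw [h2]
  simp only [bil_eq_mul, Matrix.trace, Matrix.diag, Matrix.mul_apply (N := (M * S * Mᵀ)ᵀ),
    Matrix.transpose_apply, sq]
  rfl

lemma SmoothMetric.scalarCurv_sq_le (hG : SmoothMetric G) (x : Fin n → ℝ) :
    scalarCurv G x ^ 2 ≤ n * ricSq G x := by
  obtain ⟨E, hE⟩ := exists_orthonormal (hG.2 x).2
  have h := isFrame_of_orthonormal hE
  rw [h.scalarCurv_eq, h.ricSq_eq]
  have h1 := sq_sum_le_card_mul_sum_sq (s := (Finset.univ : Finset (Fin n)))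
    (f := fun c => bil (Matrix.of (ricci G x)) (E c) (E c))
  simp only [Finset.card_univ, Fintype.card_fin] at h1
  refine h1.trans (mul_le_mul_of_nonneg_left ?_ (Nat.cast_nonneg n))
  exact Finset.sum_le_sum fun c _ => Finset.single_le_sum
    (f := fun d => bil (Matrix.of (ricci G x)) (E c) (E d) ^ 2)
    (fun _ _ => sq_nonneg _) (Finset.mem_univ c)

lemma sum_comm_five (F : Fin n → Fin n → Fin n → Fin n → Fin n → ℝ) :
    ∑ m, ∑ k, ∑ i, ∑ j, ∑ l, F m k i j l = ∑ i, ∑ l, ∑ j, ∑ m, ∑ k, F m k i j l := by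
  rw [Finset.sum_congr rfl fun m _ => Finset.sum_comm, Finset.sum_comm]
  refine Finset.sum_congr rfl fun i _ => ?_
  rw [Finset.sum_congr rfl fun m _ => Finset.sum_congr rfl fun k _ => Finset.sum_comm,
    Finset.sum_congr rfl fun m _ => Finset.sum_comm, Finset.sum_comm]
  refine Finset.sum_congr rfl fun l _ => ?_
  rw [Finset.sum_congr rfl fun m _ => Finset.sum_comm, Finset.sum_comm]

/-- The trace of the curvature term of the second variation. -/
lemma SmoothMetric.sum_curvature (hG : SmoothMetric G) {x : Fin n → ℝ} {E : Fin n → Fin n → ℝ}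
    (h : IsFrame (G x) E) (v : Fin n → ℝ) :
    ∑ c, bil (G x) (dchr G x (E c) v (E c) - dchr G x v (E c) (E c)
      + chr G x (E c) (chr G x v (E c)) - chr G x v (chr G x (E c) (E c))) v
      = - bil (Matrix.of (ricci G x)) v v := by
  have hu : IsUnit (G x).det := (hG.2 x).2.det_pos.ne'.isUnit
  have e1 : ∀ c, bil (G x) (dchr G x (E c) v (E c) - dchr G x v (E c) (E c)
      + chr G x (E c) (chr G x v (E c)) - chr G x v (chr G x (E c) (E c))) v
      = bil (Matrix.of fun i l => ∑ j, ∑ m, (G x * curvMat G x i j) m l * v j * v m)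
        (E c) (E c) := by
    intro c
    rw [bil_comm hG]
    simp only [bil_apply, curvature_vector, Matrix.of_apply, Matrix.mul_apply, Finset.mul_sum,
      Finset.sum_mul]
    rw [sum_comm_five]
    refine Finset.sum_congr rfl fun i _ => Finset.sum_congr rfl fun l _ => ?_
    exact Finset.sum_congr rfl fun j _ => Finset.sum_congr rfl fun m _ =>
      Finset.sum_congr rfl fun k _ => by ring
  simp only [e1]
  rw [h.sum_bil]
  have e2 : ∀ i j m, ∑ l, (G x)⁻¹ i l * (G x * curvMat G x i j) m l = - curvMat G x i j i m := by
    intro i j m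
    simp only [hG.metric_mul_curvMat x i j m, mul_neg, Finset.sum_neg_distrib]
    rw [← Matrix.mul_apply, ← Matrix.mul_assoc, Matrix.nonsing_inv_mul _ hu, Matrix.one_mul]
  calc ∑ i, ∑ l, (G x)⁻¹ i l * (Matrix.of fun i l => ∑ j, ∑ m,
        (G x * curvMat G x i j) m l * v j * v m) i l
      = ∑ i, ∑ j, ∑ m, (∑ l, (G x)⁻¹ i l * (G x * curvMat G x i j) m l) * v j * v m := by
        refine Finset.sum_congr rfl fun i _ => ?_
        simp only [Matrix.of_apply, Finset.mul_sum, Finset.sum_mul]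
        rw [Finset.sum_comm]
        refine Finset.sum_congr rfl fun j _ => ?_
        rw [Finset.sum_comm]
        exact Finset.sum_congr rfl fun _ _ => Finset.sum_congr rfl fun _ _ => by ring
    _ = - bil (Matrix.of (ricci G x)) v v := by
        simp only [e2, bil_apply, Matrix.of_apply, hG.ricci_eq_sum_curvMat, Finset.sum_mul,
          neg_mul, Finset.sum_neg_distrib]
        rw [neg_inj, Finset.sum_comm]
        refine Finset.sum_congr rfl fun j _ => ?_
        rw [Finset.sum_comm]

/-- The trace of the second variation of the energy density for the parallel variation. -/
lemma SmoothMetric.sum_deriv_deriv_edens (hG : SmoothMetric G) {x : Fin n → ℝ}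
    {E : Fin n → Fin n → ℝ} (h : IsFrame (G x) E) (v : Fin n → ℝ) (φ φ' : ℝ) :
    ∑ c, deriv (deriv (edens G x (φ • E c) (- chr G x (φ • E c) (φ • E c)) v
      (φ' • E c - chr G x v (φ • E c))
      (- dchr G x v (φ • E c) (φ • E c) - (2 * φ') • chr G x (E c) (φ • E c)
        + (2 : ℝ) • chr G x (chr G x v (φ • E c)) (φ • E c)))) 0
      = 2 * n * φ' ^ 2 - 2 * φ ^ 2 * bil (Matrix.of (ricci G x)) v v := by
  simp only [deriv_deriv_edens_parallel hG, Finset.sum_add_distrib, ← Finset.mul_sum,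
    hG.sum_curvature h, h.sum_bil_self (hG.2 x).1 (hG.2 x).2]
  ring

lemma hasDerivAt_comp_quadratic {f : (Fin n → ℝ) → ℝ} (hf : ContDiff ℝ (⊤ : ℕ∞) f)
    (x u q : Fin n → ℝ) (a : ℝ) :
    HasDerivAt (fun a : ℝ => f (x + a • u + (a ^ 2 / 2) • q))
      (∑ m, (u + a • q) m * pd f m (x + a • u + (a ^ 2 / 2) • q)) a := by
  rw [← fderiv_eq_sum_pd]
  exact ((hf.differentiable (by simp) _).hasFDerivAt).comp_hasDerivAt a
    (hasDerivAt_quadratic x u q a)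

lemma deriv_deriv_comp_quadratic {f : (Fin n → ℝ) → ℝ} (hf : ContDiff ℝ (⊤ : ℕ∞) f)
    (x u q : Fin n → ℝ) :
    deriv (deriv (fun a : ℝ => f (x + a • u + (a ^ 2 / 2) • q))) 0
      = ∑ j, ∑ k, pd (fun y => pd f k y) j x * u j * u k + ∑ m, q m * pd f m x := by
  rw [show deriv (fun a : ℝ => f (x + a • u + (a ^ 2 / 2) • q)) = _ from
    funext fun a => (hasDerivAt_comp_quadratic hf x u q a).deriv]
  have hpd : ∀ m, ContDiff ℝ (⊤ : ℕ∞) (fun y => pd f m y) := fun m => contDiff_fderiv_apply_const hf _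
  have h1 := HasDerivAt.fun_sum (u := Finset.univ) fun (m : Fin n) _ =>
    ((((hasDerivAt_id (0 : ℝ)).mul_const (q m)).const_add (u m)).mul
      (hasDerivAt_comp_quadratic (hpd m) x u q 0))
  refine (HasDerivAt.deriv h1).trans ?_
  simp only [zero_smul, add_zero, ne_eq, OfNat.ofNat_ne_zero, not_false_eq_true, zero_pow,
    zero_div, Finset.sum_add_distrib, one_mul, id_eq, zero_mul, Pi.add_apply]
  rw [add_comm]
  congr 1
  simp only [Finset.mul_sum, Pi.zero_apply, add_zero]
  rw [Finset.sum_comm]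
  exact Finset.sum_congr rfl fun _ _ => Finset.sum_congr rfl fun _ _ => by ring

/-- The frame sum of second derivatives is the Laplacian. -/
lemma IsFrame.sum_deriv_deriv {f : (Fin n → ℝ) → ℝ} (hf : ContDiff ℝ (⊤ : ℕ∞) f)
    {x : Fin n → ℝ} {E : Fin n → Fin n → ℝ} (h : IsFrame (G x) E) :
    ∑ c, deriv (deriv (fun a : ℝ => f (x + a • E c + (a ^ 2 / 2) • (- chr G x (E c) (E c))))) 0
      = lapl G f x := by
  have e : ∀ c, deriv (deriv (fun a : ℝ =>
      f (x + a • E c + (a ^ 2 / 2) • (- chr G x (E c) (E c))))) 0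
      = bil (Matrix.of fun j k => pd (fun y => pd f k y) j x
        - ∑ p, christoffel G x p j k * pd f p x) (E c) (E c) := by
    intro c
    rw [deriv_deriv_comp_quadratic hf]
    simp only [bil_apply, Matrix.of_apply, sub_mul, Finset.sum_sub_distrib,
      Pi.neg_apply, chr, vbil_apply, neg_mul, Finset.sum_neg_distrib, Finset.sum_mul]
    rw [← sub_eq_add_neg]
    congr 1
    rw [Finset.sum_comm]
    refine Finset.sum_congr rfl fun j _ => ?_
    rw [Finset.sum_comm]
    exact Finset.sum_congr rfl fun _ _ => Finset.sum_congr rfl fun _ _ => by ring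
  simp only [e]
  rw [h.sum_bil]
  rfl

end

section

/-- A curve which is differentiable on `[0,1]` with continuous derivative extends to a
globally `C¹` curve. -/
lemma exists_contDiff_extension {V : Type*} [NormedAddCommGroup V] [NormedSpace ℝ V]
    [CompleteSpace V] {α β : ℝ → V} (hβ : ContinuousOn β (Icc 0 1))
    (h : ∀ s ∈ Icc (0 : ℝ) 1, HasDerivWithinAt α (β s) (Icc 0 1) s) :
    ∃ E : ℝ → V, ContDiff ℝ 1 E ∧ EqOn E α (Icc 0 1) ∧
      ∀ s ∈ Icc (0 : ℝ) 1, HasDerivAt E (β s) s := by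
  set B : ℝ → V := IccExtend (zero_le_one' ℝ) ((Icc (0 : ℝ) 1).domRestrict β) with hB
  have hBc : Continuous B := hβ.domRestrict.Icc_extend'
  have hBe : ∀ s ∈ Icc (0 : ℝ) 1, B s = β s := fun s hs => by
    rw [hB, IccExtend_of_mem _ _ hs]; rfl
  have hd : ∀ s, HasDerivAt (fun s => α 0 + ∫ r in (0 : ℝ)..s, B r) (B s) s := fun s =>
    (intervalIntegral.integral_hasDerivAt_right (hBc.intervalIntegrable _ _)
      (hBc.stronglyMeasurableAtFilter _ _) hBc.continuousAt).const_add _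
  refine ⟨_, contDiff_one_iff_deriv.2 ⟨fun s => (hd s).differentiableAt, ?_⟩, ?_, ?_⟩
  · rwa [show deriv (fun s => α 0 + ∫ r in (0 : ℝ)..s, B r) = B from funext fun s => (hd s).deriv]
  · intro s hs
    have hc : ContinuousOn α (Icc 0 1) := fun r hr => (h r hr).continuousWithinAt
    refine eq_of_derivWithin_eq (a := 0) (b := 1)
      (fun r hr => (hd r).differentiableAt.differentiableWithinAt)
      (fun r hr => (h r hr).differentiableWithinAt) ?_ (by simp) s hs
    intro r hr
    have hr' := Ico_subset_Icc_self hr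
    have hu := uniqueDiffOn_Icc (zero_lt_one' ℝ) r hr'
    rw [(hd r).hasDerivWithinAt.derivWithin hu, (h r hr').derivWithin hu, hBe r hr']
  · intro s hs
    rw [← hBe s hs]; exact hd s

/-- Global solutions of linear differential equations on `[0,1]`. -/
lemma exists_linear_ode {n : ℕ} {B : ℝ → (Fin n → ℝ) →L[ℝ] (Fin n → ℝ)} (hB : Continuous B)
    (e₀ : Fin n → ℝ) : ∃ E : ℝ → Fin n → ℝ, ContDiff ℝ 1 E ∧ E 0 = e₀ ∧
      ∀ s ∈ Icc (0 : ℝ) 1, HasDerivAt E (B s (E s)) s := by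
  obtain ⟨K, hK⟩ := isCompact_Icc.exists_bound_of_continuousOn (s := Icc (0 : ℝ) 1) hB.continuousOn
  have hK0 : 0 ≤ K := (norm_nonneg _).trans (hK 0 ⟨le_rfl, zero_le_one⟩)
  set R := gronwallBound ‖e₀‖ K 0 1 with hR
  have hmono : ∀ s ∈ Icc (0 : ℝ) 1, gronwallBound ‖e₀‖ K 0 s ≤ R := fun s hs =>
    gronwallBound_mono (norm_nonneg _) le_rfl hK0 hs.2
  have hR0 : 0 ≤ R := (norm_nonneg e₀).trans
    ((gronwallBound_x0 ‖e₀‖ K 0).symm.le.trans (hmono 0 ⟨le_rfl, zero_le_one⟩))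
  have hRR : -R ≤ R := by linarith
  set P : (Fin n → ℝ) → (Fin n → ℝ) := fun x i => projIcc (-R) R hRR (x i) with hP
  have hPL : LipschitzWith 1 P := by
    refine LipschitzWith.of_dist_le_mul fun x y => ?_
    rw [NNReal.coe_one, one_mul]
    refine (dist_pi_le_iff dist_nonneg).2 fun i => ?_
    exact ((LipschitzWith.projIcc hRR).dist_le_mul (x i) (y i)).trans
      (by simpa using dist_le_pi_dist x y i)
  have hP0 : P 0 = 0 := by
    ext i; simp [hP, projIcc_of_mem hRR (show (0 : ℝ) ∈ Icc (-R) R from ⟨by linarith, hR0⟩)]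
  have hPn : ∀ x, ‖P x‖ ≤ ‖x‖ := fun x => by
    have := hPL.dist_le_mul x 0
    rwa [hP0, dist_zero_right, dist_zero_right, NNReal.coe_one, one_mul] at this
  have hPR : ∀ x, ‖P x‖ ≤ R := fun x => (pi_norm_le_iff_of_nonneg hR0).2 fun i =>
    abs_le.2 (projIcc (-R) R hRR (x i)).2
  have hPid : ∀ x, ‖x‖ ≤ R → P x = x := fun x hx => by
    ext i
    simp only [hP]
    rw [projIcc_of_mem hRR (abs_le.1 ((norm_le_pi_norm x i).trans hx))]
  have hpl : IsPicardLindelof (fun s x => B s (P x)) (⟨0, le_rfl, zero_le_one⟩ : Icc (0 : ℝ) 1) e₀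
      (K * R).toNNReal 0 (K * R).toNNReal K.toNNReal := by
    refine ⟨fun s hs => LipschitzWith.lipschitzOnWith ?_, fun x _ => ?_, fun s hs x _ => ?_, ?_⟩
    · refine LipschitzWith.of_dist_le_mul fun x y => ?_
      rw [Real.coe_toNNReal _ hK0, dist_eq_norm, ← map_sub]
      refine ((B s).le_opNorm _).trans (mul_le_mul (hK s hs) ?_ (norm_nonneg _) hK0)
      rw [← dist_eq_norm]
      simpa using hPL.dist_le_mul x y
    · exact (hB.clm_apply continuous_const).continuousOn
    · rw [Real.coe_toNNReal _ (mul_nonneg hK0 hR0)]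
      exact ((B s).le_opNorm _).trans (mul_le_mul (hK s hs) (hPR x) (norm_nonneg _) hK0)
    · simp
  obtain ⟨α, hα0, hα⟩ := hpl.exists_eq_forall_mem_Icc_hasDerivWithinAt₀
  have hαc : ContinuousOn α (Icc 0 1) := fun s hs => (hα s hs).continuousWithinAt
  have hb : ∀ s ∈ Icc (0 : ℝ) 1, ‖α s‖ ≤ R := by
    intro s hs
    refine (norm_le_gronwallBound_of_norm_deriv_right_le (δ := ‖e₀‖) (K := K) (ε := 0) hαc
      (fun r hr => (hα r (Ico_subset_Icc_self hr)).mono_of_mem_nhdsWithin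
        (Icc_mem_nhdsGE_of_mem hr)) (by simp [hα0])
      (fun r hr => ?_) s hs).trans (by rw [sub_zero]; exact hmono s hs)
    rw [add_zero]
    exact ((B r).le_opNorm _).trans
      (mul_le_mul (hK r (Ico_subset_Icc_self hr)) (hPn _) (norm_nonneg _) hK0)
  have hα' : ∀ s ∈ Icc (0 : ℝ) 1, HasDerivWithinAt α (B s (α s)) (Icc 0 1) s := fun s hs => by
    have := hα s hs; rwa [hPid _ (hb s hs)] at this
  obtain ⟨E, hE, hEe, hEd⟩ := exists_contDiff_extension (hB.continuousOn.clm_apply hαc) hα'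
  refine ⟨E, hE, (hEe ⟨le_rfl, zero_le_one⟩).trans hα0, fun s hs => ?_⟩
  rw [hEe hs]; exact hEd s hs

variable {n : ℕ} {G : (Fin n → ℝ) → Matrix (Fin n) (Fin n) ℝ}

lemma SmoothMetric.contDiff_christoffel_comp (hG : SmoothMetric G) {γ : ℝ → Fin n → ℝ}
    {m : WithTop ℕ∞} (hm : m ≤ (⊤ : ℕ∞)) (hγ : ContDiff ℝ m γ) (k i j : Fin n) :
    ContDiff ℝ m fun s => christoffel G (γ s) k i j :=
  ((contDiff_christoffel hG k i j).of_le hm).comp hγ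

/-- Parallel orthonormal frames along `C¹` curves. -/
lemma SmoothMetric.exists_parallel_frame (hG : SmoothMetric G) {γ : ℝ → Fin n → ℝ}
    (hγ : ContDiff ℝ 1 γ) : ∃ E : Fin n → ℝ → Fin n → ℝ, (∀ c, ContDiff ℝ 1 (E c)) ∧
      (∀ c, ∀ s ∈ Icc (0 : ℝ) 1, HasDerivAt (E c) (- chr G (γ s) (deriv γ s) (E c s)) s) ∧
      ∀ s ∈ Icc (0 : ℝ) 1, IsFrame (G (γ s)) fun c => E c s := by
  obtain ⟨E₀, hE₀⟩ := exists_orthonormal (hG.2 (γ 0)).2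
  set B : ℝ → (Fin n → ℝ) →L[ℝ] (Fin n → ℝ) := fun s =>
    LinearMap.toContinuousLinearMap (- chr G (γ s) (deriv γ s)) with hB
  have hγ' : Continuous (deriv γ) := hγ.continuous_deriv le_rfl
  have hBc : Continuous B := by
    rw [continuous_clm_apply]
    intro y
    refine continuous_pi fun k => ?_
    simp only [hB, LinearMap.coe_toContinuousLinearMap', LinearMap.neg_apply, Pi.neg_apply, chr,
      vbil_apply]
    refine Continuous.neg (continuous_finsetSum _ fun i _ => continuous_finsetSum _ fun j _ => ?_)
    exact ((hG.contDiff_christoffel_comp (by simp) hγ k i j).continuous.mul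
      ((continuous_apply i).comp hγ')).mul continuous_const
  choose E hE hE0 hEd using fun c => exists_linear_ode hBc (E₀ c)
  have hEd' : ∀ c, ∀ s ∈ Icc (0 : ℝ) 1, HasDerivAt (E c) (- chr G (γ s) (deriv γ s) (E c s)) s :=
    hEd
  refine ⟨E, hE, hEd', fun s hs => isFrame_of_orthonormal fun c d => ?_⟩
  rw [← hE₀ c d, ← hE0 c, ← hE0 d]
  have hd : ∀ s ∈ Icc (0 : ℝ) 1,
      HasDerivAt (fun s => bil (G (γ s)) (E c s) (E d s)) 0 s := fun s hs => by
    refine (hasDerivAt_bil hG ((hγ.differentiable (by simp)) s).hasDerivAt (hEd' c s hs)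
      (hEd' d s hs)).congr_deriv ?_
    simp
  exact constant_of_has_deriv_right_zero (fun s hs => (hd s hs).continuousAt.continuousWithinAt)
    (fun s hs => (hd s (Ico_subset_Icc_self hs)).hasDerivWithinAt) s hs

end

section

/-- A second order Taylor estimate. -/
lemma taylor_two {F F₁ F₂ F₃ : ℝ → ℝ} {x h C : ℝ}
    (h₁ : ∀ y, |y - x| ≤ |h| → HasDerivAt F (F₁ y) y)
    (h₂ : ∀ y, |y - x| ≤ |h| → HasDerivAt F₁ (F₂ y) y)
    (h₃ : ∀ y, |y - x| ≤ |h| → HasDerivAt F₂ (F₃ y) y)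
    (hC : ∀ y, |y - x| ≤ |h| → |F₃ y| ≤ C) :
    |F (x + h) - F x - h * F₁ x - h ^ 2 / 2 * F₂ x| ≤ C * |h| ^ 3 := by
  have key : ∀ (H H' : ℝ → ℝ) (c : ℝ), (∀ y, |y - x| ≤ |h| → HasDerivAt H (H' y) y) →
      (∀ y, |y - x| ≤ |h| → |H' y| ≤ c) → ∀ y, |y - x| ≤ |h| → |H y - H x| ≤ c * |h| := by
    intro H H' c hH hc y hy
    have hs : Convex ℝ (Metric.closedBall x |h|) := convex_closedBall x _
    have hm : ∀ z, z ∈ Metric.closedBall x |h| ↔ |z - x| ≤ |h| := fun z => by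
      rw [Metric.mem_closedBall, Real.dist_eq]
    have := hs.norm_image_sub_le_of_norm_hasDerivWithin_le (f := H) (f' := H') (C := c)
      (fun z hz => (hH z ((hm z).1 hz)).hasDerivWithinAt) (fun z hz => hc z ((hm z).1 hz))
      (Metric.mem_closedBall_self (abs_nonneg h)) ((hm y).2 hy)
    refine this.trans (mul_le_mul_of_nonneg_left hy ?_)
    exact (abs_nonneg _).trans (hc y hy)
  have k₂ := key F₂ F₃ C h₃ hC
  have k₁ := key (fun y => F₁ y - y * F₂ x) (fun y => F₂ y - F₂ x) (C * |h|)
    (fun y hy => ((h₂ y hy).sub ((hasDerivAt_id y).mul_const (F₂ x))).congr_deriv (by ring)) k₂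
  have k₀ := key (fun y => F y - y * F₁ x - (y - x) ^ 2 / 2 * F₂ x)
    (fun y => F₁ y - F₁ x - (y - x) * F₂ x) (C * |h| * |h|)
    (fun y hy => by
      have := ((h₁ y hy).sub ((hasDerivAt_id y).mul_const (F₁ x))).sub
        (((((hasDerivAt_id y).sub_const x).pow 2).div_const 2).mul_const (F₂ x))
      refine this.congr_deriv ?_
      simp)
    (fun y hy => by
      have := k₁ y hy
      refine le_trans (le_of_eq ?_) this
      congr 1; ring)
  have := k₀ (x + h) (by simp)
  refine le_trans (le_of_eq ?_) (this.trans (le_of_eq (by ring)))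
  congr 1; ring

/-- The derivative with respect to the distinguished real variable. -/
lemma hasDerivAt_slice_snd {Y : Type*} [NormedAddCommGroup Y] [NormedSpace ℝ Y] {T : ℝ}
    {f : (Y × ℝ) × ℝ → ℝ} (hf : ContDiffOn ℝ (⊤ : ℕ∞) f (univ ×ˢ Icc 0 T)) (d : Y) {t : ℝ}
    (ht : t ∈ Icc 0 T) (a : ℝ) :
    HasDerivAt (fun a => f ((d, a), t)) (fderiv ℝ (fun y => f (y, t)) (d, a) (0, 1)) a := by
  have h1 := ((hf.slice ht).differentiable (by simp) (d, a)).hasFDerivAt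
  have h2 : HasDerivAt (fun a : ℝ => (d, a)) ((0 : Y), (1 : ℝ)) a :=
    (hasDerivAt_const a d).prodMk (hasDerivAt_id a)
  exact h1.comp_hasDerivAt a h2

/-- Uniform second order Taylor estimates on compact sets of parameters. -/
lemma exists_uniform_taylor {Y : Type*} [NormedAddCommGroup Y] [NormedSpace ℝ Y] {T : ℝ}
    (hT : 0 < T) {f : (Y × ℝ) × ℝ → ℝ} (hf : ContDiffOn ℝ (⊤ : ℕ∞) f (univ ×ˢ Icc 0 T))
    {D : Set Y} (hD : IsCompact D) :
    ∃ C, ∀ d ∈ D, ∀ t ∈ Icc 0 T,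
      |deriv (fun a => f ((d, a), t)) 0| ≤ C ∧ |deriv (deriv fun a => f ((d, a), t)) 0| ≤ C ∧
      ∀ a, |a| ≤ 1 → |f ((d, a), t) - f ((d, 0), t) - a * deriv (fun a => f ((d, a), t)) 0
        - a ^ 2 / 2 * deriv (deriv fun a => f ((d, a), t)) 0| ≤ C * |a| ^ 3 := by
  set f₁ : (Y × ℝ) × ℝ → ℝ := fun p => fderiv ℝ (fun y => f (y, p.2)) p.1 (0, 1) with hf₁
  have hs₁ : ContDiffOn ℝ (⊤ : ℕ∞) f₁ (univ ×ˢ Icc 0 T) := contDiffOn_fderiv_fst hT hf _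
  set f₂ : (Y × ℝ) × ℝ → ℝ := fun p => fderiv ℝ (fun y => f₁ (y, p.2)) p.1 (0, 1) with hf₂
  have hs₂ : ContDiffOn ℝ (⊤ : ℕ∞) f₂ (univ ×ˢ Icc 0 T) := contDiffOn_fderiv_fst hT hs₁ _
  set f₃ : (Y × ℝ) × ℝ → ℝ := fun p => fderiv ℝ (fun y => f₂ (y, p.2)) p.1 (0, 1) with hf₃
  have hs₃ : ContDiffOn ℝ (⊤ : ℕ∞) f₃ (univ ×ˢ Icc 0 T) := contDiffOn_fderiv_fst hT hs₂ _
  have hK : IsCompact ((D ×ˢ Icc (-1 : ℝ) 1) ×ˢ Icc 0 T) := (hD.prod isCompact_Icc).prod isCompact_Icc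
  have hsub : (D ×ˢ Icc (-1 : ℝ) 1) ×ˢ Icc 0 T ⊆ univ ×ˢ Icc 0 T :=
    prod_mono (subset_univ _) le_rfl
  obtain ⟨C₁, hC₁⟩ := hK.exists_bound_of_continuousOn (hs₁.continuousOn.mono hsub)
  obtain ⟨C₂, hC₂⟩ := hK.exists_bound_of_continuousOn (hs₂.continuousOn.mono hsub)
  obtain ⟨C₃, hC₃⟩ := hK.exists_bound_of_continuousOn (hs₃.continuousOn.mono hsub)
  refine ⟨max C₁ (max C₂ C₃), fun d hd t ht => ?_⟩
  have e₁ : deriv (fun a => f ((d, a), t)) = fun a => f₁ ((d, a), t) :=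
    funext fun a => (hasDerivAt_slice_snd hf d ht a).deriv
  have e₂ : deriv (deriv fun a => f ((d, a), t)) = fun a => f₂ ((d, a), t) := by
    rw [e₁]; exact funext fun a => (hasDerivAt_slice_snd hs₁ d ht a).deriv
  rw [e₂, e₁]
  have h0 : ((d, (0 : ℝ)), t) ∈ (D ×ˢ Icc (-1 : ℝ) 1) ×ˢ Icc 0 T := ⟨⟨hd, by norm_num⟩, ht⟩
  refine ⟨(hC₁ _ h0).trans (le_max_left _ _),
    (hC₂ _ h0).trans ((le_max_left _ _).trans (le_max_right _ _)), fun a ha => ?_⟩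
  have := taylor_two (F := fun a => f ((d, a), t)) (F₁ := fun a => f₁ ((d, a), t))
    (F₂ := fun a => f₂ ((d, a), t)) (F₃ := fun a => f₃ ((d, a), t)) (x := 0) (h := a)
    (C := max C₁ (max C₂ C₃))
    (fun y _ => hasDerivAt_slice_snd hf d ht y) (fun y _ => hasDerivAt_slice_snd hs₁ d ht y)
    (fun y _ => hasDerivAt_slice_snd hs₂ d ht y) (fun y hy => by
      rw [sub_zero] at hy
      exact (hC₃ ((d, y), t) ⟨⟨hd, abs_le.1 (hy.trans ha)⟩, ht⟩).trans
        ((le_max_right _ _).trans (le_max_right _ _)))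
  simpa using this

/-- Uniform backward first order expansion in time on compact sets of parameters. -/
lemma exists_uniform_time {X : Type*} [PseudoMetricSpace X] {T : ℝ} {D : Set X} (hD : IsCompact D)
    {f q : X → ℝ → ℝ} (hf : ∀ x ∈ D, ContinuousOn (f x) (Icc 0 T))
    (hq : ContinuousOn (fun p : X × ℝ => q p.1 p.2) (D ×ˢ Icc 0 T))
    (hfq : ∀ x ∈ D, ∀ t ∈ Ioo 0 T, HasDerivAt (f x) (q x t) t) {ε : ℝ} (hε : 0 < ε) :
    ∃ τ₀ > 0, ∀ x ∈ D, ∀ t ∈ Icc 0 T, ∀ τ, 0 ≤ τ → τ < τ₀ → t - τ ∈ Icc 0 T →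
      |f x (t - τ) - f x t + τ * q x t| ≤ ε * τ := by
  have hu := (hD.prod isCompact_Icc).uniformContinuousOn_of_continuous hq
  rw [Metric.uniformContinuousOn_iff] at hu
  obtain ⟨τ₀, hτ₀, h⟩ := hu ε hε
  refine ⟨τ₀, hτ₀, fun x hx t ht τ hτ hlt ht' => ?_⟩
  rcases hτ.eq_or_lt with rfl | hτ
  · simp
  have hsub : Icc (t - τ) t ⊆ Icc 0 T := Icc_subset_Icc ht'.1 ht.2
  obtain ⟨s, hs, he⟩ := exists_hasDerivAt_eq_slope (f x) (q x) (show t - τ < t by linarith)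
    ((hf x hx).mono hsub) (fun r hr => hfq x hx r ⟨ht'.1.trans_lt hr.1, hr.2.trans_le ht.2⟩)
  have h1 := h (x, s) ⟨hx, hsub (Ioo_subset_Icc_self hs)⟩ (x, t) ⟨hx, ht⟩ (by
    rw [Prod.dist_eq, dist_self, Real.dist_eq, abs_of_nonpos (by linarith [hs.2])]
    exact max_lt hτ₀ (by linarith [hs.1]))
  rw [Real.dist_eq] at h1
  rw [eq_div_iff (by linarith)] at he
  rw [show f x (t - τ) - f x t + τ * q x t = -(q x s - q x t) * τ by linarith, abs_mul, abs_neg,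
    abs_of_pos hτ]
  exact mul_le_mul_of_nonneg_right h1.le hτ.le

end

section

variable {n : ℕ}

lemma bil_self_nonneg {A : Matrix (Fin n) (Fin n) ℝ} (hA : A.PosSemidef) (u : Fin n → ℝ) :
    0 ≤ bil A u u := by
  have := hA.dotProduct_mulVec_nonneg u
  rw [star_trivial] at this
  refine this.trans_eq ?_
  simp only [bil_apply, Matrix.mulVec, dotProduct, Finset.mul_sum]
  exact Finset.sum_congr rfl fun _ _ => Finset.sum_congr rfl fun _ _ => by ring

lemma bil_self_pos {A : Matrix (Fin n) (Fin n) ℝ} (hA : A.PosDef) {u : Fin n → ℝ} (hu : u ≠ 0) :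
    0 < bil A u u := by
  have := hA.dotProduct_mulVec_pos hu
  rw [star_trivial] at this
  refine this.trans_eq ?_
  simp only [bil_apply, Matrix.mulVec, dotProduct, Finset.mul_sum]
  exact Finset.sum_congr rfl fun _ _ => Finset.sum_congr rfl fun _ _ => by ring

/-- The squared speed of a curve. -/
def sqSpeed (G : (Fin n → ℝ) → Matrix (Fin n) (Fin n) ℝ) (γ : ℝ → Fin n → ℝ) (s : ℝ) : ℝ :=
  bil (G (γ s)) (deriv γ s) (deriv γ s)

/-- The energy of a curve. -/
def energy (G : (Fin n → ℝ) → Matrix (Fin n) (Fin n) ℝ) (γ : ℝ → Fin n → ℝ) : ℝ :=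
  ∫ s in (0 : ℝ)..1, sqSpeed G γ s

lemma pathLength_eq (G : (Fin n → ℝ) → Matrix (Fin n) (Fin n) ℝ) (γ : ℝ → Fin n → ℝ) :
    pathLength G γ = ∫ s in (0 : ℝ)..1, Real.sqrt (sqSpeed G γ s) := rfl

lemma pathLength_nonneg (G : (Fin n → ℝ) → Matrix (Fin n) (Fin n) ℝ) (γ : ℝ → Fin n → ℝ) :
    0 ≤ pathLength G γ :=
  intervalIntegral.integral_nonneg zero_le_one fun _ _ => Real.sqrt_nonneg _

variable {G : (Fin n → ℝ) → Matrix (Fin n) (Fin n) ℝ} (hG : SmoothMetric G)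

lemma continuous_bil {X : Type*} [TopologicalSpace X] {A : X → Matrix (Fin n) (Fin n) ℝ}
    {u w : X → Fin n → ℝ} (hA : ∀ i j, Continuous fun x => A x i j) (hu : Continuous u)
    (hw : Continuous w) : Continuous fun x => bil (A x) (u x) (w x) := by
  simp only [bil_apply]
  exact continuous_finsetSum _ fun i _ => continuous_finsetSum _ fun j _ =>
    ((hA i j).mul ((continuous_apply i).comp hu)).mul ((continuous_apply j).comp hw)

include hG

lemma sqSpeed_nonneg (γ : ℝ → Fin n → ℝ) (s : ℝ) : 0 ≤ sqSpeed G γ s :=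
  bil_self_nonneg (hG.2 _).2.posSemidef _

lemma continuous_sqSpeed {γ : ℝ → Fin n → ℝ} (hγ : ContDiff ℝ 1 γ) : Continuous (sqSpeed G γ) :=
  continuous_bil (fun i j => (hG.1 i j).continuous.comp hγ.continuous) (hγ.continuous_deriv le_rfl)
    (hγ.continuous_deriv le_rfl)

omit hG in
lemma riemDist_le_pathLength {γ : ℝ → Fin n → ℝ} (hγ : ContDiff ℝ 1 γ) :
    riemDist G (γ 0) (γ 1) ≤ pathLength G γ :=
  csInf_le ⟨0, by rintro _ ⟨γ, _, _, _, rfl⟩; exact pathLength_nonneg G γ⟩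
    ⟨γ, hγ.contDiffOn, rfl, rfl, rfl⟩

omit hG in
lemma riemDist_le_integral {γ : ℝ → Fin n → ℝ} (hγ : ContDiff ℝ 1 γ) {s : ℝ} (hs : 0 ≤ s) :
    riemDist G (γ 0) (γ s) ≤ ∫ r in (0 : ℝ)..s, Real.sqrt (sqSpeed G γ r) := by
  have hβ : ContDiff ℝ 1 fun r => γ (s * r) := hγ.comp (contDiff_const.mul contDiff_id)
  have h := riemDist_le_pathLength (G := G) hβ
  simp only [mul_zero, mul_one] at h
  refine h.trans_eq ?_
  have hd : ∀ r, deriv (fun r => γ (s * r)) r = s • deriv γ (s * r) := fun r => by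
    have h1 := ((hγ.differentiable (by simp)) (s * r)).hasDerivAt
    have h2 : HasDerivAt (fun r : ℝ => s * r) s r := by
      simpa using (hasDerivAt_id r).const_mul s
    exact (h1.scomp r h2).deriv
  have e : ∀ r, Real.sqrt (sqSpeed G (fun r => γ (s * r)) r)
      = s * Real.sqrt (sqSpeed G γ (s * r)) := fun r => by
    simp only [sqSpeed, hd, map_smul, LinearMap.smul_apply, smul_eq_mul]
    rw [← mul_assoc, Real.sqrt_mul (mul_self_nonneg s), Real.sqrt_mul_self hs]
  rw [pathLength_eq]
  simp only [e]
  rw [intervalIntegral.integral_const_mul,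
    intervalIntegral.mul_integral_comp_mul_left (f := fun r => Real.sqrt (sqSpeed G γ r))]
  simp

lemma pathLength_sq_le_energy {γ : ℝ → Fin n → ℝ} (hγ : ContDiff ℝ 1 γ) :
    pathLength G γ ^ 2 ≤ energy G γ := by
  have hc := continuous_sqSpeed hG hγ
  have hv : Continuous fun s => Real.sqrt (sqSpeed G γ s) := hc.sqrt
  set l := pathLength G γ with hl
  have h0 : 0 ≤ ∫ s in (0 : ℝ)..1, (Real.sqrt (sqSpeed G γ s) - l) ^ 2 :=
    intervalIntegral.integral_nonneg zero_le_one fun _ _ => sq_nonneg _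
  have e : ∀ s, (Real.sqrt (sqSpeed G γ s) - l) ^ 2
      = sqSpeed G γ s - (2 * l) * Real.sqrt (sqSpeed G γ s) + l ^ 2 := fun s => by
    rw [sub_sq, Real.sq_sqrt (sqSpeed_nonneg hG γ s)]; ring
  simp only [e] at h0
  have i2 : Continuous fun s => 2 * l * Real.sqrt (sqSpeed G γ s) := continuous_const.mul hv
  have i1 : Continuous fun s => sqSpeed G γ s - 2 * l * Real.sqrt (sqSpeed G γ s) := hc.sub i2
  rw [intervalIntegral.integral_add (i1.intervalIntegrable _ _)
    (continuous_const.intervalIntegrable _ _), intervalIntegral.integral_sub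
    (hc.intervalIntegrable _ _) (i2.intervalIntegrable _ _),
    intervalIntegral.integral_const_mul, ← pathLength_eq, ← hl] at h0
  simp only [intervalIntegral.integral_const, sub_zero, one_smul] at h0
  change 0 ≤ energy G γ - _ + _ at h0
  nlinarith

omit hG in
lemma exists_path_of_riemDist_lt {x y : Fin n → ℝ} {r : ℝ} (h : riemDist G x y < r) :
    ∃ γ : ℝ → Fin n → ℝ, ContDiff ℝ 1 γ ∧ γ 0 = x ∧ γ 1 = y ∧ pathLength G γ < r := by
  have hne : {L : ℝ | ∃ γ : ℝ → (Fin n → ℝ),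
      ContDiffOn ℝ 1 γ (Icc 0 1) ∧ γ 0 = x ∧ γ 1 = y ∧ L = pathLength G γ}.Nonempty :=
    ⟨_, fun s => x + s • (y - x), (contDiff_const.add (contDiff_id.smul contDiff_const)).contDiffOn,
      by simp, by simp, rfl⟩
  obtain ⟨_, ⟨α, hα, h0, h1, rfl⟩, hlt⟩ := exists_lt_of_csInf_lt hne h
  have hu := uniqueDiffOn_Icc (zero_lt_one' ℝ)
  obtain ⟨γ, hγ, he, hd⟩ := exists_contDiff_extension (α := α) (β := derivWithin α (Icc 0 1))
    (hα.continuousOn_derivWithin hu le_rfl)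
    (fun s hs => ((hα.differentiableOn (by simp)) s hs).hasDerivWithinAt)
  refine ⟨γ, hγ, (he ⟨le_rfl, zero_le_one⟩).trans h0, (he ⟨zero_le_one, le_rfl⟩).trans h1, ?_⟩
  refine lt_of_eq_of_lt ?_ hlt
  rw [pathLength_eq, pathLength_eq, intervalIntegral.integral_of_le zero_le_one,
    intervalIntegral.integral_of_le zero_le_one, integral_Ioc_eq_integral_Ioo,
    integral_Ioc_eq_integral_Ioo]
  refine setIntegral_congr_fun measurableSet_Ioo fun s hs => ?_
  have hs' := Ioo_subset_Icc_self hs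
  simp only [sqSpeed, he hs', (hd s hs').deriv,
    derivWithin_of_mem_nhds (Icc_mem_nhds hs.1 hs.2)]

/-- Reparametrization to almost constant speed. -/
lemma exists_reparam {γ : ℝ → Fin n → ℝ} (hγ : ContDiff ℝ 1 γ) {l : ℝ} (h : pathLength G γ < l) :
    ∃ η : ℝ → Fin n → ℝ, ContDiff ℝ 1 η ∧ η 0 = γ 0 ∧ η 1 = γ 1 ∧
      ∀ s, sqSpeed G η s ≤ l ^ 2 := by
  have hl : 0 < l := (pathLength_nonneg G γ).trans_lt h
  set ε := l - pathLength G γ with hε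
  have hε0 : 0 < ε := sub_pos.2 h
  set v : ℝ → ℝ := fun s => Real.sqrt (sqSpeed G γ s) with hv
  have hvc : Continuous v := (continuous_sqSpeed hG hγ).sqrt
  have hv0 : ∀ s, 0 ≤ v s := fun s => Real.sqrt_nonneg _
  set w : ℝ → ℝ := fun s => (v s + ε) / l with hw
  have hwc : Continuous w := (hvc.add continuous_const).div_const l
  have hw0 : ∀ s, ε / l ≤ w s := fun s => div_le_div_of_nonneg_right (by linarith [hv0 s]) hl.le
  have hwp : ∀ s, 0 < w s := fun s => (div_pos hε0 hl).trans_le (hw0 s)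
  set σ : ℝ → ℝ := fun s => ∫ r in (0 : ℝ)..s, w r with hσ
  have hd : ∀ s, HasDerivAt σ (w s) s := fun s =>
    intervalIntegral.integral_hasDerivAt_right (hwc.intervalIntegrable _ _)
      (hwc.stronglyMeasurableAtFilter _ _) hwc.continuousAt
  have hσ0 : σ 0 = 0 := by simp [hσ]
  have hσ1 : σ 1 = 1 := by
    simp only [hσ, hw]
    rw [intervalIntegral.integral_div, intervalIntegral.integral_add (hvc.intervalIntegrable _ _)
      (continuous_const.intervalIntegrable _ _), ← pathLength_eq]
    simp only [intervalIntegral.integral_const, sub_zero, one_smul, hε]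
    field_simp
    ring
  have hmono : StrictMono σ := strictMono_of_deriv_pos fun s => by rw [(hd s).deriv]; exact hwp s
  have hc : Continuous σ := continuous_iff_continuousAt.2 fun s => (hd s).continuousAt
  have hlin : Monotone fun s => σ s - ε / l * s := by
    refine monotone_of_deriv_nonneg (fun s => (((hd s).sub
      ((hasDerivAt_id s).const_mul (ε / l)))).differentiableAt) fun s => ?_
    have h1 : HasDerivAt (fun s => σ s - ε / l * s) (w s - ε / l * 1) s :=
      (hd s).sub ((hasDerivAt_id s).const_mul (ε / l))
    rw [h1.deriv]
    linarith [hw0 s]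
  have hcpos : 0 < ε / l := div_pos hε0 hl
  have htop : Filter.Tendsto σ Filter.atTop Filter.atTop := by
    refine Filter.tendsto_atTop_mono' _ ?_ (Filter.tendsto_id.const_mul_atTop hcpos)
    filter_upwards [Filter.eventually_ge_atTop 0] with s hs
    have := hlin hs
    simp only [hσ0, mul_zero, sub_zero] at this
    simpa using this
  have hbot : Filter.Tendsto σ Filter.atBot Filter.atBot := by
    refine Filter.tendsto_atBot_mono' _ ?_ (Filter.tendsto_id.const_mul_atBot hcpos)
    filter_upwards [Filter.eventually_le_atBot 0] with s hs
    have := hlin hs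
    simp only [hσ0, mul_zero, sub_zero] at this
    simpa using this
  set e := hmono.orderIsoOfSurjective σ (hc.surjective htop hbot) with he
  set φ : ℝ → ℝ := fun r => e.symm r with hφ
  have hσφ : ∀ r, σ (φ r) = r := fun r => e.apply_symm_apply r
  have hφc : Continuous φ := e.symm.continuous
  have hφd : ∀ r, HasDerivAt φ (w (φ r))⁻¹ r := fun r =>
    HasDerivAt.of_local_left_inverse hφc.continuousAt (hd (φ r)) (hwp _).ne'
      (Filter.Eventually.of_forall hσφ)
  have hφ0 : φ 0 = 0 := hmono.injective (by rw [hσφ, hσ0])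
  have hφ1 : φ 1 = 1 := hmono.injective (by rw [hσφ, hσ1])
  have hφC : ContDiff ℝ 1 φ := contDiff_one_iff_deriv.2
    ⟨fun r => (hφd r).differentiableAt, by
      rw [show deriv φ = fun r => (w (φ r))⁻¹ from funext fun r => (hφd r).deriv]
      exact (hwc.comp hφc).inv₀ fun r => (hwp _).ne'⟩
  refine ⟨γ ∘ φ, hγ.comp hφC, by simp [hφ0], by simp [hφ1], fun s => ?_⟩
  have hde : deriv (γ ∘ φ) s = (w (φ s))⁻¹ • deriv γ (φ s) :=
    (((hγ.differentiable (by simp)) (φ s)).hasDerivAt.scomp s (hφd s)).deriv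
  have hsq : sqSpeed G (γ ∘ φ) s = (v (φ s) / w (φ s)) ^ 2 := by
    simp only [sqSpeed, hde, map_smul, LinearMap.smul_apply, smul_eq_mul, Function.comp]
    rw [div_pow, hv, Real.sq_sqrt (sqSpeed_nonneg hG γ _)]
    simp only [sqSpeed]
    have := (hwp (φ s)).ne'
    field_simp
  rw [hsq]
  refine pow_le_pow_left₀ (div_nonneg (hv0 _) (hwp _).le) ?_ 2
  rw [div_le_iff₀ (hwp _), hw]
  have : l * ((v (φ s) + ε) / l) = v (φ s) + ε := by field_simp
  simp only [this]
  linarith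

end

section

variable {n : ℕ}

lemma bil_self_scale (A : Matrix (Fin n) (Fin n) ℝ) (u : Fin n → ℝ) :
    bil A u u = ‖u‖ ^ 2 * bil A (‖u‖⁻¹ • u) (‖u‖⁻¹ • u) := by
  rcases eq_or_ne u 0 with rfl | hu
  · simp
  · have := norm_ne_zero_iff.2 hu
    simp only [map_smul, LinearMap.smul_apply, smul_eq_mul]
    field_simp

lemma norm_normalize_mem_sphere {u : Fin n → ℝ} (hu : u ≠ 0) :
    ‖u‖⁻¹ • u ∈ Metric.sphere (0 : Fin n → ℝ) 1 := by
  rw [mem_sphere_zero_iff_norm, norm_smul, norm_inv, norm_norm,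
    inv_mul_cancel₀ (norm_ne_zero_iff.2 hu)]

variable {T : ℝ} {g : (Fin n → ℝ) → ℝ → Matrix (Fin n) (Fin n) ℝ}
  (hT : 0 < T) (hg : SmoothMetricFamily g (Icc 0 T))

include hg

lemma continuousOn_bil_family :
    ContinuousOn (fun p : ((Fin n → ℝ) × ℝ) × (Fin n → ℝ) => bil (g p.1.1 p.1.2) p.2 p.2)
      ((univ ×ˢ Icc 0 T) ×ˢ univ) := by
  simp only [bil_apply]
  refine continuousOn_finsetSum _ fun i _ => continuousOn_finsetSum _ fun j _ => ?_
  refine (ContinuousOn.mul ?_ ?_).mul ?_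
  · exact (hg.1 i j).continuousOn.comp continuousOn_fst fun p hp => hp.1
  · exact ((continuous_apply i).comp continuous_snd).continuousOn
  · exact ((continuous_apply j).comp continuous_snd).continuousOn

lemma exists_metric_lower_bound {S : Set (Fin n → ℝ)} (hS : IsCompact S) :
    ∃ c > 0, ∀ x ∈ S, ∀ t ∈ Icc 0 T, ∀ u, c * ‖u‖ ^ 2 ≤ bil (g x t) u u := by
  have hc : IsCompact ((S ×ˢ Icc 0 T) ×ˢ Metric.sphere (0 : Fin n → ℝ) 1) :=
    (hS.prod isCompact_Icc).prod (isCompact_sphere _ _)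
  obtain ⟨c, hc0, h⟩ := hc.exists_forall_le' ((continuousOn_bil_family hg).mono
    (prod_mono (prod_mono (subset_univ _) le_rfl) (subset_univ _))) (a := 0) fun p hp =>
      bil_self_pos (hg.2 _ _ hp.1.2).2 (by
        rintro h0; have := hp.2; rw [h0] at this; simp at this)
  refine ⟨c, hc0, fun x hx t ht u => ?_⟩
  rcases eq_or_ne u 0 with rfl | hu
  · simp
  rw [bil_self_scale, mul_comm]
  exact mul_le_mul_of_nonneg_left (h ⟨⟨x, t⟩, _⟩ ⟨⟨hx, ht⟩, norm_normalize_mem_sphere hu⟩)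
    (sq_nonneg _)

include hT

lemma eventually_metric_le {S : Set (Fin n → ℝ)} (hS : IsCompact S) {q : ℝ} (hq : 1 < q)
    {t : ℝ} (ht : t ∈ Icc 0 T) :
    ∃ η > 0, ∀ t' ∈ Icc 0 T, |t' - t| < η → ∀ x ∈ S, ∀ u,
      bil (g x t) u u ≤ q * bil (g x t') u u := by
  set P : ℝ → ℝ := fun s => projIcc 0 T hT.le s with hP
  have hPc : Continuous P := continuous_subtype_val.comp continuous_projIcc
  have hPm : ∀ s, P s ∈ Icc 0 T := fun s => (projIcc 0 T hT.le s).2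
  have hPe : ∀ s ∈ Icc 0 T, P s = s := fun s hs => by simp [hP, projIcc_of_mem hT.le hs]
  have hc : Continuous fun p : ℝ × ((Fin n → ℝ) × (Fin n → ℝ)) =>
      q * bil (g p.2.1 (P p.1)) p.2.2 p.2.2 - bil (g p.2.1 t) p.2.2 p.2.2 := by
    refine (continuous_const.mul ?_).sub ?_
    · exact (continuousOn_bil_family hg).comp_continuous
        (f := fun p : ℝ × ((Fin n → ℝ) × (Fin n → ℝ)) => ((p.2.1, P p.1), p.2.2))
        (by fun_prop) fun p => ⟨⟨mem_univ _, hPm _⟩, mem_univ _⟩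
    · exact (continuousOn_bil_family hg).comp_continuous
        (f := fun p : ℝ × ((Fin n → ℝ) × (Fin n → ℝ)) => ((p.2.1, t), p.2.2))
        (by fun_prop) fun p => ⟨⟨mem_univ _, ht⟩, mem_univ _⟩
  have hev := (hS.prod (isCompact_sphere (0 : Fin n → ℝ) 1)).eventually_forall_of_forall_eventually
    (x₀ := t) (P := fun s y => 0 < q * bil (g y.1 (P s)) y.2 y.2 - bil (g y.1 t) y.2 y.2)
    (fun y hy => by
      refine hc.continuousAt.eventually (lt_mem_nhds ?_)
      have hpos : 0 < bil (g y.1 t) y.2 y.2 := bil_self_pos (hg.2 _ _ ht).2 (by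
        rintro h0; have := hy.2; rw [h0] at this; simp at this)
      simp only [hPe t ht]
      nlinarith)
  obtain ⟨η, hη, h⟩ := Metric.eventually_nhds_iff.1 hev
  refine ⟨η, hη, fun t' ht' htt x hx u => ?_⟩
  rcases eq_or_ne u 0 with rfl | hu
  · simp
  have := h (y := t') htt (x, ‖u‖⁻¹ • u) ⟨hx, norm_normalize_mem_sphere hu⟩
  simp only [hPe t' ht'] at this
  rw [bil_self_scale (g x t), bil_self_scale (g x t')]
  nlinarith [sq_nonneg ‖u‖]

omit hT hg in
lemma rBall_subset_of_metric_le {G G' : (Fin n → ℝ) → Matrix (Fin n) (Fin n) ℝ}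
    (hG : SmoothMetric G) (hG' : SmoothMetric G') {x₀ : Fin n → ℝ} {L q : ℝ}
    (hq : 0 < q)
    (h : ∀ x ∈ rBall G x₀ L, ∀ u, bil (G x) u u ≤ q ^ 2 * bil (G' x) u u) :
    rBall G' x₀ (L / q) ⊆ rBall G x₀ L := by
  intro x hx
  obtain ⟨γ, hγ, rfl, rfl, hlen⟩ := exists_path_of_riemDist_lt hx
  by_contra hcon
  have hcon : L ≤ riemDist G (γ 0) (γ 1) := not_lt.1 hcon
  have hv : Continuous fun s => Real.sqrt (sqSpeed G γ s) := (continuous_sqSpeed hG hγ).sqrt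
  have hv' : Continuous fun s => Real.sqrt (sqSpeed G' γ s) := (continuous_sqSpeed hG' hγ).sqrt
  have hlen' : q * pathLength G' γ < L := by rwa [lt_div_iff₀ hq, mul_comm] at hlen
  obtain ⟨c, hc1, hc2⟩ := exists_between hlen'
  have hc0 : 0 ≤ c := (mul_nonneg hq.le (pathLength_nonneg _ _)).trans hc1.le
  set l : ℝ → ℝ := fun s => ∫ r in (0 : ℝ)..s, Real.sqrt (sqSpeed G γ r) with hl
  have hlc : Continuous l := intervalIntegral.continuous_primitive
    (fun a b => hv.intervalIntegrable a b) 0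
  have hl1 : c ≤ l 1 := hc2.le.trans (hcon.trans (riemDist_le_integral hγ zero_le_one))
  obtain ⟨s, hs, hsc⟩ := intermediate_value_Icc zero_le_one hlc.continuousOn
    (show c ∈ Icc (l 0) (l 1) from ⟨by simpa [hl] using hc0, hl1⟩)
  have key : l s ≤ ∫ r in (0 : ℝ)..s, q * Real.sqrt (sqSpeed G' γ r) := by
    refine intervalIntegral.integral_mono_on hs.1 (hv.intervalIntegrable _ _)
      ((continuous_const.mul hv').intervalIntegrable _ _) fun r hr => ?_
    have hr' : l r ≤ l s := by
      refine intervalIntegral.integral_mono_interval le_rfl hr.1 hr.2 ?_ (hv.intervalIntegrable _ _)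
      exact Filter.Eventually.of_forall fun _ => Real.sqrt_nonneg _
    have hmem : γ r ∈ rBall G (γ 0) L :=
      (riemDist_le_integral hγ hr.1).trans_lt (hr'.trans_lt (hsc ▸ hc2))
    rw [← Real.sqrt_sq hq.le, ← Real.sqrt_mul (sq_nonneg q)]
    exact Real.sqrt_le_sqrt (h _ hmem _)
  have h2 : ∫ r in (0 : ℝ)..s, q * Real.sqrt (sqSpeed G' γ r) ≤ q * pathLength G' γ := by
    rw [intervalIntegral.integral_const_mul, pathLength_eq]
    refine mul_le_mul_of_nonneg_left (intervalIntegral.integral_mono_interval le_rfl hs.1 hs.2 ?_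
      (hv'.intervalIntegrable _ _)) hq.le
    exact Filter.Eventually.of_forall fun _ => Real.sqrt_nonneg _
  linarith

lemma eventually_rBall_subset {x₀ : Fin n → ℝ} {L : ℝ} {t : ℝ} (ht : t ∈ Icc 0 T)
    (hc : IsCompact (closure (rBall (fun y => g y t) x₀ L))) :
    ∃ η > 0, ∀ t' ∈ Icc 0 T, |t' - t| < η →
      rBall (fun y => g y t') x₀ (7 / 8 * L) ⊆ rBall (fun y => g y t) x₀ L := by
  obtain ⟨η, hη, h⟩ := eventually_metric_le hT hg hc (q := (8 / 7) ^ 2) (by norm_num) ht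
  refine ⟨η, hη, fun t' ht' htt => ?_⟩
  have := rBall_subset_of_metric_le (x₀ := x₀) (hg.slice ht) (hg.slice ht')
    (q := 8 / 7) (by norm_num) fun x hx u => h t' ht' htt x (subset_closure hx) u
  rwa [show L / (8 / 7) = 7 / 8 * L by ring] at this

lemma exists_compact_rBall {x₀ : Fin n → ℝ} {L : ℝ}
    (hc : ∀ t ∈ Icc 0 T, IsCompact (closure (rBall (fun y => g y t) x₀ L))) :
    ∃ S : Set (Fin n → ℝ), IsCompact S ∧
      ∀ t ∈ Icc 0 T, rBall (fun y => g y t) x₀ (7 / 8 * L) ⊆ S := by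
  have : ∃ S : Set (Fin n → ℝ), IsCompact S ∧
      ∀ t ∈ Icc 0 T, t ∈ Icc 0 T → rBall (fun y => g y t) x₀ (7 / 8 * L) ⊆ S := by
    refine (isCompact_Icc (a := (0 : ℝ)) (b := T)).induction_on
      (p := fun I => ∃ S : Set (Fin n → ℝ), IsCompact S ∧
        ∀ t ∈ I, t ∈ Icc 0 T → rBall (fun y => g y t) x₀ (7 / 8 * L) ⊆ S)
      ⟨∅, isCompact_empty, by simp⟩ ?_ ?_ ?_
    · rintro I J hIJ ⟨S, hS, h⟩
      exact ⟨S, hS, fun t ht => h t (hIJ ht)⟩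
    · rintro I J ⟨S, hS, h⟩ ⟨S', hS', h'⟩
      refine ⟨S ∪ S', hS.union hS', fun t ht hT => ?_⟩
      rcases ht with ht | ht
      · exact (h t ht hT).trans subset_union_left
      · exact (h' t ht hT).trans subset_union_right
    · intro t ht
      obtain ⟨η, hη, h⟩ := eventually_rBall_subset hT hg ht (hc t ht)
      exact ⟨Metric.ball t η, mem_nhdsWithin_of_mem_nhds (Metric.ball_mem_nhds t hη), _, hc t ht,
        fun t' htt ht' => (h t' ht' htt).trans subset_closure⟩
  obtain ⟨S, hS, h⟩ := this
  exact ⟨S, hS, fun t ht => h t ht ht⟩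

end

section

/-- A cutoff function on `(-∞, 1)`, vanishing for `σ ≤ 0` and blowing up at `1`. -/
def cutoff (σ : ℝ) : ℝ := max σ 0 ^ 4 * (1 - σ)⁻¹ ^ 2

/-- The derivative of `cutoff`. -/
def cutoffDeriv (σ : ℝ) : ℝ := 4 * max σ 0 ^ 3 * (1 - σ)⁻¹ ^ 2 + 2 * max σ 0 ^ 4 * (1 - σ)⁻¹ ^ 3

/-- The second derivative of `cutoff`. -/
def cutoffDerivTwo (σ : ℝ) : ℝ :=
  12 * max σ 0 ^ 2 * (1 - σ)⁻¹ ^ 2 + 16 * max σ 0 ^ 3 * (1 - σ)⁻¹ ^ 3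
    + 6 * max σ 0 ^ 4 * (1 - σ)⁻¹ ^ 4

lemma hasDerivAt_max_zero_pow (k : ℕ) (σ : ℝ) :
    HasDerivAt (fun s : ℝ => max s 0 ^ (k + 2)) ((k + 2) * max σ 0 ^ (k + 1)) σ := by
  rcases lt_trichotomy σ 0 with h | rfl | h
  · rw [max_eq_right h.le, zero_pow (by omega), mul_zero]
    refine (hasDerivAt_const σ (0 : ℝ)).congr_of_eventuallyEq ?_
    filter_upwards [gt_mem_nhds h] with s hs
    rw [max_eq_right hs.le, zero_pow (by omega)]
  · rw [max_self, zero_pow (by omega), mul_zero, hasDerivAt_iff_isLittleO]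
    simp only [max_self, zero_pow (show k + 2 ≠ 0 by omega), sub_zero, smul_zero]
    have : (fun s : ℝ => max s 0 ^ (k + 2)) =O[nhds 0] fun s : ℝ => s ^ (k + 2) :=
      Asymptotics.IsBigO.of_bound 1 (Filter.Eventually.of_forall fun s => by
        rw [norm_pow, norm_pow, one_mul]
        refine pow_le_pow_left₀ (norm_nonneg _) ?_ _
        rw [Real.norm_eq_abs, Real.norm_eq_abs, abs_of_nonneg (le_max_right s 0)]
        exact max_le (le_abs_self s) (abs_nonneg s))
    refine this.trans_isLittleO ?_
    simpa using Asymptotics.isLittleO_pow_pow (𝕜 := ℝ) (show 1 < k + 2 by omega)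
  · have h1 := hasDerivAt_pow (k + 2) σ
    rw [max_eq_left h.le]
    refine HasDerivAt.congr_of_eventuallyEq (by simpa using h1) ?_
    filter_upwards [lt_mem_nhds h] with s hs
    rw [max_eq_left hs.le]

lemma hasDerivAt_inv_one_sub_pow (k : ℕ) {σ : ℝ} (hσ : σ < 1) :
    HasDerivAt (fun s : ℝ => (1 - s)⁻¹ ^ (k + 1)) ((k + 1) * (1 - σ)⁻¹ ^ (k + 2)) σ := by
  have h0 : (1 - σ) ≠ 0 := by linarith
  have h1 : HasDerivAt (fun s : ℝ => (1 - s)⁻¹) ((1 - σ)⁻¹ ^ 2) σ := by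
    have := ((hasDerivAt_id σ).const_sub 1).inv h0
    refine this.congr_deriv ?_
    simp
  refine (h1.pow (k + 1)).congr_deriv ?_
  push_cast
  ring

lemma hasDerivAt_cutoff {σ : ℝ} (hσ : σ < 1) : HasDerivAt cutoff (cutoffDeriv σ) σ := by
  refine ((hasDerivAt_max_zero_pow 2 σ).mul (hasDerivAt_inv_one_sub_pow 1 hσ)).congr_deriv ?_
  simp only [cutoffDeriv]
  push_cast
  ring

lemma hasDerivAt_cutoffDeriv {σ : ℝ} (hσ : σ < 1) :
    HasDerivAt cutoffDeriv (cutoffDerivTwo σ) σ := by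
  refine ((((hasDerivAt_max_zero_pow 1 σ).const_mul 4).mul (hasDerivAt_inv_one_sub_pow 1 hσ)).add
    (((hasDerivAt_max_zero_pow 2 σ).const_mul 2).mul
      (hasDerivAt_inv_one_sub_pow 2 hσ))).congr_deriv ?_
  simp only [cutoffDerivTwo]
  push_cast
  ring

lemma hasDerivAt_cutoffDerivTwo {σ : ℝ} (hσ : σ < 1) :
    HasDerivAt cutoffDerivTwo (24 * max σ 0 * (1 - σ)⁻¹ ^ 2 + 72 * max σ 0 ^ 2 * (1 - σ)⁻¹ ^ 3
      + 72 * max σ 0 ^ 3 * (1 - σ)⁻¹ ^ 4 + 24 * max σ 0 ^ 4 * (1 - σ)⁻¹ ^ 5) σ := by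
  refine (((((hasDerivAt_max_zero_pow 0 σ).const_mul 12).mul
    (hasDerivAt_inv_one_sub_pow 1 hσ)).add
    (((hasDerivAt_max_zero_pow 1 σ).const_mul 16).mul (hasDerivAt_inv_one_sub_pow 2 hσ))).add
    (((hasDerivAt_max_zero_pow 2 σ).const_mul 6).mul
      (hasDerivAt_inv_one_sub_pow 3 hσ))).congr_deriv ?_
  push_cast
  ring

lemma cutoff_nonneg (σ : ℝ) : 0 ≤ cutoff σ :=
  mul_nonneg (pow_nonneg (le_max_right _ _) _) (sq_nonneg _)

lemma cutoff_of_nonpos {σ : ℝ} (h : σ ≤ 0) : cutoff σ = 0 := by simp [cutoff, max_eq_right h]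

lemma cutoffDeriv_nonneg {σ : ℝ} (hσ : σ < 1) : 0 ≤ cutoffDeriv σ := by
  have h : 0 ≤ (1 - σ)⁻¹ := inv_nonneg.2 (by linarith)
  have := le_max_right σ 0
  unfold cutoffDeriv; positivity

lemma cutoffDerivTwo_nonneg {σ : ℝ} (hσ : σ < 1) : 0 ≤ cutoffDerivTwo σ := by
  have h : 0 ≤ (1 - σ)⁻¹ := inv_nonneg.2 (by linarith)
  have := le_max_right σ 0
  unfold cutoffDerivTwo; positivity

lemma cutoff_mono : MonotoneOn cutoff (Iio 1) := by
  intro s _ t ht hst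
  have ht : t < 1 := ht
  have h1 : (1 - s)⁻¹ ≤ (1 - t)⁻¹ := inv_anti₀ (by linarith) (by linarith)
  have h0 : 0 ≤ (1 - s)⁻¹ := inv_nonneg.2 (by linarith)
  exact mul_le_mul (pow_le_pow_left₀ (le_max_right _ _) (max_le_max_right _ hst) _)
    (pow_le_pow_left₀ h0 h1 _) (sq_nonneg _) (pow_nonneg (le_max_right _ _) _)

lemma cutoffDeriv_le {σ : ℝ} (hσ : σ < 1) :
    cutoffDeriv σ ≤ 8704 * (1 + cutoff σ ^ 2) ∧ cutoffDerivTwo σ ≤ 8704 * (1 + cutoff σ ^ 2) := by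
  set u := max σ 0 with hu
  set z := (1 - σ)⁻¹ with hz
  have hu0 : 0 ≤ u := le_max_right _ _
  have hz0 : 0 < z := inv_pos.2 (by linarith)
  have hθ := sq_nonneg (cutoff σ)
  rcases le_total σ (1 / 2) with h | h
  · have hu1 : u ≤ 1 / 2 := max_le h (by norm_num)
    have hz1 : z ≤ 2 := by
      rw [hz, inv_le_comm₀ (by linarith) (by norm_num)]; linarith
    have m : ∀ i j, u ^ i * z ^ j ≤ (1 / 2) ^ i * 2 ^ j := fun i j =>
      mul_le_mul (pow_le_pow_left₀ hu0 hu1 i) (pow_le_pow_left₀ hz0.le hz1 j) (by positivity)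
        (by positivity)
    have m1 := m 3 2; have m2 := m 4 3; have m3 := m 2 2; have m4 := m 3 3; have m5 := m 4 4
    norm_num at m1 m2 m3 m4 m5
    simp only [cutoffDeriv, cutoffDerivTwo, ← hu, ← hz]
    constructor <;> nlinarith
  · have huσ : u = σ := max_eq_left (by linarith)
    have hz2 : 2 ≤ z := by
      rw [hz, le_inv_comm₀ (by norm_num) (by linarith)]; linarith
    have hu1 : u ≤ 1 := by linarith
    have hul : 1 / 2 ≤ u := by linarith
    have m : ∀ i j, u ^ i * z ^ j ≤ z ^ j := fun i j =>
      mul_le_of_le_one_left (by positivity) (pow_le_one₀ hu0 hu1)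
    have m1 := m 3 2; have m2 := m 4 3; have m3 := m 2 2; have m4 := m 3 3; have m5 := m 4 4
    have hz24 : z ^ 2 ≤ z ^ 4 := pow_le_pow_right₀ (by linarith) (by norm_num)
    have hz34 : z ^ 3 ≤ z ^ 4 := pow_le_pow_right₀ (by linarith) (by norm_num)
    have hc : z ^ 4 ≤ 256 * cutoff σ ^ 2 := by
      have h1 : z ^ 2 / 16 ≤ cutoff σ := by
        have : (1 / 2 : ℝ) ^ 4 ≤ u ^ 4 := pow_le_pow_left₀ (by norm_num) hul 4
        simp only [cutoff, ← hu, ← hz]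
        nlinarith [sq_nonneg z]
      have := pow_le_pow_left₀ (by positivity) h1 2
      nlinarith
    simp only [cutoffDeriv, cutoffDerivTwo, ← hu, ← hz]
    constructor <;> nlinarith

lemma exists_cutoff_taylor {η : ℝ} (hη : 0 < η) :
    ∃ C, 0 ≤ C ∧ ∀ σ ≤ 1 - η, cutoff σ ≤ C ∧ cutoffDeriv σ ≤ C ∧ cutoffDerivTwo σ ≤ C ∧
      ∀ h, |h| ≤ η / 2 → |cutoff (σ + h) - cutoff σ - h * cutoffDeriv σ
        - h ^ 2 / 2 * cutoffDerivTwo σ| ≤ C * |h| ^ 3 := by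
  set Z := 2 / η with hZ
  have hZ0 : 0 < Z := by positivity
  have bd : ∀ y ≤ 1 - η / 2, ∀ i j, max y 0 ^ i * (1 - y)⁻¹ ^ j ≤ Z ^ j := fun y hy i j => by
    have h1 : (1 - y)⁻¹ ≤ Z := by
      rw [hZ, inv_le_comm₀ (by linarith) (by positivity), inv_div]; linarith
    have h0 : 0 ≤ (1 - y)⁻¹ := inv_nonneg.2 (by linarith)
    have hm : max y 0 ≤ 1 := max_le (by linarith) zero_le_one
    calc max y 0 ^ i * (1 - y)⁻¹ ^ j ≤ 1 * Z ^ j :=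
          mul_le_mul (pow_le_one₀ (le_max_right _ _) hm) (pow_le_pow_left₀ h0 h1 _)
            (pow_nonneg h0 _) zero_le_one
      _ = Z ^ j := one_mul _
  refine ⟨24 * Z ^ 2 + 72 * Z ^ 3 + 72 * Z ^ 4 + 24 * Z ^ 5, by positivity, fun σ hσ => ?_⟩
  have p2 : 0 < Z ^ 2 := by positivity
  have p3 : 0 < Z ^ 3 := by positivity
  have p4 : 0 < Z ^ 4 := by positivity
  have p5 : 0 < Z ^ 5 := by positivity
  have b := bd σ (by linarith)
  refine ⟨?_, ?_, ?_, fun h hh => ?_⟩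
  · have := b 4 2
    simp only [cutoff]; linarith
  · have h1 := b 3 2; have h2 := b 4 3
    simp only [cutoffDeriv]; linarith
  · have h1 := b 2 2; have h2 := b 3 3; have h3 := b 4 4
    simp only [cutoffDerivTwo]; linarith
  · have hlt : ∀ y, |y - σ| ≤ |h| → y ≤ 1 - η / 2 := fun y hy => by
      have := (abs_le.1 (hy.trans hh)).2; linarith
    refine taylor_two (fun y hy => hasDerivAt_cutoff (by linarith [hlt y hy]))
      (fun y hy => hasDerivAt_cutoffDeriv (by linarith [hlt y hy]))
      (fun y hy => hasDerivAt_cutoffDerivTwo (by linarith [hlt y hy])) fun y hy => ?_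
    have b' := bd y (hlt y hy)
    have h0 : 0 ≤ (1 - y)⁻¹ := inv_nonneg.2 (by linarith [hlt y hy])
    have hm0 := le_max_right y 0
    rw [abs_of_nonneg (by positivity)]
    have h1 := b' 1 2; have h2 := b' 2 3; have h3 := b' 3 4; have h4 := b' 4 5
    rw [pow_one] at h1
    linarith

lemma exists_cutoff_comp_taylor {η C : ℝ} (hη : 0 < η) (hC : 0 ≤ C) :
    ∃ C' a₀, 0 < a₀ ∧ a₀ ≤ 1 ∧ ∀ σ ≤ 1 - η, ∀ s a y₁ y₂ : ℝ, |y₁| ≤ C → |y₂| ≤ C → |a| ≤ a₀ →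
      |s - σ - a * y₁ - a ^ 2 / 2 * y₂| ≤ C * |a| ^ 3 → s < 1 ∧
      cutoff s ≤ cutoff σ + cutoffDeriv σ * (a * y₁ + a ^ 2 / 2 * y₂)
        + cutoffDerivTwo σ * (a ^ 2 / 2 * y₁ ^ 2) + C' * |a| ^ 3 := by
  obtain ⟨D, hD, hcut⟩ := exists_cutoff_taylor hη
  refine ⟨D * C + D * (4 * C ^ 2) + D * (3 * C) ^ 3, min 1 (η / (6 * C + 1)), by positivity,
    min_le_left _ _, fun σ hσ s a y₁ y₂ h₁ h₂ ha hs => ?_⟩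
  obtain ⟨-, hd1, hd2, ht⟩ := hcut σ hσ
  have ha1 : |a| ≤ 1 := ha.trans (min_le_left _ _)
  have ha2 : |a| * (6 * C + 1) ≤ η := by
    rw [← le_div_iff₀ (by positivity)]; exact ha.trans (min_le_right _ _)
  have a0 := abs_nonneg a
  have asq : a ^ 2 = |a| ^ 2 := (sq_abs a).symm
  have a2 : |a| ^ 2 ≤ |a| := by nlinarith
  have a3 : |a| ^ 3 ≤ |a| ^ 2 := by nlinarith [sq_nonneg |a|]
  have n0 := cutoffDeriv_nonneg (σ := σ) (by linarith)
  have n1 := cutoffDerivTwo_nonneg (σ := σ) (by linarith)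
  set h := s - σ with hh
  have e1 : |a * y₁| ≤ |a| * C := by rw [abs_mul]; exact mul_le_mul_of_nonneg_left h₁ a0
  have e2 : |a ^ 2 / 2 * y₂| ≤ |a| ^ 2 / 2 * C := by
    rw [abs_mul, abs_of_nonneg (by positivity : 0 ≤ a ^ 2 / 2), asq]
    exact mul_le_mul_of_nonneg_left h₂ (by positivity)
  have e3 : |h - a * y₁| ≤ 2 * C * |a| ^ 2 := by
    have := abs_add_le (h - a * y₁ - a ^ 2 / 2 * y₂) (a ^ 2 / 2 * y₂)
    rw [sub_add_cancel] at this
    linarith [mul_le_mul_of_nonneg_left a3 hC, mul_nonneg hC (sq_nonneg |a|)]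
  have e4 : |h| ≤ 3 * C * |a| := by
    have := abs_add_le (h - a * y₁) (a * y₁)
    rw [sub_add_cancel] at this
    linarith [mul_le_mul_of_nonneg_left a2 hC]
  have e5 : |h| ≤ η / 2 := by linarith
  have e6 : h ^ 2 ≤ (a * y₁) ^ 2 + 8 * C ^ 2 * |a| ^ 3 := by
    have q1 : |(h - a * y₁) * (h + a * y₁)| ≤ 2 * C * |a| ^ 2 * (4 * C * |a|) := by
      rw [abs_mul]
      refine mul_le_mul e3 ?_ (abs_nonneg _) (by positivity)
      have := abs_add_le h (a * y₁)
      linarith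
    have := le_abs_self ((h - a * y₁) * (h + a * y₁))
    linarith
  have e7 : |h| ^ 3 ≤ (3 * C) ^ 3 * |a| ^ 3 := by
    rw [← mul_pow]; exact pow_le_pow_left₀ (abs_nonneg _) e4 3
  have e8 := (abs_le.1 (ht h e5)).2
  have e9 := (abs_le.1 hs).2
  rw [show σ + h = s by rw [hh]; ring] at e8
  refine ⟨by have := (abs_le.1 e5).2; linarith, ?_⟩
  have f1 : h * cutoffDeriv σ ≤ cutoffDeriv σ * (a * y₁ + a ^ 2 / 2 * y₂) + D * C * |a| ^ 3 := by
    have g1 : h ≤ (a * y₁ + a ^ 2 / 2 * y₂) + C * |a| ^ 3 := by linarith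
    have g2 := mul_le_mul_of_nonneg_right g1 n0
    have g3 := mul_le_mul_of_nonneg_right hd1 (by positivity : 0 ≤ C * |a| ^ 3)
    linarith
  have f2 : h ^ 2 / 2 * cutoffDerivTwo σ
      ≤ cutoffDerivTwo σ * (a ^ 2 / 2 * y₁ ^ 2) + D * (4 * C ^ 2) * |a| ^ 3 := by
    have g2 := mul_le_mul_of_nonneg_right e6 n1
    have g3 := mul_le_mul_of_nonneg_right hd2 (by positivity : 0 ≤ 4 * C ^ 2 * |a| ^ 3)
    linarith
  have f3 := mul_le_mul_of_nonneg_left e7 hD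
  linarith

lemma exists_cutoff_le {η : ℝ} (hη : 0 < η) :
    ∃ C, 0 ≤ C ∧ ∀ σ ≤ 1 - η, ∀ h, |h| ≤ η / 2 →
      cutoff (σ + h) ≤ cutoff σ + cutoffDeriv σ * h + C * h ^ 2 := by
  obtain ⟨D, hD, hcut⟩ := exists_cutoff_taylor hη
  refine ⟨D / 2 + D * (η / 2), by positivity, fun σ hσ h hh => ?_⟩
  obtain ⟨-, -, hd2, ht⟩ := hcut σ hσ
  have h1 := (abs_le.1 (ht h hh)).2
  have h2 : |h| ^ 3 ≤ (η / 2) * h ^ 2 := by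
    rw [← sq_abs h]; nlinarith [sq_nonneg |h|]
  nlinarith [mul_le_mul_of_nonneg_left h2 hD, mul_le_mul_of_nonneg_right hd2 (sq_nonneg h)]

end

section

variable {n : ℕ} {T : ℝ} {g : (Fin n → ℝ) → ℝ → Matrix (Fin n) (Fin n) ℝ}
  (hT : 0 < T) (hg : SmoothMetricFamily g (Icc 0 T))

include hT hg

lemma continuousOn_chr_family {X : Type*} [TopologicalSpace X] {W : Set X}
    {x u w : X → Fin n → ℝ} {τ : X → ℝ} (hx : ContinuousOn x W) (hu : ContinuousOn u W)
    (hw : ContinuousOn w W) (hτ : ContinuousOn τ W) (hm : MapsTo τ W (Icc 0 T)) :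
    ContinuousOn (fun p => chr (fun y => g y (τ p)) (x p) (u p) (w p)) W := by
  refine continuousOn_pi.2 fun k => ?_
  simp only [chr, vbil_apply]
  refine continuousOn_finsetSum _ fun i _ => continuousOn_finsetSum _ fun j _ => ?_
  refine (ContinuousOn.mul ?_ ?_).mul ?_
  · have h := (contDiffOn_christoffel hT hg k i j).continuousOn
    have h' : ContinuousOn (fun p => (x p, τ p)) W := hx.prodMk hτ
    have h'' : MapsTo (fun p => (x p, τ p)) W (univ ×ˢ Icc 0 T) := fun p hp => ⟨trivial, hm hp⟩
    have := h.comp h' h''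
    simpa only [Function.comp_def] using this
  · exact (continuous_apply i).comp_continuousOn hu
  · exact (continuous_apply j).comp_continuousOn hw

lemma continuousOn_dchr_family {X : Type*} [TopologicalSpace X] {W : Set X}
    {x z u w : X → Fin n → ℝ} {τ : X → ℝ} (hx : ContinuousOn x W) (hz : ContinuousOn z W)
    (hu : ContinuousOn u W) (hw : ContinuousOn w W) (hτ : ContinuousOn τ W)
    (hm : MapsTo τ W (Icc 0 T)) :
    ContinuousOn (fun p => dchr (fun y => g y (τ p)) (x p) (z p) (u p) (w p)) W := by
  refine continuousOn_pi.2 fun k => ?_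
  simp only [dchr, vbil_apply, fderiv_eq_sum_pd]
  refine continuousOn_finsetSum _ fun i _ => continuousOn_finsetSum _ fun j _ => ?_
  refine (ContinuousOn.mul ?_ ?_).mul ?_
  · refine continuousOn_finsetSum _ fun m _ => ?_
    refine ((continuous_apply m).comp_continuousOn hz).mul ?_
    have h := (contDiffOn_pd hT (f := fun x t => christoffel (fun y => g y t) x k i j)
      (contDiffOn_christoffel hT hg k i j) m).continuousOn
    have h' : ContinuousOn (fun p => (x p, τ p)) W := hx.prodMk hτ
    have h'' : MapsTo (fun p => (x p, τ p)) W (univ ×ˢ Icc 0 T) := fun p hp => ⟨trivial, hm hp⟩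
    have := h.comp h' h''
    simpa only [Function.comp_def] using this
  · exact (continuous_apply i).comp_continuousOn hu
  · exact (continuous_apply j).comp_continuousOn hw

omit hT in
lemma contDiffOn_edens_family : ContDiffOn ℝ (⊤ : ℕ∞)
    (fun p : (((Fin n → ℝ) × (Fin n → ℝ) × (Fin n → ℝ) × (Fin n → ℝ) × (Fin n → ℝ)
        × (Fin n → ℝ)) × ℝ) × ℝ =>
      edens (fun y => g y p.2) p.1.1.1 p.1.1.2.1 p.1.1.2.2.1 p.1.1.2.2.2.1 p.1.1.2.2.2.2.1
        p.1.1.2.2.2.2.2 p.1.2) (univ ×ˢ Icc 0 T) := by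
  simp only [edens, bil_apply]
  refine ContDiffOn.sum fun i _ => ContDiffOn.sum fun j _ => ?_
  have h : ∀ k : Fin n, ContDiff ℝ (⊤ : ℕ∞) (fun p : (((Fin n → ℝ) × (Fin n → ℝ) × (Fin n → ℝ)
      × (Fin n → ℝ) × (Fin n → ℝ) × (Fin n → ℝ)) × ℝ) × ℝ =>
      (p.1.1.2.2.2.1 + p.1.2 • p.1.1.2.2.2.2.1 + (p.1.2 ^ 2 / 2) • p.1.1.2.2.2.2.2) k) :=
    fun k => (contDiff_apply ℝ ℝ k).comp (by fun_prop)
  refine (ContDiffOn.mul ?_ (h i).contDiffOn).mul (h j).contDiffOn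
  exact (hg.1 i j).comp (f := fun p : (((Fin n → ℝ) × (Fin n → ℝ) × (Fin n → ℝ)
      × (Fin n → ℝ) × (Fin n → ℝ) × (Fin n → ℝ)) × ℝ) × ℝ =>
      (p.1.1.1 + p.1.2 • p.1.1.2.1 + (p.1.2 ^ 2 / 2) • p.1.1.2.2.1, p.2))
    (ContDiff.contDiffOn (by fun_prop)) fun p hp => ⟨mem_univ _, hp.2⟩

omit hT hg in
lemma continuous_deriv_deriv_slice {Y : Type*} [NormedAddCommGroup Y] [NormedSpace ℝ Y]
    {f : Y × ℝ → ℝ} (hf : ContDiff ℝ (⊤ : ℕ∞) f) :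
    Continuous fun d => deriv (deriv fun a => f (d, a)) 0 := by
  have key : ∀ {h : Y × ℝ → ℝ}, ContDiff ℝ (⊤ : ℕ∞) h → ∀ d,
      deriv (fun a => h (d, a)) = fun a => fderiv ℝ h (d, a) (0, 1) := fun {h} hh d => by
    funext a
    have h1 : HasDerivAt (fun a : ℝ => ((d, a) : Y × ℝ)) (0, 1) a :=
      (hasDerivAt_const a d).prodMk (hasDerivAt_id a)
    exact (((hh.differentiable (by simp)) (d, a)).hasFDerivAt.comp_hasDerivAt a h1).deriv
  have h1 : ContDiff ℝ (⊤ : ℕ∞) fun y => fderiv ℝ f y (0, 1) := contDiff_fderiv_apply_const hf _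
  have h2 : ContDiff ℝ (⊤ : ℕ∞) fun y => fderiv ℝ (fun y => fderiv ℝ f y (0, 1)) y (0, 1) :=
    contDiff_fderiv_apply_const h1 _
  simp only [key hf, key h1]
  exact h2.continuous.comp (continuous_id.prodMk continuous_const)

omit hT hg in
lemma IsFrame.norm_le {G : Matrix (Fin n) (Fin n) ℝ} {E : Fin n → Fin n → ℝ} (h : IsFrame G E)
    (hs : G.IsSymm) (hG : G.PosDef) {κ ρ : ℝ} (hκ : 0 < κ) (hρ : 0 ≤ ρ) (hn : n ≤ κ * ρ ^ 2)
    (hl : ∀ u, κ * ‖u‖ ^ 2 ≤ bil G u u) (c : Fin n) : ‖E c‖ ≤ ρ := by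
  have h1 : bil G (E c) (E c) ≤ n := by
    rw [← h.sum_bil_self hs hG]
    exact Finset.single_le_sum (f := fun c => bil G (E c) (E c))
      (fun c _ => bil_self_nonneg hG.posSemidef _) (Finset.mem_univ c)
  have h2 := hl (E c)
  exact le_of_sq_le_sq (le_of_mul_le_mul_left (h2.trans (h1.trans hn)) hκ) hρ

end

section

variable {n : ℕ}

/-- The data at a point of a variation of a curve in direction `φ • e`: base point, first and
second order variation of the point, velocity, first and second order variation of the velocity. -/
def variationData (G : (Fin n → ℝ) → Matrix (Fin n) (Fin n) ℝ) (x v e : Fin n → ℝ) (φ φ' : ℝ) :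
    (Fin n → ℝ) × (Fin n → ℝ) × (Fin n → ℝ) × (Fin n → ℝ) × (Fin n → ℝ) × (Fin n → ℝ) :=
  (x, φ • e, - chr G x (φ • e) (φ • e), v, φ' • e - chr G x v (φ • e),
    - dchr G x v (φ • e) (φ • e) - (2 * φ') • chr G x e (φ • e)
        + (2 : ℝ) • chr G x (chr G x v (φ • e)) (φ • e))

/-- The energy density of a variation. -/
def variationDensity (G : (Fin n → ℝ) → Matrix (Fin n) (Fin n) ℝ) (x v e : Fin n → ℝ)
    (φ φ' a : ℝ) : ℝ :=
  edens G x (φ • e) (- chr G x (φ • e) (φ • e)) v (φ' • e - chr G x v (φ • e))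
    (- dchr G x v (φ • e) (φ • e) - (2 * φ') • chr G x e (φ • e)
        + (2 : ℝ) • chr G x (chr G x v (φ • e)) (φ • e)) a

variable {T : ℝ} {g : (Fin n → ℝ) → ℝ → Matrix (Fin n) (Fin n) ℝ}
  (hT : 0 < T) (hg : SmoothMetricFamily g (Icc 0 T))

include hT hg in
lemma continuousOn_variationData : ContinuousOn
    (fun p : ((Fin n → ℝ) × (Fin n → ℝ) × (Fin n → ℝ) × ℝ × ℝ) × ℝ =>
      variationData (fun y => g y p.2) p.1.1 p.1.2.1 p.1.2.2.1 p.1.2.2.2.1 p.1.2.2.2.2)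
    (univ ×ˢ Icc 0 T) := by
  have hx : ContinuousOn (fun p : ((Fin n → ℝ) × (Fin n → ℝ) × (Fin n → ℝ) × ℝ × ℝ) × ℝ => p.1.1)
      (univ ×ˢ Icc 0 T) := by fun_prop
  have hv : ContinuousOn (fun p : ((Fin n → ℝ) × (Fin n → ℝ) × (Fin n → ℝ) × ℝ × ℝ) × ℝ => p.1.2.1)
      (univ ×ˢ Icc 0 T) := by fun_prop
  have he : ContinuousOn (fun p : ((Fin n → ℝ) × (Fin n → ℝ) × (Fin n → ℝ) × ℝ × ℝ) × ℝ => p.1.2.2.1)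
      (univ ×ˢ Icc 0 T) := by fun_prop
  have hφ : ContinuousOn (fun p : ((Fin n → ℝ) × (Fin n → ℝ) × (Fin n → ℝ) × ℝ × ℝ) × ℝ => p.1.2.2.2.1)
      (univ ×ˢ Icc 0 T) := by fun_prop
  have hφ' : ContinuousOn (fun p : ((Fin n → ℝ) × (Fin n → ℝ) × (Fin n → ℝ) × ℝ × ℝ) × ℝ => p.1.2.2.2.2)
      (univ ×ˢ Icc 0 T) := by fun_prop
  have hτ : ContinuousOn (fun p : ((Fin n → ℝ) × (Fin n → ℝ) × (Fin n → ℝ) × ℝ × ℝ) × ℝ => p.2)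
      (univ ×ˢ Icc 0 T) := by fun_prop
  have hm : MapsTo (fun p : ((Fin n → ℝ) × (Fin n → ℝ) × (Fin n → ℝ) × ℝ × ℝ) × ℝ => p.2)
      (univ ×ˢ Icc 0 T) (Icc 0 T) := fun p hp => hp.2
  have hφe := hφ.smul he
  have c1 := continuousOn_chr_family hT hg hx hφe hφe hτ hm
  have c2 := continuousOn_chr_family hT hg hx hv hφe hτ hm
  have c3 := continuousOn_chr_family hT hg hx he hφe hτ hm
  have c4 := continuousOn_chr_family hT hg hx c2 hφe hτ hm
  have c5 := continuousOn_dchr_family hT hg hx hv hφe hφe hτ hm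
  exact hx.prodMk (hφe.prodMk (c1.neg.prodMk (hv.prodMk (((hφ'.smul he).sub c2).prodMk
    ((c5.neg.sub ((continuousOn_const.mul hφ').smul c3)).add (c4.const_smul (2 : ℝ)))))))

include hT hg in
lemma exists_energy_variation {S : Set (Fin n → ℝ)} (hS : IsCompact S) (ρ F : ℝ) :
    ∃ C, ∀ t ∈ Icc 0 T, ∀ γ : ℝ → Fin n → ℝ, ContDiff ℝ 1 γ →
      (∀ s ∈ Icc (0 : ℝ) 1, γ s ∈ S ∧ ‖deriv γ s‖ ≤ ρ) →
      ∀ e : ℝ → Fin n → ℝ, ContDiff ℝ 1 e → (∀ s ∈ Icc (0 : ℝ) 1,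
        HasDerivAt e (- chr (fun y => g y t) (γ s) (deriv γ s) (e s)) s ∧ ‖e s‖ ≤ ρ) →
      ∀ φ φ' : ℝ → ℝ, (∀ s, HasDerivAt φ (φ' s) s) → Continuous φ' →
      (∀ s ∈ Icc (0 : ℝ) 1, φ s ∈ Icc 0 1 ∧ φ' s ∈ Icc 0 F) → φ 0 = 0 → φ 1 = 1 →
      Continuous (fun s => deriv (deriv (variationDensity (fun y => g y t) (γ s) (deriv γ s) (e s)
          (φ s) (φ' s))) 0) ∧
      |∫ s in (0 : ℝ)..1, deriv (deriv (variationDensity (fun y => g y t) (γ s) (deriv γ s) (e s)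
          (φ s) (φ' s))) 0| ≤ C ∧
      ∀ a, ∃ η : ℝ → Fin n → ℝ, ContDiff ℝ 1 η ∧ η 0 = γ 0 ∧
        η 1 = γ 1 + a • e 1 + (a ^ 2 / 2) • (- chr (fun y => g y t) (γ 1) (e 1) (e 1)) ∧
        (|a| ≤ 1 → |energy (fun y => g y t) η - energy (fun y => g y t) γ
          - a * (∫ s in (0 : ℝ)..1, 2 * φ' s * bil (g (γ s) t) (e s) (deriv γ s))
          - a ^ 2 / 2 * (∫ s in (0 : ℝ)..1, deriv (deriv (variationDensity (fun y => g y t) (γ s)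
            (deriv γ s) (e s) (φ s) (φ' s))) 0)| ≤ C * |a| ^ 3) := by
  have hQ : IsCompact ((S ×ˢ Metric.closedBall (0 : Fin n → ℝ) ρ ×ˢ
      Metric.closedBall (0 : Fin n → ℝ) ρ ×ˢ Icc (0 : ℝ) 1 ×ˢ Icc 0 F) ×ˢ Icc 0 T) :=
    (hS.prod ((isCompact_closedBall _ _).prod ((isCompact_closedBall _ _).prod
      (isCompact_Icc.prod isCompact_Icc)))).prod isCompact_Icc
  have hΨ := continuousOn_variationData hT hg
  have hD := hQ.image_of_continuousOn (hΨ.mono (prod_mono (subset_univ _) le_rfl))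
  obtain ⟨C, hC⟩ := exists_uniform_taylor hT (contDiffOn_edens_family hg) hD
  refine ⟨C, fun t ht γ hγ hγS e he hed φ φ' hφ hφ'c hφb hφ0 hφ1 => ?_⟩
  set G : (Fin n → ℝ) → Matrix (Fin n) (Fin n) ℝ := fun y => g y t with hGdef
  have hG : SmoothMetric G := hg.slice ht
  have hγ' : Continuous (deriv γ) := hγ.continuous_deriv le_rfl
  have hφC : ContDiff ℝ 1 φ := contDiff_one_iff_deriv.2
    ⟨fun s => (hφ s).differentiableAt, by rwa [funext fun s => (hφ s).deriv]⟩
  have hest : ∀ s ∈ Icc (0 : ℝ) 1,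
      |deriv (deriv (variationDensity G (γ s) (deriv γ s) (e s) (φ s) (φ' s))) 0| ≤ C ∧
      ∀ a, |a| ≤ 1 → |variationDensity G (γ s) (deriv γ s) (e s) (φ s) (φ' s) a
        - sqSpeed G γ s - a * (2 * φ' s * bil (G (γ s)) (e s) (deriv γ s))
        - a ^ 2 / 2 * deriv (deriv (variationDensity G (γ s) (deriv γ s) (e s) (φ s) (φ' s))) 0|
        ≤ C * |a| ^ 3 := by
    intro s hs
    obtain ⟨-, h2, h3⟩ := hC (variationData G (γ s) (deriv γ s) (e s) (φ s) (φ' s))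
      ⟨((γ s, deriv γ s, e s, φ s, φ' s), t), ⟨⟨(hγS s hs).1,
        mem_closedBall_zero_iff.2 (hγS s hs).2, mem_closedBall_zero_iff.2 (hed s hs).2,
        (hφb s hs).1, (hφb s hs).2⟩, ht⟩, rfl⟩ t ht
    refine ⟨h2, fun a ha => ?_⟩
    have h4 := h3 a ha
    have h5 := deriv_edens_parallel hG (γ s) (deriv γ s) (e s) (- chr G (γ s) (φ s • e s) (φ s • e s))
      (- dchr G (γ s) (deriv γ s) (φ s • e s) (φ s • e s) - (2 * φ' s) • chr G (γ s) (e s) (φ s • e s)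
        + (2 : ℝ) • chr G (γ s) (chr G (γ s) (deriv γ s) (φ s • e s)) (φ s • e s)) (φ s) (φ' s)
    have h6 : variationDensity G (γ s) (deriv γ s) (e s) (φ s) (φ' s) 0 = sqSpeed G γ s := by
      simp [variationDensity, edens, sqSpeed]
    rw [← h6, ← h5]
    exact h4
  have hdd : Continuous fun s =>
      deriv (deriv (variationDensity G (γ s) (deriv γ s) (e s) (φ s) (φ' s))) 0 := by
    have h1 := continuous_deriv_deriv_slice ((contDiffOn_edens_family hg).slice ht)
    exact h1.comp (f := fun s => variationData G (γ s) (deriv γ s) (e s) (φ s) (φ' s))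
      (hΨ.comp_continuous (f := fun s => ((γ s, deriv γ s, e s, φ s, φ' s), t))
        ((hγ.continuous.prodMk (hγ'.prodMk (he.continuous.prodMk
          (hφC.continuous.prodMk hφ'c)))).prodMk continuous_const) fun s => ⟨trivial, ht⟩)
  refine ⟨hdd, ?_, fun a => ?_⟩
  · have := intervalIntegral.norm_integral_le_of_norm_le_const (a := (0 : ℝ)) (b := 1) (C := C)
      (f := fun s => deriv (deriv (variationDensity G (γ s) (deriv γ s) (e s) (φ s) (φ' s))) 0)
      fun s hs => (hest s (Ioc_subset_Icc_self (by rwa [uIoc_of_le zero_le_one] at hs))).1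
    simpa using this
  have hV : ContDiff ℝ 1 fun s => φ s • e s := hφC.smul he
  have hq : ContDiff ℝ 1 fun s => chr G (γ s) (φ s • e s) (φ s • e s) := by
    refine contDiff_pi.2 fun k => ?_
    simp only [chr, vbil_apply]
    exact ContDiff.sum fun i _ => ContDiff.sum fun j _ =>
      ((hG.contDiff_christoffel_comp (by simp) hγ k i j).mul (contDiff_pi.1 hV i)).mul
        (contDiff_pi.1 hV j)
  set η : ℝ → Fin n → ℝ := fun s =>
    γ s + a • (φ s • e s) + (a ^ 2 / 2) • (- chr G (γ s) (φ s • e s) (φ s • e s)) with hη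
  have hηC : ContDiff ℝ 1 η :=
    (hγ.add (hV.const_smul a)).add (hq.neg.const_smul (a ^ 2 / 2))
  refine ⟨η, hηC, by simp [hη, hφ0], by simp [hη, hφ1], fun ha => ?_⟩
  have hsp : ∀ s ∈ Icc (0 : ℝ) 1,
      sqSpeed G η s = variationDensity G (γ s) (deriv γ s) (e s) (φ s) (φ' s) a := by
    intro s hs
    have d1 := ((hγ.differentiable (by simp)) s).hasDerivAt
    have d2 : HasDerivAt (fun s => φ s • e s)
        (φ' s • e s - chr G (γ s) (deriv γ s) (φ s • e s)) s := by
      refine ((hφ s).smul (hed s hs).1).congr_deriv ?_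
      simp only [map_smul, smul_neg]
      abel
    have d3 := hasDerivAt_chr hG d1 d2 d2
    have d4 : HasDerivAt η (deriv γ s + a • (φ' s • e s - chr G (γ s) (deriv γ s) (φ s • e s))
        + (a ^ 2 / 2) • (- dchr G (γ s) (deriv γ s) (φ s • e s) (φ s • e s)
          - (2 * φ' s) • chr G (γ s) (e s) (φ s • e s)
          + (2 : ℝ) • chr G (γ s) (chr G (γ s) (deriv γ s) (φ s • e s)) (φ s • e s))) s := by
      refine ((d1.add (d2.const_smul a)).add (d3.neg.const_smul (a ^ 2 / 2))).congr_deriv ?_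
      congr 2
      rw [chr_comm hG (γ s) (φ s • e s) (φ' s • e s - chr G (γ s) (deriv γ s) (φ s • e s))]
      rw [map_sub, map_smul (chr G (γ s)) (φ' s) (e s)]
      simp only [LinearMap.sub_apply, LinearMap.smul_apply]
      module
    rw [sqSpeed, d4.deriv, variationDensity, edens]
  have hle := intervalIntegral.norm_integral_le_of_norm_le_const (a := (0 : ℝ)) (b := 1)
    (C := C * |a| ^ 3)
    (f := fun s => sqSpeed G η s - sqSpeed G γ s
      - a * (2 * φ' s * bil (G (γ s)) (e s) (deriv γ s))
      - a ^ 2 / 2 * deriv (deriv (variationDensity G (γ s) (deriv γ s) (e s) (φ s) (φ' s))) 0)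
    fun s hs => by
      have hs' := Ioc_subset_Icc_self (by rwa [uIoc_of_le zero_le_one] at hs)
      rw [hsp s hs']
      exact (hest s hs').2 a ha
  have i1 := (continuous_sqSpeed hG hηC).intervalIntegrable (μ := volume) 0 1
  have i2 := (continuous_sqSpeed hG hγ).intervalIntegrable (μ := volume) 0 1
  have c3 : Continuous fun s => 2 * φ' s * bil (G (γ s)) (e s) (deriv γ s) :=
    (continuous_const.mul hφ'c).mul (continuous_bil
      (fun i j => (hG.1 i j).continuous.comp hγ.continuous) he.continuous hγ')
  have i3 := (c3.const_mul a).intervalIntegrable (μ := volume) 0 1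
  have i4 := (hdd.const_mul (a ^ 2 / 2)).intervalIntegrable (μ := volume) 0 1
  rw [intervalIntegral.integral_sub ((i1.sub i2).sub i3) i4,
    intervalIntegral.integral_sub (i1.sub i2) i3, intervalIntegral.integral_sub i1 i2,
    intervalIntegral.integral_const_mul, intervalIntegral.integral_const_mul] at hle
  rw [sub_zero, abs_one, mul_one, Real.norm_eq_abs] at hle
  exact hle

end

/-- A monotone `C¹` function rising from `0` to `1` on `[0, b]` and constant afterwards. -/
lemma exists_ramp {b : ℝ} (hb : 0 < b) (hb1 : b ≤ 1) :
    ∃ φ φ' : ℝ → ℝ, (∀ s, HasDerivAt φ (φ' s) s) ∧ Continuous φ' ∧ φ 0 = 0 ∧ φ 1 = 1 ∧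
      (∀ s ∈ Icc (0 : ℝ) 1, φ s ∈ Icc 0 1 ∧ φ' s ∈ Icc 0 (2 / b) ∧ 1 - φ s ^ 2 ≤ b * φ' s) ∧
      ∀ s, b ≤ s → φ s = 1 := by
  have hm : ∀ s, b ≤ s → max (1 - s / b) 0 = 0 := fun s hs =>
    max_eq_right (sub_nonpos.2 ((one_le_div hb).2 hs))
  refine ⟨fun s => 1 - max (1 - s / b) 0 ^ 2, fun s => 2 / b * max (1 - s / b) 0,
    fun s => ?_, by fun_prop, by simp, ?_, fun s hs => ?_, fun s hs => ?_⟩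
  · have h1 : HasDerivAt (fun s : ℝ => 1 - s / b) (-(1 / b)) s :=
      ((hasDerivAt_id s).div_const b).const_sub 1
    have h2 := ((hasDerivAt_max_zero_pow 0 (1 - s / b)).comp s h1).const_sub 1
    refine h2.congr_deriv ?_
    simp only [CharP.cast_eq_zero, zero_add, pow_one]
    ring
  · simp only [hm 1 hb1]
    norm_num
  · have hm0 : 0 ≤ max (1 - s / b) 0 := le_max_right _ _
    have hm1 : max (1 - s / b) 0 ≤ 1 :=
      max_le (by linarith [div_nonneg hs.1 hb.le]) zero_le_one
    set m := max (1 - s / b) 0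
    have hm2 : m ^ 2 ≤ m := by nlinarith
    have hb2 : 0 ≤ 2 / b := by positivity
    refine ⟨⟨by linarith, by linarith [sq_nonneg m]⟩, ⟨mul_nonneg hb2 hm0, ?_⟩, ?_⟩
    · simpa using mul_le_mul_of_nonneg_left hm1 hb2
    · have : b * (2 / b * m) = 2 * m := by field_simp
      rw [this]
      nlinarith [sq_nonneg (m ^ 2)]
  · simp [hm s hs]

section

variable {n : ℕ} {T : ℝ} {g : (Fin n → ℝ) → ℝ → Matrix (Fin n) (Fin n) ℝ}
  (hT : 0 < T) (hg : SmoothMetricFamily g (Icc 0 T))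

lemma SmoothMetric.contDiff_ricci {G : (Fin n → ℝ) → Matrix (Fin n) (Fin n) ℝ}
    (hG : SmoothMetric G) (j k : Fin n) : ContDiff ℝ (⊤ : ℕ∞) fun x => ricci G x j k := by
  have h : SmoothMetricFamily (fun x _ => G x) (Icc (0 : ℝ) 1) :=
    ⟨fun i j => ((hG.1 i j).comp contDiff_fst).contDiffOn, fun x _ _ => hG.2 x⟩
  exact (contDiffOn_ricci one_pos h j k).slice (t := 0) (by simp)

lemma IsFrame.abs_bil_le {G : Matrix (Fin n) (Fin n) ℝ} {E : Fin n → Fin n → ℝ} (h : IsFrame G E)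
    (hs : G.IsSymm) (hG : G.PosDef) {v : Fin n → ℝ} {l : ℝ} (hl : 0 ≤ l) (hv : bil G v v ≤ l ^ 2)
    (c : Fin n) : |bil G (E c) v| ≤ l := by
  refine abs_le_of_sq_le_sq (le_trans ?_ hv) hl
  rw [← h.sum_bil_sq hs hG v]
  exact Finset.single_le_sum (f := fun c => bil G (E c) v ^ 2) (fun c _ => sq_nonneg _)
    (Finset.mem_univ c)

/-- Upper bound for the sum of the second variations of energy over a parallel frame. -/
lemma sum_second_variation_le {G : (Fin n → ℝ) → Matrix (Fin n) (Fin n) ℝ} (hG : SmoothMetric G)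
    (hn : 1 ≤ n) {γ : ℝ → Fin n → ℝ} (hγ : ContDiff ℝ 1 γ) {r l : ℝ} (hr : 0 < r) (hrl : r ≤ l)
    (hsp : ∀ s ∈ Icc (0 : ℝ) 1, sqSpeed G γ s ≤ l ^ 2)
    (hric : ∀ s ∈ Icc (0 : ℝ) 1, s < r / l →
      bil (Matrix.of (ricci G (γ s))) (deriv γ s) (deriv γ s) ≤ ((n : ℝ) - 1) / r ^ 2 * sqSpeed G γ s)
    {φ φ' : ℝ → ℝ} (hφ : ∀ s, HasDerivAt φ (φ' s) s) (hφ'c : Continuous φ') (hφ0 : φ 0 = 0)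
    (hφ1 : φ 1 = 1)
    (hφb : ∀ s ∈ Icc (0 : ℝ) 1, φ s ∈ Icc 0 1 ∧ φ' s ∈ Icc 0 (2 / (r / l)) ∧
      1 - φ s ^ 2 ≤ r / l * φ' s)
    (hφe : ∀ s, r / l ≤ s → φ s = 1) :
    ∫ s in (0 : ℝ)..1, (2 * n * φ' s ^ 2
        - 2 * φ s ^ 2 * bil (Matrix.of (ricci G (γ s))) (deriv γ s) (deriv γ s))
      ≤ -2 * (∫ s in (0 : ℝ)..1, bil (Matrix.of (ricci G (γ s))) (deriv γ s) (deriv γ s))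
        + 6 * n * l / r := by
  have hl : 0 < l := hr.trans_le hrl
  have hγ' : Continuous (deriv γ) := hγ.continuous_deriv le_rfl
  have hφc : Continuous φ := continuous_iff_continuousAt.2 fun s => (hφ s).continuousAt
  set q : ℝ → ℝ := fun s => bil (Matrix.of (ricci G (γ s))) (deriv γ s) (deriv γ s) with hq
  have hqc : Continuous q :=
    continuous_bil (fun i j => (hG.contDiff_ricci i j).continuous.comp hγ.continuous) hγ' hγ'
  have hφint : ∫ s in (0 : ℝ)..1, φ' s = 1 := by
    rw [intervalIntegral.integral_eq_sub_of_hasDerivAt (fun s _ => hφ s)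
      (hφ'c.intervalIntegrable 0 1), hφ0, hφ1, sub_zero]
  have hpt : ∀ s ∈ Icc (0 : ℝ) 1, 2 * n * φ' s ^ 2 - 2 * φ s ^ 2 * q s
      ≤ -2 * q s + 6 * n * l / r * φ' s := by
    intro s hs
    obtain ⟨⟨h0, h1⟩, ⟨h2, h3⟩, h4⟩ := hφb s hs
    have hn0 : (0 : ℝ) ≤ (n : ℝ) - 1 := by
      have : (1 : ℝ) ≤ n := by exact_mod_cast hn
      linarith
    have a1 : 2 * n * φ' s ^ 2 ≤ 4 * n * l / r * φ' s := by
      have h5 : 2 * n * φ' s ^ 2 ≤ 2 * n * (2 / (r / l) * φ' s) := by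
        rw [sq]
        gcongr
      refine h5.trans_eq ?_
      field_simp
      ring
    have a2 : (1 - φ s ^ 2) * q s ≤ n * l / r * φ' s := by
      rcases lt_or_ge s (r / l) with h | h
      · have h5 : q s ≤ ((n : ℝ) - 1) / r ^ 2 * l ^ 2 :=
          (hric s hs h).trans (mul_le_mul_of_nonneg_left (hsp s hs) (by positivity))
        have h6 : 0 ≤ 1 - φ s ^ 2 := by nlinarith
        calc (1 - φ s ^ 2) * q s ≤ (1 - φ s ^ 2) * (((n : ℝ) - 1) / r ^ 2 * l ^ 2) :=
              mul_le_mul_of_nonneg_left h5 h6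
          _ ≤ (r / l * φ' s) * (((n : ℝ) - 1) / r ^ 2 * l ^ 2) :=
              mul_le_mul_of_nonneg_right h4 (by positivity)
          _ = ((n : ℝ) - 1) * (l / r * φ' s) := by field_simp
          _ ≤ n * (l / r * φ' s) := by
              refine mul_le_mul_of_nonneg_right (by linarith) (by positivity)
          _ = n * l / r * φ' s := by ring
      · rw [hφe s h]
        have : 0 ≤ n * l / r * φ' s := by positivity
        simpa using this
    have a3 : 6 * n * l / r * φ' s = 4 * n * l / r * φ' s + 2 * (n * l / r * φ' s) := by ring
    linarith
  have i1 : Continuous fun s => 2 * n * φ' s ^ 2 - 2 * φ s ^ 2 * q s := by fun_prop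
  have i2 : Continuous fun s => -2 * q s := by fun_prop
  have i3 : Continuous fun s => 6 * n * l / r * φ' s := by fun_prop
  refine (intervalIntegral.integral_mono_on zero_le_one (i1.intervalIntegrable 0 1)
    ((i2.add i3).intervalIntegrable 0 1) hpt).trans_eq ?_
  simp only [Pi.add_apply]
  rw [intervalIntegral.integral_add (i2.intervalIntegrable 0 1) (i3.intervalIntegrable 0 1),
    intervalIntegral.integral_const_mul, intervalIntegral.integral_const_mul, hφint, mul_one]

include hT hg in
/-- Variations of a path along a frame at its endpoint, with second order expansion of the
energy, uniformly over paths of bounded speed in a compact set. -/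
lemma exists_frame_variation (hn : 1 ≤ n) {S : Set (Fin n → ℝ)} (hS : IsCompact S) {r L : ℝ}
    (hr : 0 < r) :
    ∃ C, 0 ≤ C ∧ ∀ t ∈ Icc 0 T, ∀ γ : ℝ → Fin n → ℝ, ContDiff ℝ 1 γ → ∀ l, r ≤ l → l ≤ L →
      (∀ s ∈ Icc (0 : ℝ) 1, γ s ∈ S ∧ sqSpeed (fun y => g y t) γ s ≤ l ^ 2) →
      (∀ s ∈ Icc (0 : ℝ) 1, s < r / l →
        bil (Matrix.of (ricci (fun y => g y t) (γ s))) (deriv γ s) (deriv γ s)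
          ≤ ((n : ℝ) - 1) / r ^ 2 * sqSpeed (fun y => g y t) γ s) →
      ∃ (e : Fin n → Fin n → ℝ) (y₁ y₂ : Fin n → ℝ), IsFrame (g (γ 1) t) e ∧
        (∀ c, |y₁ c| ≤ 2 * l ∧ |y₂ c| ≤ C) ∧
        ∑ c, y₂ c ≤ -2 * (∫ s in (0 : ℝ)..1,
          bil (Matrix.of (ricci (fun y => g y t) (γ s))) (deriv γ s) (deriv γ s))
            + 6 * n * l / r ∧
        ∀ c a, ∃ η : ℝ → Fin n → ℝ, ContDiff ℝ 1 η ∧ η 0 = γ 0 ∧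
          η 1 = γ 1 + a • e c + (a ^ 2 / 2) • (- chr (fun y => g y t) (γ 1) (e c) (e c)) ∧
          (|a| ≤ 1 → |energy (fun y => g y t) η - energy (fun y => g y t) γ
            - a * y₁ c - a ^ 2 / 2 * y₂ c| ≤ C * |a| ^ 3) := by
  obtain ⟨κ, hκ, hlow⟩ := exists_metric_lower_bound hg hS
  set ρ := √((L ^ 2 + n) / κ) with hρ
  have hρ2 : κ * ρ ^ 2 = L ^ 2 + n := by
    rw [hρ, Real.sq_sqrt (by positivity)]
    field_simp
  have hρ0 : 0 ≤ ρ := Real.sqrt_nonneg _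
  obtain ⟨C, hC⟩ := exists_energy_variation hT hg hS ρ (2 * L / r)
  refine ⟨|C|, abs_nonneg _, fun t ht γ hγ l hrl hlL hγS hric => ?_⟩
  have hl : 0 < l := hr.trans_le hrl
  have hG : SmoothMetric (fun y => g y t) := hg.slice ht
  have hγ' : Continuous (deriv γ) := hγ.continuous_deriv le_rfl
  obtain ⟨E, hE1, hE2, hE3⟩ := hG.exists_parallel_frame hγ
  obtain ⟨φ, φ', hφ, hφ'c, hφ0, hφ1, hφb, hφe⟩ :=
    exists_ramp (div_pos hr hl) ((div_le_one hl).2 hrl)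
  have hll : l ^ 2 ≤ L ^ 2 := pow_le_pow_left₀ hl.le hlL 2
  have hvel : ∀ s ∈ Icc (0 : ℝ) 1, γ s ∈ S ∧ ‖deriv γ s‖ ≤ ρ := fun s hs => by
    refine ⟨(hγS s hs).1, ?_⟩
    have h1 := hlow (γ s) (hγS s hs).1 t ht (deriv γ s)
    have h2 : bil (g (γ s) t) (deriv γ s) (deriv γ s) ≤ l ^ 2 := (hγS s hs).2
    have hn0 : (0 : ℝ) ≤ n := n.cast_nonneg
    have h3 : ‖deriv γ s‖ ^ 2 ≤ ρ ^ 2 := by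
      refine le_of_mul_le_mul_left ?_ hκ
      linarith
    exact (abs_le_of_sq_le_sq' h3 hρ0).2
  have hEn : ∀ c, ∀ s ∈ Icc (0 : ℝ) 1, ‖E c s‖ ≤ ρ := fun c s hs =>
    (hE3 s hs).norm_le (hG.2 _).1 (hG.2 _).2 hκ hρ0 (by rw [hρ2]; nlinarith [sq_nonneg L])
      (hlow (γ s) (hγS s hs).1 t ht) c
  have hF : 2 / (r / l) ≤ 2 * L / r := by
    rw [div_div_eq_mul_div]
    gcongr
  have key := fun c => hC t ht γ hγ hvel (E c) (hE1 c) (fun s hs => ⟨hE2 c s hs, hEn c s hs⟩)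
    φ φ' hφ hφ'c (fun s hs => ⟨(hφb s hs).1, (hφb s hs).2.1.1, (hφb s hs).2.1.2.trans hF⟩) hφ0 hφ1
  refine ⟨fun c => E c 1, fun c => ∫ s in (0 : ℝ)..1, 2 * φ' s * bil (g (γ s) t) (E c s) (deriv γ s),
    fun c => ∫ s in (0 : ℝ)..1, deriv (deriv (variationDensity (fun y => g y t) (γ s)
      (deriv γ s) (E c s) (φ s) (φ' s))) 0, hE3 1 (by simp), fun c => ⟨?_, ?_⟩, ?_, fun c a => ?_⟩
  · have hφint : ∫ s in (0 : ℝ)..1, φ' s = 1 := by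
      rw [intervalIntegral.integral_eq_sub_of_hasDerivAt (fun s _ => hφ s)
        (hφ'c.intervalIntegrable 0 1), hφ0, hφ1, sub_zero]
    have := intervalIntegral.norm_integral_le_of_norm_le (μ := volume) zero_le_one
      (f := fun s => 2 * φ' s * bil (g (γ s) t) (E c s) (deriv γ s))
      (g := fun s => 2 * l * φ' s) (Filter.Eventually.of_forall fun s hs => by
        have hs' := Ioc_subset_Icc_self hs
        have h1 := (hE3 s hs').abs_bil_le (hG.2 _).1 (hG.2 _).2 hl.le (hγS s hs').2 c
        have h2 := (hφb s hs').2.1.1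
        rw [Real.norm_eq_abs, abs_mul, abs_of_nonneg (by positivity : 0 ≤ 2 * φ' s)]
        calc 2 * φ' s * _ ≤ 2 * φ' s * l := mul_le_mul_of_nonneg_left h1 (by positivity)
          _ = _ := by ring)
      ((hφ'c.const_mul _).intervalIntegrable 0 1)
    rwa [intervalIntegral.integral_const_mul, hφint, mul_one] at this
  · exact (key c).2.1.trans (le_abs_self C)
  · rw [← intervalIntegral.integral_finsetSum fun c _ => (key c).1.intervalIntegrable 0 1]
    refine le_trans (le_of_eq ?_) (sum_second_variation_le hG hn hγ hr hrl
      (fun s hs => (hγS s hs).2) hric hφ hφ'c hφ0 hφ1 hφb hφe)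
    refine intervalIntegral.integral_congr fun s hs => ?_
    rw [uIcc_of_le zero_le_one] at hs
    exact hG.sum_deriv_deriv_edens (hE3 s hs) (deriv γ s) (φ s) (φ' s)
  · obtain ⟨η, h1, h2, h3, h4⟩ := (key c).2.2 a
    exact ⟨η, h1, h2, h3, fun ha => (h4 ha).trans
      (mul_le_mul_of_nonneg_right (le_abs_self C) (by positivity))⟩

end

section

variable {n : ℕ} {T : ℝ} {g : (Fin n → ℝ) → ℝ → Matrix (Fin n) (Fin n) ℝ}
  (hT : 0 < T) (hg : SmoothMetricFamily g (Icc 0 T))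

include hT hg in
/-- The sum over a frame of second differences of the scalar curvature is bounded by the
Laplacian, uniformly on compact sets. -/
lemma exists_scalarCurv_second_difference_le {S : Set (Fin n → ℝ)} (hS : IsCompact S) :
    ∃ C, 0 ≤ C ∧ ∀ t ∈ Icc 0 T, ∀ x ∈ S, ∀ e : Fin n → Fin n → ℝ, IsFrame (g x t) e →
      ∀ a, |a| ≤ 1 → ∑ c, (scalarCurv (fun y => g y t)
          (x + a • e c + (a ^ 2 / 2) • (- chr (fun y => g y t) x (e c) (e c)))
        + scalarCurv (fun y => g y t)
          (x + (-a) • e c + ((-a) ^ 2 / 2) • (- chr (fun y => g y t) x (e c) (e c)))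
        - 2 * scalarCurv (fun y => g y t) x)
      ≤ a ^ 2 * lapl (fun y => g y t) (fun y => scalarCurv (fun z => g z t) y) x
        + C * |a| ^ 3 := by
  obtain ⟨κ, hκ, hlow⟩ := exists_metric_lower_bound hg hS
  set ρ := √(n / κ) with hρ
  have hρ2 : κ * ρ ^ 2 = n := by
    rw [hρ, Real.sq_sqrt (by positivity)]
    field_simp
  have hQ : IsCompact ((S ×ˢ Metric.closedBall (0 : Fin n → ℝ) ρ) ×ˢ Icc 0 T) :=
    (hS.prod (isCompact_closedBall _ _)).prod isCompact_Icc
  have hΨ : ContinuousOn (fun p : ((Fin n → ℝ) × (Fin n → ℝ)) × ℝ =>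
      (p.1.1, p.1.2, - chr (fun y => g y p.2) p.1.1 p.1.2 p.1.2))
      ((S ×ˢ Metric.closedBall (0 : Fin n → ℝ) ρ) ×ˢ Icc 0 T) := by
    have hx : ContinuousOn (fun p : ((Fin n → ℝ) × (Fin n → ℝ)) × ℝ => p.1.1)
      ((S ×ˢ Metric.closedBall (0 : Fin n → ℝ) ρ) ×ˢ Icc 0 T) := by fun_prop
    have he : ContinuousOn (fun p : ((Fin n → ℝ) × (Fin n → ℝ)) × ℝ => p.1.2)
      ((S ×ˢ Metric.closedBall (0 : Fin n → ℝ) ρ) ×ˢ Icc 0 T) := by fun_prop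
    have hτ : ContinuousOn (fun p : ((Fin n → ℝ) × (Fin n → ℝ)) × ℝ => p.2)
      ((S ×ˢ Metric.closedBall (0 : Fin n → ℝ) ρ) ×ˢ Icc 0 T) := by fun_prop
    exact hx.prodMk (he.prodMk (continuousOn_chr_family hT hg hx he he hτ fun p hp => hp.2).neg)
  have hf : ContDiffOn ℝ (⊤ : ℕ∞)
      (fun p : (((Fin n → ℝ) × (Fin n → ℝ) × (Fin n → ℝ)) × ℝ) × ℝ =>
        scalarCurv (fun y => g y p.2) (p.1.1.1 + p.1.2 • p.1.1.2.1 + (p.1.2 ^ 2 / 2) • p.1.1.2.2))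
      (univ ×ˢ Icc 0 T) := by
    have h := contDiffOn_scalarCurv hT hg
    have h' : ContDiffOn ℝ (⊤ : ℕ∞)
        (fun p : (((Fin n → ℝ) × (Fin n → ℝ) × (Fin n → ℝ)) × ℝ) × ℝ =>
          (p.1.1.1 + p.1.2 • p.1.1.2.1 + (p.1.2 ^ 2 / 2) • p.1.1.2.2, p.2))
        (univ ×ˢ Icc 0 T) := by fun_prop
    have h'' : MapsTo (fun p : (((Fin n → ℝ) × (Fin n → ℝ) × (Fin n → ℝ)) × ℝ) × ℝ =>
          (p.1.1.1 + p.1.2 • p.1.1.2.1 + (p.1.2 ^ 2 / 2) • p.1.1.2.2, p.2))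
        (univ ×ˢ Icc 0 T) (univ ×ˢ Icc 0 T) := fun p hp => ⟨trivial, hp.2⟩
    simpa only [Function.comp_def] using h.comp h' h''
  obtain ⟨C, hC⟩ := exists_uniform_taylor hT hf (hQ.image_of_continuousOn hΨ)
  refine ⟨n * (2 * |C|), by positivity, fun t ht x hx e he a ha => ?_⟩
  set G : (Fin n → ℝ) → Matrix (Fin n) (Fin n) ℝ := fun y => g y t with hGdef
  have hG : SmoothMetric G := hg.slice ht
  set F : Fin n → ℝ → ℝ := fun c a =>
    scalarCurv G (x + a • e c + (a ^ 2 / 2) • (- chr G x (e c) (e c))) with hF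
  have hF0 : ∀ c, F c 0 = scalarCurv G x := fun c => by simp [hF]
  have hpt : ∀ c, F c a + F c (-a) - 2 * scalarCurv G x
      ≤ a ^ 2 * deriv (deriv (F c)) 0 + 2 * |C| * |a| ^ 3 := by
    intro c
    have hen : ‖e c‖ ≤ ρ := he.norm_le (hG.2 x).1 (hG.2 x).2 hκ (Real.sqrt_nonneg _)
      hρ2.ge (hlow x hx t ht) c
    have hd := (hC (x, e c, - chr G x (e c) (e c))
      ⟨((x, e c), t), ⟨⟨hx, by simpa using hen⟩, ht⟩, rfl⟩ t ht).2.2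
    have h1 : |F c a - F c 0 - a * deriv (F c) 0 - a ^ 2 / 2 * deriv (deriv (F c)) 0|
      ≤ C * |a| ^ 3 := hd a ha
    have h2 : |F c (-a) - F c 0 - (-a) * deriv (F c) 0 - (-a) ^ 2 / 2 * deriv (deriv (F c)) 0|
      ≤ C * |-a| ^ 3 := hd (-a) (by rwa [abs_neg])
    rw [hF0] at h1 h2
    rw [abs_neg, neg_sq] at h2
    have h3 := (abs_le.1 h1).2
    have h4 := (abs_le.1 h2).2
    have h5 : C * |a| ^ 3 ≤ |C| * |a| ^ 3 :=
      mul_le_mul_of_nonneg_right (le_abs_self C) (by positivity)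
    linarith
  refine (Finset.sum_le_sum fun c _ => hpt c).trans_eq ?_
  rw [Finset.sum_add_distrib, ← Finset.mul_sum,
    he.sum_deriv_deriv (G := G) ((contDiffOn_scalarCurv hT hg).slice ht)]
  simp only [Finset.sum_const, Finset.card_univ, Fintype.card_fin, nsmul_eq_mul]
  ring

include hT hg in
/-- First order expansion in time of the scalar curvature, uniformly on compact sets. -/
lemma exists_uniform_time_scalarCurv (hflow : IsRicciFlow g (Icc 0 T)) {S : Set (Fin n → ℝ)}
    (hS : IsCompact S) {ε : ℝ} (hε : 0 < ε) :
    ∃ τ₀ > 0, ∀ x ∈ S, ∀ t ∈ Icc 0 T, ∀ τ, 0 ≤ τ → τ < τ₀ → t - τ ∈ Icc 0 T →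
      |scalarCurv (fun y => g y (t - τ)) x - scalarCurv (fun y => g y t) x
        + τ * (lapl (fun y => g y t) (fun y => scalarCurv (fun z => g z t) y) x
          + 2 * ricSq (fun y => g y t) x)| ≤ ε * τ := by
  have hR := contDiffOn_scalarCurv hT hg
  refine exists_uniform_time (f := fun x s => scalarCurv (fun y => g y s) x)
    (q := fun x s => lapl (fun y => g y s) (fun y => scalarCurv (fun z => g z s) y) x
          + 2 * ricSq (fun y => g y s) x) hS (fun x hx => ?_) ?_
    (fun x _ t ht => hflow.hasDerivAt_scalarCurv hT hg x ht) hε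
  · have h' : ContinuousOn (fun s : ℝ => (x, s)) (Icc 0 T) := by fun_prop
    have h'' : MapsTo (fun s : ℝ => (x, s)) (Icc 0 T) (univ ×ˢ Icc 0 T) :=
      fun s hs => ⟨trivial, hs⟩
    simpa only [Function.comp_def] using hR.continuousOn.comp h' h''
  · have h1 := contDiffOn_lapl hT hg (f := fun x s => scalarCurv (fun y => g y s) x) hR
    exact (h1.continuousOn.add (continuousOn_const.mul (contDiffOn_ricSq hT hg).continuousOn)).mono
      (prod_mono (subset_univ _) le_rfl)

include hT hg in
/-- First order expansion in time of the energy of paths, uniformly over paths of bounded speed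
in a compact set. -/
lemma exists_uniform_time_energy (hflow : IsRicciFlow g (Icc 0 T)) {S : Set (Fin n → ℝ)}
    (hS : IsCompact S) (L : ℝ) :
    ∃ C, 0 ≤ C ∧ ∀ ε > 0, ∃ τ₀ > 0, ∀ t ∈ Icc 0 T, ∀ γ : ℝ → Fin n → ℝ, ContDiff ℝ 1 γ →
      (∀ s ∈ Icc (0 : ℝ) 1, γ s ∈ S ∧ sqSpeed (fun y => g y t) γ s ≤ L ^ 2) →
      |∫ s in (0 : ℝ)..1, bil (Matrix.of (ricci (fun y => g y t) (γ s))) (deriv γ s) (deriv γ s)|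
        ≤ C ∧
      ∀ τ, 0 ≤ τ → τ < τ₀ → t - τ ∈ Icc 0 T →
        |energy (fun y => g y (t - τ)) γ - energy (fun y => g y t) γ
          - 2 * τ * ∫ s in (0 : ℝ)..1,
            bil (Matrix.of (ricci (fun y => g y t) (γ s))) (deriv γ s) (deriv γ s)| ≤ ε * τ := by
  obtain ⟨κ, hκ, hlow⟩ := exists_metric_lower_bound hg hS
  set ρ := √(L ^ 2 / κ) with hρ
  have hρ2 : κ * ρ ^ 2 = L ^ 2 := by
    rw [hρ, Real.sq_sqrt (by positivity)]
    field_simp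
  have hD : IsCompact (S ×ˢ Metric.closedBall (0 : Fin n → ℝ) ρ) :=
    hS.prod (isCompact_closedBall _ _)
  have hqc : ContinuousOn (fun p : ((Fin n → ℝ) × (Fin n → ℝ)) × ℝ =>
      bil (Matrix.of (ricci (fun y => g y p.2) p.1.1)) p.1.2 p.1.2)
      ((S ×ˢ Metric.closedBall (0 : Fin n → ℝ) ρ) ×ˢ Icc 0 T) := by
    simp only [bil_apply, Matrix.of_apply]
    refine continuousOn_finsetSum _ fun i _ => continuousOn_finsetSum _ fun j _ => ?_
    refine (ContinuousOn.mul ?_ ?_).mul ?_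
    · have h' : ContinuousOn (fun p : ((Fin n → ℝ) × (Fin n → ℝ)) × ℝ => (p.1.1, p.2))
        ((S ×ˢ Metric.closedBall (0 : Fin n → ℝ) ρ) ×ˢ Icc 0 T) := by fun_prop
      have h'' : MapsTo (fun p : ((Fin n → ℝ) × (Fin n → ℝ)) × ℝ => (p.1.1, p.2))
        ((S ×ˢ Metric.closedBall (0 : Fin n → ℝ) ρ) ×ˢ Icc 0 T) (univ ×ˢ Icc 0 T) :=
        fun p hp => ⟨trivial, hp.2⟩
      simpa only [Function.comp_def] using (contDiffOn_ricci hT hg i j).continuousOn.comp h' h''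
    · exact ((continuous_apply i).comp (continuous_snd.comp continuous_fst)).continuousOn
    · exact ((continuous_apply j).comp (continuous_snd.comp continuous_fst)).continuousOn
  have hfc : ∀ d ∈ S ×ˢ Metric.closedBall (0 : Fin n → ℝ) ρ,
      ContinuousOn (fun s => bil (g d.1 s) d.2 d.2) (Icc 0 T) := fun d _ => by
    have h' : ContinuousOn (fun s : ℝ => ((d.1, s), d.2)) (Icc 0 T) := by fun_prop
    have h'' : MapsTo (fun s : ℝ => ((d.1, s), d.2)) (Icc 0 T) ((univ ×ˢ Icc 0 T) ×ˢ univ) :=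
      fun s hs => ⟨⟨trivial, hs⟩, trivial⟩
    simpa only [Function.comp_def] using (continuousOn_bil_family hg).comp h' h''
  have hder : ∀ d ∈ S ×ˢ Metric.closedBall (0 : Fin n → ℝ) ρ, ∀ t ∈ Ioo 0 T,
      HasDerivAt (fun s => bil (g d.1 s) d.2 d.2)
        (-2 * bil (Matrix.of (ricci (fun y => g y t) d.1)) d.2 d.2) t := fun d _ t ht => by
    simp only [bil_apply, Matrix.of_apply, Finset.mul_sum]
    refine HasDerivAt.fun_sum fun i _ => HasDerivAt.fun_sum fun j _ => ?_
    have h := ((hflow.hasDerivAt hg d.1 ht i j).mul_const (d.2 i)).mul_const (d.2 j)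
    exact h.congr_deriv (by ring)
  obtain ⟨C, hC⟩ := (hD.prod isCompact_Icc).exists_bound_of_continuousOn hqc
  refine ⟨|C|, abs_nonneg C, fun ε hε => ?_⟩
  obtain ⟨τ₀, hτ₀, h⟩ := exists_uniform_time (f := fun d s => bil (g d.1 s) d.2 d.2)
    (q := fun d s => -2 * bil (Matrix.of (ricci (fun y => g y s) d.1)) d.2 d.2)
    hD hfc (continuousOn_const.mul hqc) hder hε
  refine ⟨τ₀, hτ₀, fun t ht γ hγ hγS => ?_⟩
  have hG : SmoothMetric (fun y => g y t) := hg.slice ht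
  have hγ' : Continuous (deriv γ) := hγ.continuous_deriv le_rfl
  have hmem : ∀ s ∈ Icc (0 : ℝ) 1,
      (γ s, deriv γ s) ∈ S ×ˢ Metric.closedBall (0 : Fin n → ℝ) ρ := fun s hs => by
    refine ⟨(hγS s hs).1, ?_⟩
    have h1 := hlow (γ s) (hγS s hs).1 t ht (deriv γ s)
    have h2 : bil (g (γ s) t) (deriv γ s) (deriv γ s) ≤ L ^ 2 := (hγS s hs).2
    have h3 : ‖deriv γ s‖ ^ 2 ≤ ρ ^ 2 := by
      refine le_of_mul_le_mul_left ?_ hκ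
      linarith
    simpa using (abs_le_of_sq_le_sq' h3 (Real.sqrt_nonneg _)).2
  have cric : Continuous fun s =>
      bil (Matrix.of (ricci (fun y => g y t) (γ s))) (deriv γ s) (deriv γ s) :=
    continuous_bil (fun i j => (hG.contDiff_ricci i j).continuous.comp hγ.continuous) hγ' hγ'
  constructor
  · have := intervalIntegral.norm_integral_le_of_norm_le_const (a := (0 : ℝ)) (b := 1) (C := |C|)
      (f := fun s => bil (Matrix.of (ricci (fun y => g y t) (γ s))) (deriv γ s) (deriv γ s))
      fun s hs => by
        have hs' := Ioc_subset_Icc_self (by rwa [uIoc_of_le zero_le_one] at hs)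
        exact (hC ((γ s, deriv γ s), t) ⟨hmem s hs', ht⟩).trans (le_abs_self C)
    rwa [sub_zero, abs_one, mul_one, Real.norm_eq_abs] at this
  · intro τ hτ hττ htτ
    have hle := intervalIntegral.norm_integral_le_of_norm_le_const (a := (0 : ℝ)) (b := 1)
      (C := ε * τ)
      (f := fun s => sqSpeed (fun y => g y (t - τ)) γ s - sqSpeed (fun y => g y t) γ s
        - 2 * τ * bil (Matrix.of (ricci (fun y => g y t) (γ s))) (deriv γ s) (deriv γ s))
      fun s hs => by
        have hs' := Ioc_subset_Icc_self (by rwa [uIoc_of_le zero_le_one] at hs)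
        have := h (γ s, deriv γ s) (hmem s hs') t ht τ hτ hττ htτ
        rw [Real.norm_eq_abs]
        refine le_trans (le_of_eq ?_) this
        congr 1
        simp only [sqSpeed]
        ring
    have i1 := (continuous_sqSpeed (hg.slice htτ) hγ).intervalIntegrable (μ := volume) 0 1
    have i2 := (continuous_sqSpeed hG hγ).intervalIntegrable (μ := volume) 0 1
    have i3 := (cric.const_mul (2 * τ)).intervalIntegrable (μ := volume) 0 1
    rw [intervalIntegral.integral_sub (i1.sub i2) i3, intervalIntegral.integral_sub i1 i2,
      intervalIntegral.integral_const_mul, sub_zero, abs_one, mul_one, Real.norm_eq_abs] at hle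
    exact hle

end

lemma exists_le_of_cutoff_le (P : ℝ) :
    ∃ η > 0, ∀ σ < 1, cutoff σ ≤ P → σ ≤ 1 - η := by
  refine ⟨1 / (4 * (|P| + 1)), by positivity, fun σ hσ h => ?_⟩
  by_contra! hc
  have hP : 0 < 4 * (|P| + 1) := by positivity
  have h1 : 0 < 1 - σ := by linarith
  have h2 : 1 - σ < 1 / (4 * (|P| + 1)) := by linarith
  have h3 : 1 / (4 * (|P| + 1)) ≤ 1 / 4 :=
    one_div_le_one_div_of_le (by norm_num) (by linarith [abs_nonneg P])
  have h4 : 4 * (|P| + 1) < (1 - σ)⁻¹ := by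
    have := one_div_lt_one_div_of_lt h1 h2
    rwa [one_div_one_div, one_div] at this
  have h5 : (3 / 4 : ℝ) ≤ max σ 0 := le_max_of_le_left (by linarith)
  have h6 : (3 / 4 : ℝ) ^ 4 * (4 * (|P| + 1)) ^ 2 ≤ cutoff σ := by
    unfold cutoff
    gcongr
  nlinarith [le_abs_self P, abs_nonneg P]

/-- The barrier `min (-1/(κt + 1/K), -c)`. -/
def barrier (κ K c t : ℝ) : ℝ := min (-(1 / (κ * t + 1 / K))) (-c)

section

variable {κ K c : ℝ}

lemma barrier_le_neg (t : ℝ) : barrier κ K c t ≤ -c := min_le_right _ _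

lemma barrier_sub_le (hκ : 0 < κ) (hK : 0 < K) {ε : ℝ} (hε : 0 < ε) :
    ∃ τ₀ > 0, ∀ t τ, 0 ≤ τ → τ < τ₀ → 0 ≤ t - τ →
      barrier κ K c t - barrier κ K c (t - τ) ≤ κ * τ * barrier κ K c t ^ 2 + ε * τ := by
  refine ⟨ε / (κ ^ 2 * K ^ 3), by positivity, fun t τ hτ hττ ht => ?_⟩
  have hp : 0 < κ * (t - τ) + 1 / K := by positivity
  have hp' : 0 < κ * t + 1 / K := by
    have : 0 ≤ t := by linarith
    positivity
  set u := 1 / (κ * t + 1 / K) with hu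
  set v := 1 / (κ * (t - τ) + 1 / K) with hv
  have hu0 : 0 < u := by positivity
  have hv0 : 0 < v := by positivity
  have hvK : v ≤ K := by
    rw [hv, div_le_iff₀ hp]
    have : K * (1 / K) = 1 := by field_simp
    nlinarith [mul_nonneg (mul_nonneg hκ.le ht) hK.le]
  have huv : v - u = κ * τ * (u * v) := by
    have h1 : u * (κ * t + 1 / K) = 1 := one_div_mul_cancel hp'.ne'
    have h2 : v * (κ * (t - τ) + 1 / K) = 1 := one_div_mul_cancel hp.ne'
    linear_combination (-v) * h1 + u * h2
  have hκτ : 0 ≤ κ * τ := by positivity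
  have huv' : u ≤ v := by
    have : 0 ≤ κ * τ * (u * v) := by positivity
    linarith
  have huK : u ≤ K := huv'.trans hvK
  have hmain : v - u ≤ κ * τ * u ^ 2 + ε * τ := by
    have e : v - u = κ * τ * u ^ 2 + (κ * τ) ^ 2 * (u ^ 2 * v) := by
      have : v = u + κ * τ * (u * v) := by linarith
      rw [huv]
      nth_rewrite 1 [this]
      ring
    rw [e]
    have h1 : u ^ 2 * v ≤ K ^ 2 * K := by gcongr
    have h2 : κ ^ 2 * K ^ 3 * τ ≤ ε := by
      rw [lt_div_iff₀ (by positivity)] at hττ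
      linarith
    have h3 : (κ * τ) ^ 2 * (u ^ 2 * v) ≤ (κ * τ) ^ 2 * (K ^ 2 * K) := by gcongr
    have h4 : κ ^ 2 * K ^ 3 * τ * τ ≤ ε * τ := mul_le_mul_of_nonneg_right h2 hτ
    nlinarith
  have hb : barrier κ K c t = min (-u) (-c) := rfl
  have hb' : barrier κ K c (t - τ) = min (-v) (-c) := rfl
  have hb2 : u ^ 2 ≤ barrier κ K c t ^ 2 := by
    rw [hb, ← neg_sq (min (-u) (-c))]
    exact pow_le_pow_left₀ hu0.le (by linarith [min_le_left (-u) (-c)]) 2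
  have hb3 : κ * τ * u ^ 2 ≤ κ * τ * barrier κ K c t ^ 2 := mul_le_mul_of_nonneg_left hb2 hκτ
  have hετ : 0 ≤ ε * τ := by positivity
  have hb4 : 0 ≤ κ * τ * barrier κ K c t ^ 2 := by positivity
  rcases le_total (-v) (-c) with h | h
  · rw [hb', min_eq_left h]
    have := (hb.trans_le (min_le_left _ _))
    linarith
  · rw [hb', min_eq_right h]
    linarith [barrier_le_neg (κ := κ) (K := K) (c := c) t]

lemma exists_barrier_near_zero (hκ : 0 < κ) (hK : 0 < K) {ε : ℝ} (hε : 0 < ε) :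
    ∃ η > 0, ∀ t, 0 ≤ t → t < η → barrier κ K c t ≤ -K + ε := by
  refine ⟨ε / (κ * K ^ 2), by positivity, fun t ht htη => (min_le_left _ _).trans ?_⟩
  have hp : 0 < κ * t + 1 / K := by positivity
  have h1 : K - ε ≤ 1 / (κ * t + 1 / K) := by
    rw [le_div_iff₀ hp]
    have h2 : t * (κ * K ^ 2) < ε := (lt_div_iff₀ (by positivity)).1 htη
    have h3 : K * (1 / K) = 1 := by field_simp
    have h4 : t * (κ * K ^ 2) * (1 / K) ≤ ε * (1 / K) :=
      mul_le_mul_of_nonneg_right h2.le (by positivity)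
    have h5 : t * (κ * K ^ 2) * (1 / K) = K * (κ * t) := by field_simp
    have h6 : 0 ≤ ε * (κ * t) := by positivity
    nlinarith
  linarith

end

/-- The rescaled energy of a path, used as argument of the cutoff. -/
def pathLevel {n : ℕ} (L : ℝ) (G : (Fin n → ℝ) → Matrix (Fin n) (Fin n) ℝ)
    (γ : ℝ → Fin n → ℝ) : ℝ :=
  8 / L ^ 2 * energy G γ - 9 / 2

section

variable {n : ℕ} {T : ℝ} {g : (Fin n → ℝ) → ℝ → Matrix (Fin n) (Fin n) ℝ}
  (hT : 0 < T) (hg : SmoothMetricFamily g (Icc 0 T))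

include hT hg in
/-- Second order condition in space at a path almost minimizing the scalar curvature plus a
multiple of the cutoff. -/
lemma exists_space_inequality (hn : 1 ≤ n) {S : Set (Fin n → ℝ)} (hS : IsCompact S) {r L μ η : ℝ}
    (hr : 0 < r) (hL : 0 < L) (hμ : 0 ≤ μ) (hη : 0 < η) {ε : ℝ} (hε : 0 < ε) :
    ∃ a₀ > 0, ∀ t ∈ Icc 0 T, ∀ γ : ℝ → Fin n → ℝ, ContDiff ℝ 1 γ → ∀ l, r ≤ l → l ≤ L →
      (∀ s ∈ Icc (0 : ℝ) 1, γ s ∈ S ∧ sqSpeed (fun y => g y t) γ s ≤ l ^ 2) →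
      (∀ s ∈ Icc (0 : ℝ) 1, s < r / l →
        bil (Matrix.of (ricci (fun y => g y t) (γ s))) (deriv γ s) (deriv γ s)
          ≤ ((n : ℝ) - 1) / r ^ 2 * sqSpeed (fun y => g y t) γ s) →
      pathLevel L (fun y => g y t) γ ≤ 1 - η →
      ∀ a, 0 ≤ a → a ≤ a₀ → ∀ d,
      (∀ β : ℝ → Fin n → ℝ, ContDiff ℝ 1 β → β 0 = γ 0 → pathLevel L (fun y => g y t) β < 1 →
        scalarCurv (fun y => g y t) (γ 1) + μ * cutoff (pathLevel L (fun y => g y t) γ) - d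
          ≤ scalarCurv (fun y => g y t) (β 1) + μ * cutoff (pathLevel L (fun y => g y t) β)) →
      -(2 * n * d) ≤ a ^ 2 * (
        lapl (fun y => g y t) (fun y => scalarCurv (fun z => g z t) y) (γ 1)
        + μ * (cutoffDeriv (pathLevel L (fun y => g y t) γ) * (8 / L ^ 2 * (-2 * (∫ s in (0 : ℝ)..1,
          bil (Matrix.of (ricci (fun y => g y t) (γ s))) (deriv γ s) (deriv γ s))
            + 6 * n * l / r))
          + cutoffDerivTwo (pathLevel L (fun y => g y t) γ) * (256 * n / L ^ 2)) + ε) := by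
  obtain ⟨C₁, hC₁, hvar⟩ := exists_frame_variation hT hg hn hS (L := L) hr
  obtain ⟨C₂, hC₂, hscal⟩ := exists_scalarCurv_second_difference_le hT hg hS
  set C₀ := 16 / L + 8 / L ^ 2 * C₁ with hC₀
  have hC₀' : 0 ≤ C₀ := by positivity
  obtain ⟨C₃, a₁, ha₁, ha₁', hcut⟩ := exists_cutoff_comp_taylor hη hC₀'
  set C₄ := C₂ + μ * (2 * n * |C₃|) + 1 with hC₄
  have hC₄' : 0 < C₄ := by positivity
  refine ⟨min a₁ (ε / C₄), by positivity, fun t ht γ hγ l hrl hlL hγS hric hlev a ha haa d hmin => ?_⟩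
  obtain ⟨e, y₁, y₂, he, hy, hsum, hpath⟩ := hvar t ht γ hγ l hrl hlL hγS hric
  have haa₁ : |a| ≤ a₁ := by
    rw [abs_of_nonneg ha]
    exact haa.trans (min_le_left _ _)
  have ha1 : |a| ≤ 1 := haa₁.trans ha₁'
  have hlev' : pathLevel L (fun y => g y t) γ < 1 := by linarith
  have hθ₁ := cutoffDeriv_nonneg hlev'
  have hθ₂ := cutoffDerivTwo_nonneg hlev'
  set G : (Fin n → ℝ) → Matrix (Fin n) (Fin n) ℝ := fun y => g y t with hGdef
  set σ := pathLevel L G γ with hσ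
  set k := 8 / L ^ 2 with hk
  have hk0 : 0 < k := by positivity
  set X : Fin n → ℝ → Fin n → ℝ := fun c a =>
    γ 1 + a • e c + (a ^ 2 / 2) • (- chr G (γ 1) (e c) (e c)) with hX
  have hone : ∀ c, ∀ b, |b| = |a| → scalarCurv G (γ 1) - d ≤ scalarCurv G (X c b)
      + μ * (cutoffDeriv σ * (b * (k * y₁ c) + b ^ 2 / 2 * (k * y₂ c))
        + cutoffDerivTwo σ * (b ^ 2 / 2 * (k * y₁ c) ^ 2) + |C₃| * |a| ^ 3) := by
    intro c b hb
    obtain ⟨β, h1, h2, h3, h4⟩ := hpath c b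
    have hy1 : |k * y₁ c| ≤ C₀ := by
      rw [abs_mul, abs_of_pos hk0]
      calc k * |y₁ c| ≤ k * (2 * L) :=
            mul_le_mul_of_nonneg_left ((hy c).1.trans (by linarith)) hk0.le
        _ = 16 / L := by rw [hk]; field_simp; norm_num
        _ ≤ C₀ := le_add_of_nonneg_right (by positivity)
    have hy2 : |k * y₂ c| ≤ C₀ := by
      rw [abs_mul, abs_of_pos hk0]
      exact (mul_le_mul_of_nonneg_left (hy c).2 hk0.le).trans
        (le_add_of_nonneg_left (by positivity))
    have hs : |pathLevel L G β - σ - b * (k * y₁ c) - b ^ 2 / 2 * (k * y₂ c)|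
        ≤ C₀ * |b| ^ 3 := by
      have e1 : pathLevel L G β - σ - b * (k * y₁ c) - b ^ 2 / 2 * (k * y₂ c)
          = k * (energy G β - energy G γ - b * y₁ c - b ^ 2 / 2 * y₂ c) := by
        simp only [hσ, pathLevel, hk]
        ring
      rw [e1, abs_mul, abs_of_pos hk0]
      calc k * _ ≤ k * (C₁ * |b| ^ 3) :=
            mul_le_mul_of_nonneg_left (h4 (hb.trans_le ha1)) hk0.le
        _ = k * C₁ * |b| ^ 3 := by ring
        _ ≤ C₀ * |b| ^ 3 := by
            refine mul_le_mul_of_nonneg_right ?_ (by positivity)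
            exact le_add_of_nonneg_left (by positivity)
    obtain ⟨h5, h6⟩ := hcut σ hlev _ b _ _ hy1 hy2 (hb.trans_le haa₁) hs
    have h7 := hmin β h1 h2 h5
    rw [h3] at h7
    have h8 := mul_le_mul_of_nonneg_left h6 hμ
    have h9 : μ * (C₃ * |b| ^ 3) ≤ μ * (|C₃| * |a| ^ 3) := by
      rw [hb]
      gcongr
      exact le_abs_self _
    linarith
  have htwo : ∀ c, -(2 * d) ≤ (scalarCurv G (X c a) + scalarCurv G (X c (-a))
        - 2 * scalarCurv G (γ 1))
      + μ * (cutoffDeriv σ * (k * a ^ 2 * y₂ c) + cutoffDerivTwo σ * (256 / L ^ 2 * a ^ 2)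
        + 2 * |C₃| * |a| ^ 3) := by
    intro c
    have h1 := hone c a rfl
    have h2 := hone c (-a) (abs_neg a)
    have h3 : (k * y₁ c) ^ 2 ≤ 256 / L ^ 2 := by
      have : y₁ c ^ 2 ≤ (2 * L) ^ 2 := by
        rw [← sq_abs]
        exact pow_le_pow_left₀ (abs_nonneg _) ((hy c).1.trans (by linarith)) 2
      calc (k * y₁ c) ^ 2 = k ^ 2 * y₁ c ^ 2 := by ring
        _ ≤ k ^ 2 * (2 * L) ^ 2 := by gcongr
        _ = 256 / L ^ 2 := by rw [hk]; field_simp; norm_num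
    have h4 : μ * (cutoffDerivTwo σ * (a ^ 2 * (k * y₁ c) ^ 2))
        ≤ μ * (cutoffDerivTwo σ * (a ^ 2 * (256 / L ^ 2))) := by gcongr
    rw [neg_sq] at h2
    linarith
  have hall := Finset.sum_le_sum fun c (_ : c ∈ Finset.univ) => htwo c
  rw [Finset.sum_add_distrib, ← Finset.mul_sum, Finset.sum_add_distrib, Finset.sum_add_distrib,
    ← Finset.mul_sum, ← Finset.mul_sum] at hall
  simp only [Finset.sum_const, Finset.card_univ, Fintype.card_fin, nsmul_eq_mul] at hall
  have hR := hscal t ht (γ 1) (hγS 1 (by simp)).1 e he a ha1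
  have hy2 : μ * (cutoffDeriv σ * (k * a ^ 2 * ∑ c, y₂ c)) ≤ μ * (cutoffDeriv σ * (k * a ^ 2 *
      (-2 * (∫ s in (0 : ℝ)..1, bil (Matrix.of (ricci G (γ s))) (deriv γ s) (deriv γ s))
        + 6 * n * l / r))) := by gcongr
  have herr : C₂ * |a| ^ 3 + μ * (n * (2 * |C₃| * |a| ^ 3)) ≤ a ^ 2 * ε := by
    rw [abs_of_nonneg ha]
    have h1 : C₄ * a ≤ ε := by
      have := haa.trans (min_le_right _ _)
      rw [le_div_iff₀ hC₄'] at this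
      linarith
    have h2 : a ^ 2 * (C₄ * a) ≤ a ^ 2 * ε := by gcongr
    have h3 : 0 ≤ a ^ 3 := by positivity
    have h4 : C₄ * a ^ 3 = (C₂ + μ * (2 * n * |C₃|)) * a ^ 3 + a ^ 3 := by rw [hC₄]; ring
    linarith
  have e1 : (256 : ℝ) * n / L ^ 2 = n * (256 / L ^ 2) := by ring
  rw [e1]
  linarith

include hT hg in
/-- First order expansion in time of the scalar curvature at the endpoint of a path plus a
multiple of the cutoff. -/
lemma exists_time_inequality (hflow : IsRicciFlow g (Icc 0 T)) {S : Set (Fin n → ℝ)}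
    (hS : IsCompact S) {L μ η : ℝ} (hL : 0 < L) (hμ : 0 ≤ μ) (hη : 0 < η) {ε : ℝ} (hε : 0 < ε) :
    ∃ τ₀ > 0, ∀ t ∈ Icc 0 T, ∀ γ : ℝ → Fin n → ℝ, ContDiff ℝ 1 γ →
      (∀ s ∈ Icc (0 : ℝ) 1, γ s ∈ S ∧ sqSpeed (fun y => g y t) γ s ≤ L ^ 2) →
      pathLevel L (fun y => g y t) γ ≤ 1 - η →
      ∀ τ, 0 ≤ τ → τ < τ₀ → t - τ ∈ Icc 0 T →
      pathLevel L (fun y => g y (t - τ)) γ < 1 ∧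
      scalarCurv (fun y => g y (t - τ)) (γ 1) + μ * cutoff (pathLevel L (fun y => g y (t - τ)) γ)
        ≤ scalarCurv (fun y => g y t) (γ 1) + μ * cutoff (pathLevel L (fun y => g y t) γ)
        - τ * (lapl (fun y => g y t) (fun y => scalarCurv (fun z => g z t) y) (γ 1)
          + 2 * ricSq (fun y => g y t) (γ 1))
        + τ * (μ * (cutoffDeriv (pathLevel L (fun y => g y t) γ) * (8 / L ^ 2 * (2 *
          ∫ s in (0 : ℝ)..1,
            bil (Matrix.of (ricci (fun y => g y t) (γ s))) (deriv γ s) (deriv γ s)))) + ε) := by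
  obtain ⟨CI, hCI, hen⟩ := exists_uniform_time_energy hT hg hflow hS L
  obtain ⟨Cθ, hCθ, hθ⟩ := exists_cutoff_taylor hη
  obtain ⟨Cq, hCq, hcut⟩ := exists_cutoff_le hη
  set k := 8 / L ^ 2 with hk
  have hk0 : 0 < k := by positivity
  set ε₂ := min 1 (ε / (3 * (μ * Cθ * k + 1))) with hε₂
  have hε₂0 : 0 < ε₂ := by positivity
  have hε₂' : μ * (Cθ * (k * ε₂)) ≤ ε / 3 := by
    have h1 : ε₂ ≤ ε / (3 * (μ * Cθ * k + 1)) := min_le_right _ _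
    rw [le_div_iff₀ (by positivity)] at h1
    linarith
  obtain ⟨τ₁, hτ₁, h₁⟩ := exists_uniform_time_scalarCurv hT hg hflow hS (ε := ε / 3) (by positivity)
  obtain ⟨τ₂, hτ₂, h₂⟩ := hen ε₂ hε₂0
  set H := k * (2 * CI + 1) with hH
  have hH0 : 0 < H := by positivity
  refine ⟨min (min τ₁ τ₂) (min (η / (2 * H)) (ε / (3 * (μ * (Cq * H ^ 2) + 1)))), by positivity,
    fun t ht γ hγ hγS hlev τ hτ hττ htτ => ?_⟩
  have hlt₁ : τ < τ₁ := hττ.trans_le ((min_le_left _ _).trans (min_le_left _ _))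
  have hlt₂ : τ < τ₂ := hττ.trans_le ((min_le_left _ _).trans (min_le_right _ _))
  have hlt₃ : τ < η / (2 * H) := hττ.trans_le ((min_le_right _ _).trans (min_le_left _ _))
  have hlt₄ : τ < ε / (3 * (μ * (Cq * H ^ 2) + 1)) :=
    hττ.trans_le ((min_le_right _ _).trans (min_le_right _ _))
  rw [lt_div_iff₀ (by positivity)] at hlt₃ hlt₄
  obtain ⟨hI, hE⟩ := h₂ t ht γ hγ hγS
  replace hE := hE τ hτ hlt₂ htτ
  set I := ∫ s in (0 : ℝ)..1, bil (Matrix.of (ricci (fun y => g y t) (γ s))) (deriv γ s) (deriv γ s)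
    with hIdef
  set σ := pathLevel L (fun y => g y t) γ with hσ
  set h := k * (energy (fun y => g y (t - τ)) γ - energy (fun y => g y t) γ) with hh
  have hσ' : pathLevel L (fun y => g y (t - τ)) γ = σ + h := by
    simp only [hσ, hh, pathLevel, hk]
    ring
  have hεle : ε₂ ≤ 1 := min_le_left _ _
  have hετ : ε₂ * τ ≤ 1 * τ := by gcongr
  have hhle : h ≤ τ * (k * (2 * I)) + k * (ε₂ * τ) := by
    have := mul_le_mul_of_nonneg_left (abs_le.1 hE).2 hk0.le
    linarith
  have hhabs : |h| ≤ H * τ := by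
    rw [hh, abs_mul, abs_of_pos hk0, hH, mul_assoc]
    refine mul_le_mul_of_nonneg_left ?_ hk0.le
    have h1 := abs_le.1 hE
    have h2 := abs_le.1 hI
    have h3 : τ * I ≤ τ * CI := by gcongr; exact h2.2
    have h4 : τ * (-CI) ≤ τ * I := by gcongr; exact h2.1
    rw [abs_le]
    constructor <;> linarith [h1.1, h1.2]
  have hhη : |h| ≤ η / 2 := by linarith
  have hlt : σ < 1 := by linarith
  have hθ₁ := cutoffDeriv_nonneg hlt
  rw [hσ']
  refine ⟨by linarith [le_abs_self h], ?_⟩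
  have hc := mul_le_mul_of_nonneg_left (hcut σ hlev h hhη) hμ
  have hc1 : μ * (cutoffDeriv σ * h) ≤ μ * (cutoffDeriv σ * (τ * (k * (2 * I)))) + τ * (ε / 3) := by
    have e1 : μ * (cutoffDeriv σ * h) ≤ μ * (cutoffDeriv σ * (τ * (k * (2 * I)) + k * (ε₂ * τ))) := by
      gcongr
    have e2 : μ * (cutoffDeriv σ * (k * (ε₂ * τ))) ≤ μ * (Cθ * (k * (ε₂ * τ))) := by
      gcongr
      exact (hθ σ hlev).2.1
    have e3 : τ * (μ * (Cθ * (k * ε₂))) ≤ τ * (ε / 3) := by gcongr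
    linarith
  have hc2 : μ * (Cq * h ^ 2) ≤ τ * (ε / 3) := by
    have e1 : h ^ 2 ≤ (H * τ) ^ 2 := by
      rw [← sq_abs]
      gcongr
    have e2 : μ * (Cq * h ^ 2) ≤ μ * (Cq * (H * τ) ^ 2) := by gcongr
    have e3 : τ * (τ * (μ * (Cq * H ^ 2))) ≤ τ * (ε / 3) := by
      refine mul_le_mul_of_nonneg_left ?_ hτ
      linarith
    linarith
  have hR := (abs_le.1 (h₁ (γ 1) (hγS 1 (by simp)).1 t ht τ hτ hlt₁ htτ)).2
  linarith

end

lemma continuousAt_cutoff {σ : ℝ} (hσ : σ < 1) : ContinuousAt cutoff σ := by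
  unfold cutoff
  have h : ContinuousAt (fun σ : ℝ => (1 - σ)⁻¹) σ :=
    (continuousAt_const.sub continuousAt_id).inv₀ (sub_pos.2 hσ).ne'
  exact ((continuous_id.max continuous_const).pow 4).continuousAt.mul (h.pow 2)

section

variable {n : ℕ} {G : (Fin n → ℝ) → Matrix (Fin n) (Fin n) ℝ} (hG : SmoothMetric G)

include hG

lemma energy_nonneg (γ : ℝ → Fin n → ℝ) : 0 ≤ energy G γ :=
  intervalIntegral.integral_nonneg zero_le_one fun s _ => sqSpeed_nonneg hG γ s

lemma energy_le_sq {γ : ℝ → Fin n → ℝ} (hγ : ContDiff ℝ 1 γ) {l : ℝ}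
    (h : ∀ s, sqSpeed G γ s ≤ l ^ 2) : energy G γ ≤ l ^ 2 := by
  have := intervalIntegral.integral_mono_on (μ := volume) zero_le_one
    ((continuous_sqSpeed hG hγ).intervalIntegrable 0 1)
    ((continuous_const (y := l ^ 2)).intervalIntegrable 0 1) fun s _ => h s
  simpa [energy] using this

omit hG in
lemma riemDist_le_mul {γ : ℝ → Fin n → ℝ} (hγ : ContDiff ℝ 1 γ) {l : ℝ} (hG : SmoothMetric G)
    (hl : 0 ≤ l) (h : ∀ s, sqSpeed G γ s ≤ l ^ 2) {s : ℝ} (hs : 0 ≤ s) :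
    riemDist G (γ 0) (γ s) ≤ s * l := by
  refine (riemDist_le_integral hγ hs).trans ?_
  have := intervalIntegral.integral_mono_on (μ := volume) hs
    ((continuous_sqSpeed hG hγ).sqrt.intervalIntegrable 0 s)
    ((continuous_const (y := l)).intervalIntegrable 0 s) fun r _ => Real.sqrt_le_iff.2 ⟨hl, h r⟩
  simpa using this

/-- A path of level less than one can be replaced by one of almost constant speed. -/
lemma exists_almost_constant_speed {γ : ℝ → Fin n → ℝ} (hγ : ContDiff ℝ 1 γ) {r L : ℝ}
    (hr : 0 < r) (hrL : r ≤ L) (hlev : pathLevel L G γ < 1) {ε : ℝ} (hε : 0 < ε) :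
    ∃ β : ℝ → Fin n → ℝ, ∃ l, ContDiff ℝ 1 β ∧ β 0 = γ 0 ∧ β 1 = γ 1 ∧ r ≤ l ∧ l ≤ L ∧
      (∀ s ∈ Icc (0 : ℝ) 1, β s ∈ rBall G (γ 0) (7 / 8 * L) ∧ sqSpeed G β s ≤ l ^ 2) ∧
      (∀ s ∈ Icc (0 : ℝ) 1, s < r / l → β s ∈ rBall G (γ 0) r) ∧
      pathLevel L G β < 1 ∧ cutoff (pathLevel L G β) ≤ cutoff (pathLevel L G γ) + ε := by
  have hL : 0 < L := hr.trans_le hrL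
  set f : ℝ → ℝ := fun l => 8 / L ^ 2 * l ^ 2 - 9 / 2 with hf
  have hE := energy_nonneg hG γ
  have hfE : f √(energy G γ) = pathLevel L G γ := by
    simp only [hf, pathLevel, Real.sq_sqrt hE]
  have hfc : ContinuousAt f √(energy G γ) := by
    rw [hf]
    fun_prop
  have hcc : ContinuousAt (fun l => cutoff (f l)) √(energy G γ) := by
    have h : ContinuousAt cutoff (f √(energy G γ)) := continuousAt_cutoff (hfE ▸ hlev)
    exact h.comp hfc
  have h1 := hfc.eventually_lt (continuousAt_const (y := (1 : ℝ))) (hfE ▸ hlev)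
  have h2 := hcc.eventually_lt
    (continuousAt_const (y := cutoff (pathLevel L G γ) + ε)) (by
      simp only [hfE]
      linarith)
  obtain ⟨l, ⟨hl1, hl2⟩, hl⟩ := (((h1.and h2).filter_mono nhdsWithin_le_nhds).and
    (self_mem_nhdsWithin (s := Ioi √(energy G γ)))).exists
  have hl0 : 0 < l := (Real.sqrt_nonneg _).trans_lt hl
  have hlen : pathLength G γ < l :=
    (Real.le_sqrt_of_sq_le (pathLength_sq_le_energy hG hγ)).trans_lt hl
  obtain ⟨β, hβ, hβ0, hβ1, hβs⟩ := exists_reparam hG hγ hlen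
  have hlL : l < 7 / 8 * L := by
    have h3 : 8 / L ^ 2 * l ^ 2 < 11 / 2 := by
      have : f l < 1 := hl1
      simp only [hf] at this
      linarith
    have h4 : 8 * l ^ 2 < 11 / 2 * L ^ 2 := by
      rwa [div_mul_eq_mul_div, div_lt_iff₀ (by positivity)] at h3
    refine lt_of_pow_lt_pow_left₀ 2 (by positivity) ?_
    nlinarith [sq_pos_of_pos hL]
  have hlevβ : pathLevel L G β ≤ f l := by
    have := energy_le_sq hG hβ hβs
    simp only [hf, pathLevel]
    gcongr
  refine ⟨β, max l r, hβ, hβ0, hβ1, le_max_right _ _, max_le (by linarith) hrL,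
    fun s hs => ⟨?_, (hβs s).trans (by gcongr; exact le_max_left _ _)⟩, fun s hs hsl => ?_,
    hlevβ.trans_lt hl1, ?_⟩
  · have h3 := riemDist_le_mul hβ hG hl0.le hβs hs.1
    have h4 : s * l ≤ 1 * l := by gcongr; exact hs.2
    rw [hβ0] at h3
    exact (h3.trans h4).trans_lt (by linarith)
  · have h3 := riemDist_le_mul hβ hG hl0.le hβs hs.1
    rw [lt_div_iff₀ (lt_max_of_lt_left hl0)] at hsl
    have h4 : s * l ≤ s * max l r := mul_le_mul_of_nonneg_left (le_max_left _ _) hs.1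
    rw [hβ0] at h3
    exact (h3.trans h4).trans_lt hsl
  · exact (cutoff_mono (hlevβ.trans_lt hl1) hl1 hlevβ).trans hl2.le

lemma mem_rBall_of_pathLevel_lt_one {γ : ℝ → Fin n → ℝ} (hγ : ContDiff ℝ 1 γ) {L : ℝ}
    (hL : 0 < L) (hlev : pathLevel L G γ < 1) : γ 1 ∈ rBall G (γ 0) (7 / 8 * L) := by
  obtain ⟨β, l, -, -, hβ1, -, -, h, -⟩ :=
    exists_almost_constant_speed hG hγ hL le_rfl hlev one_pos
  exact hβ1 ▸ (h 1 (by simp)).1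

/-- Points at distance less than `3/4 L` are endpoints of paths on which the cutoff vanishes. -/
lemma exists_path_cutoff_eq_zero {x y : Fin n → ℝ} {L : ℝ} (hL : 0 < L)
    (h : y ∈ rBall G x (3 / 4 * L)) : ∃ γ : ℝ → Fin n → ℝ, ContDiff ℝ 1 γ ∧ γ 0 = x ∧ γ 1 = y ∧
      pathLevel L G γ < 1 ∧ cutoff (pathLevel L G γ) = 0 := by
  obtain ⟨γ, hγ, h0, h1, hlen⟩ := exists_path_of_riemDist_lt h
  obtain ⟨β, hβ, hβ0, hβ1, hβs⟩ := exists_reparam hG hγ hlen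
  have hE := energy_le_sq hG hβ hβs
  have hlev : pathLevel L G β ≤ 0 := by
    have h2 : 8 / L ^ 2 * energy G β ≤ 8 / L ^ 2 * (3 / 4 * L) ^ 2 := by gcongr
    have h3 : 8 / L ^ 2 * (3 / 4 * L) ^ 2 = 9 / 2 := by
      field_simp
      norm_num
    simp only [pathLevel]
    linarith
  exact ⟨β, hβ, hβ0.trans h0, hβ1.trans h1, hlev.trans_lt one_pos, cutoff_of_nonpos hlev⟩

end

section

variable {n : ℕ} {T : ℝ} {g : (Fin n → ℝ) → ℝ → Matrix (Fin n) (Fin n) ℝ}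
  (hT : 0 < T) (hg : SmoothMetricFamily g (Icc 0 T))

include hT hg

lemma exists_scalarCurv_bound {S : Set (Fin n → ℝ)} (hS : IsCompact S) :
    ∃ P, ∀ x ∈ S, ∀ t ∈ Icc 0 T, |scalarCurv (fun y => g y t) x| ≤ P := by
  obtain ⟨P, hP⟩ := (hS.prod isCompact_Icc).exists_bound_of_continuousOn
    ((contDiffOn_scalarCurv hT hg).continuousOn.mono (prod_mono (subset_univ S) le_rfl))
  exact ⟨P, fun x hx t ht => hP (x, t) ⟨hx, ht⟩⟩

/-- An initial lower scalar curvature bound almost persists for a short time. -/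
lemma exists_scalarCurv_ge_near_zero {x₀ : Fin n → ℝ} {L K : ℝ}
    (hc : ∀ t ∈ Icc 0 T, IsCompact (closure (rBall (fun y => g y t) x₀ L)))
    (hK : ∀ x ∈ rBall (fun y => g y 0) x₀ L, -K ≤ scalarCurv (fun y => g y 0) x)
    {ε : ℝ} (hε : 0 < ε) :
    ∃ η > 0, ∀ t ∈ Icc 0 T, t < η → ∀ x ∈ rBall (fun y => g y t) x₀ (7 / 8 * L),
      -K - ε ≤ scalarCurv (fun y => g y t) x := by
  obtain ⟨S, hS, hSb⟩ := exists_compact_rBall hT hg hc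
  have h0 : (0 : ℝ) ∈ Icc 0 T := ⟨le_rfl, hT.le⟩
  obtain ⟨η₁, hη₁, h₁⟩ := eventually_rBall_subset hT hg h0 (hc 0 h0)
  have huc := (hS.prod isCompact_Icc).uniformContinuousOn_of_continuous
    ((contDiffOn_scalarCurv hT hg).continuousOn.mono (prod_mono (subset_univ S) le_rfl))
  obtain ⟨η₂, hη₂, h₂⟩ := Metric.uniformContinuousOn_iff.1 huc ε hε
  refine ⟨min η₁ η₂, lt_min hη₁ hη₂, fun t ht htη x hx => ?_⟩
  have hat : |t - 0| < min η₁ η₂ := by rwa [sub_zero, abs_of_nonneg ht.1]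
  have h3 := hK x (h₁ t ht (hat.trans_le (min_le_left _ _)) hx)
  have h4 := h₂ (x, t) ⟨hSb t ht hx, ht⟩ (x, 0) ⟨hSb t ht hx, h0⟩ (by
    rw [Prod.dist_eq, dist_self, max_eq_right dist_nonneg, Real.dist_eq]
    exact hat.trans_le (min_le_right _ _))
  rw [Real.dist_eq] at h4
  linarith [(abs_lt.1 h4).1]

end

/-- The constants absorbing the cutoff errors in the evolution inequality. -/
lemma barrier_bracket_le {n δ W M C X R B Q θ₁ θ₂ p₁ p₂ : ℝ} (hn : 1 ≤ n)
    (hδ : 0 < δ) (hW : 0 < W) (hX : 0 ≤ X) (hM : M = 152 * n ^ 2 * 8704)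
    (hC : C = 304 * n * 8704 * M / δ + 1 / δ + 1) (hB : B ≤ -(C * W)) (hR : R ≤ B - M * W * X)
    (hQ : R ^ 2 ≤ n * Q) (hθ₁ : θ₁ ≤ 8704 * (1 + X ^ 2)) (hθ₂ : θ₂ ≤ 8704 * (1 + X ^ 2))
    (hθ₁0 : 0 ≤ θ₁) (hθ₂0 : 0 ≤ θ₂) (hp₁ : p₁ ≤ 48 * n * W) (hp₂ : p₂ ≤ 256 * n * W) :
    (2 / n - δ) * B ^ 2 - 2 * Q + M * W * (θ₁ * p₁ + θ₂ * p₂) ≤ -W ^ 2 := by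
  have hn0 : 0 < n := by linarith
  have hM0 : 0 < M := by rw [hM]; positivity
  have hC1 : 1 ≤ C := by
    rw [hC]
    have : 0 ≤ 304 * n * 8704 * M / δ + 1 / δ := by positivity
    linarith
  have hC2 : 304 * n * 8704 * M + 1 ≤ δ * C ^ 2 := by
    have e : 304 * n * 8704 * M + 1 + δ = δ * C := by
      rw [hC]
      field_simp
    have : δ * C * 1 ≤ δ * C * C := by gcongr
    nlinarith
  have hCW : 0 ≤ C * W := by positivity
  have hB2 : (C * W) ^ 2 ≤ B ^ 2 := by
    rw [← neg_sq B]
    exact pow_le_pow_left₀ hCW (by linarith) 2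
  have hψ : 0 ≤ M * W * X := by positivity
  have hR2 : B ^ 2 + (M * W * X) ^ 2 ≤ R ^ 2 := by
    have h1 : (-B + M * W * X) ^ 2 ≤ (-R) ^ 2 :=
      pow_le_pow_left₀ (by linarith) (by linarith) 2
    have h2 : 0 ≤ -B * (M * W * X) := mul_nonneg (by linarith) hψ
    linarith
  have hQ' : 2 / n * (B ^ 2 + (M * W * X) ^ 2) ≤ 2 * Q := by
    have h1 : B ^ 2 + (M * W * X) ^ 2 ≤ n * Q := hR2.trans hQ
    calc 2 / n * (B ^ 2 + (M * W * X) ^ 2) ≤ 2 / n * (n * Q) := by gcongr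
      _ = 2 * Q := by field_simp
  have e1 : θ₁ * p₁ ≤ 8704 * (1 + X ^ 2) * (48 * n * W) :=
    (mul_le_mul_of_nonneg_left hp₁ hθ₁0).trans
      (mul_le_mul_of_nonneg_right hθ₁ (by positivity))
  have e2 : θ₂ * p₂ ≤ 8704 * (1 + X ^ 2) * (256 * n * W) :=
    (mul_le_mul_of_nonneg_left hp₂ hθ₂0).trans
      (mul_le_mul_of_nonneg_right hθ₂ (by positivity))
  have e3 : M * W * (θ₁ * p₁ + θ₂ * p₂) ≤ M * W * (8704 * (1 + X ^ 2) * (304 * n * W)) := by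
    refine mul_le_mul_of_nonneg_left ?_ (by positivity)
    linarith
  have e4 : 2 / n * (M * W * X) ^ 2 = 304 * n * 8704 * M * (W ^ 2 * X ^ 2) := by
    have : 2 / n * M = 304 * n * 8704 := by
      rw [hM]
      field_simp
      norm_num
    calc 2 / n * (M * W * X) ^ 2 = (2 / n * M) * M * (W ^ 2 * X ^ 2) := by ring
      _ = _ := by rw [this]
  have e5 : δ * (C * W) ^ 2 ≤ δ * B ^ 2 := by gcongr
  have e6 : (304 * n * 8704 * M + 1) * W ^ 2 ≤ δ * C ^ 2 * W ^ 2 := by gcongr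
  linarith

lemma bil_ricci_le_of_posSemidef {n : ℕ} {G : (Fin n → ℝ) → Matrix (Fin n) (Fin n) ℝ}
    {x : Fin n → ℝ} {c : ℝ}
    (h : Matrix.PosSemidef (Matrix.of fun j k => c * G x j k - ricci G x j k)) (u : Fin n → ℝ) :
    bil (Matrix.of (ricci G x)) u u ≤ c * bil (G x) u u := by
  have h1 := bil_self_nonneg h u
  have h2 : bil (Matrix.of fun j k => c * G x j k - ricci G x j k) u u
      = c * bil (G x) u u - bil (Matrix.of (ricci G x)) u u := by
    simp only [bil_apply, Matrix.of_apply, Finset.mul_sum, ← Finset.sum_sub_distrib]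
    exact Finset.sum_congr rfl fun _ _ => Finset.sum_congr rfl fun _ _ => by ring
  linarith

set_option maxHeartbeats 1000000 in
/-- The scalar curvature, corrected by the cutoff of the path level, stays above the barrier. -/
theorem barrier_le_scalarCurv_add_cutoff {n : ℕ} (hn : 1 ≤ n) {δ : ℝ} (hδ0 : 0 < δ)
    (hδ : δ < 2 / (n : ℝ)) {T : ℝ} (hT : 0 < T) {g : (Fin n → ℝ) → ℝ → Matrix (Fin n) (Fin n) ℝ}
    {x₀ : Fin n → ℝ} {r A K M C W : ℝ} (hr : 0 < r) (hA : 1 ≤ A) (hK : 0 < K)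
    (hg : SmoothMetricFamily g (Icc 0 T)) (hflow : IsRicciFlow g (Icc 0 T))
    (hc : ∀ t ∈ Icc (0 : ℝ) T, IsCompact (closure (rBall (fun y => g y t) x₀ (A * r))))
    (hric : ∀ t ∈ Icc (0 : ℝ) T, ∀ x ∈ rBall (fun y => g y t) x₀ r,
      Matrix.PosSemidef (Matrix.of fun j k =>
        ((n : ℝ) - 1) / r ^ 2 * g x t j k - ricci (fun y => g y t) x j k))
    (hR0 : ∀ x ∈ rBall (fun y => g y 0) x₀ (A * r), -K ≤ scalarCurv (fun y => g y 0) x)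
    (hM : M = 152 * (n : ℝ) ^ 2 * 8704) (hC : C = 304 * (n : ℝ) * 8704 * M / δ + 1 / δ + 1)
    (hW : W = 1 / (A * r ^ 2)) {t : ℝ} (ht : t ∈ Icc 0 T) {γ : ℝ → Fin n → ℝ}
    (hγ : ContDiff ℝ 1 γ) (hγ0 : γ 0 = x₀) (hγ1 : pathLevel (A * r) (fun y => g y t) γ < 1) :
    barrier (2 / (n : ℝ) - δ) K (C * W) t ≤ scalarCurv (fun y => g y t) (γ 1)
      + M * W * cutoff (pathLevel (A * r) (fun y => g y t) γ) := by
  have hn1 : (1 : ℝ) ≤ n := by exact_mod_cast hn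
  have hA0 : 0 < A := by linarith
  have hL : 0 < A * r := by positivity
  have hrL : r ≤ A * r := by nlinarith
  have hW0 : 0 < W := by rw [hW]; positivity
  have hM0 : 0 < M := by rw [hM]; positivity
  have hC0 : 0 ≤ C * W := by rw [hC]; positivity
  have hμ : 0 < M * W := by positivity
  have hκ : 0 < 2 / (n : ℝ) - δ := by linarith
  obtain ⟨S, hS, hSb⟩ := exists_compact_rBall hT hg hc
  obtain ⟨P, hP⟩ := exists_scalarCurv_bound hT hg hS
  set w : ℝ → (ℝ → Fin n → ℝ) → ℝ := fun t γ => scalarCurv (fun y => g y t) (γ 1)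
    - barrier (2 / (n : ℝ) - δ) K (C * W) t
    + M * W * cutoff (pathLevel (A * r) (fun y => g y t) γ) with hw
  set V : Set ℝ := {v | ∃ t ∈ Icc 0 T, ∃ γ : ℝ → Fin n → ℝ, ContDiff ℝ 1 γ ∧ γ 0 = x₀ ∧
    pathLevel (A * r) (fun y => g y t) γ < 1 ∧ v = w t γ} with hV
  have hend : ∀ t ∈ Icc 0 T, ∀ γ : ℝ → Fin n → ℝ, ContDiff ℝ 1 γ → γ 0 = x₀ →
      pathLevel (A * r) (fun y => g y t) γ < 1 →
      γ 1 ∈ rBall (fun y => g y t) x₀ (7 / 8 * (A * r)) := fun t ht γ hγ h0 h1 =>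
    h0 ▸ mem_rBall_of_pathLevel_lt_one (hg.slice ht) hγ hL h1
  have hbdd : BddBelow V := by
    refine ⟨-P, ?_⟩
    rintro v ⟨t, ht, γ, hγ, h0, h1, rfl⟩
    have h2 := (abs_le.1 (hP _ (hSb t ht (hend t ht γ hγ h0 h1)) t ht)).1
    have h3 := barrier_le_neg (κ := 2 / (n : ℝ) - δ) (K := K) (c := C * W) t
    have h4 := mul_nonneg hμ.le (cutoff_nonneg (pathLevel (A * r) (fun y => g y t) γ))
    simp only [hw]
    linarith
  have hne : V.Nonempty := ⟨_, t, ht, γ, hγ, hγ0, hγ1, rfl⟩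
  have hmin : ∀ t ∈ Icc 0 T, ∀ γ : ℝ → Fin n → ℝ, ContDiff ℝ 1 γ → γ 0 = x₀ →
      pathLevel (A * r) (fun y => g y t) γ < 1 → sInf V ≤ w t γ := fun t ht γ hγ h0 h1 =>
    csInf_le hbdd ⟨t, ht, γ, hγ, h0, h1, rfl⟩
  suffices h : 0 ≤ sInf V by
    have := h.trans (hmin t ht γ hγ hγ0 hγ1)
    simp only [hw] at this
    linarith
  clear hγ1 hγ0 hγ γ ht t
  by_contra! hm
  set m := sInf V with hmdef
  obtain ⟨η₁, hη₁, hinit₁⟩ := exists_scalarCurv_ge_near_zero hT hg hc hR0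
    (ε := -m / 4) (by linarith)
  obtain ⟨η₂, hη₂, hinit₂⟩ := exists_barrier_near_zero (c := C * W) hκ hK
    (ε := -m / 4) (by linarith)
  obtain ⟨η, hη, hlev⟩ := exists_le_of_cutoff_le (P / (M * W))
  have hε : 0 < W ^ 2 / 6 := by positivity
  obtain ⟨a₀, ha₀, hspace⟩ := exists_space_inequality hT hg hn hS hr hL hμ.le hη hε
  obtain ⟨τ₁, hτ₁, htime⟩ := exists_time_inequality hT hg hflow hS hL hμ.le hη hε
  obtain ⟨τ₂, hτ₂, hbar⟩ := barrier_sub_le (c := C * W) hκ hK hε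
  obtain ⟨a, ha, haa, haτ⟩ : ∃ a, 0 < a ∧ a ≤ a₀ ∧ a ^ 2 < min (min τ₁ τ₂) (min η₁ η₂) := by
    set q := min (min τ₁ τ₂) (min η₁ η₂) with hq
    have hq0 : 0 < q := by positivity
    refine ⟨min a₀ (√q / 2), lt_min ha₀ (by positivity), min_le_left _ _, ?_⟩
    have h1 : min a₀ (√q / 2) ^ 2 ≤ (√q / 2) ^ 2 := by
      gcongr
      exact min_le_right _ _
    rw [div_pow, Real.sq_sqrt hq0.le] at h1
    linarith
  obtain ⟨⟨ha1, ha2⟩, ha3, ha4⟩ : (a ^ 2 < τ₁ ∧ a ^ 2 < τ₂) ∧ a ^ 2 < η₁ ∧ a ^ 2 < η₂ := by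
    simpa only [lt_min_iff] using haτ
  have hτ : 0 < a ^ 2 := by positivity
  obtain ⟨d, hd, hd1, hd2⟩ : ∃ d, 0 < d ∧ d ≤ -m / 2 ∧ (2 * n + 1) * d ≤ a ^ 2 * W ^ 2 / 4 := by
    refine ⟨min (-m / 2) (a ^ 2 * W ^ 2 / 4 / (2 * n + 1)), lt_min (by linarith) (by positivity),
      min_le_left _ _, ?_⟩
    rw [← le_div_iff₀' (by positivity)]
    exact min_le_right _ _
  obtain ⟨v, ⟨t, ht, γ, hγ, hγ0, hγ1, rfl⟩, hv⟩ := exists_lt_of_csInf_lt hne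
    (show sInf V < m + d / 2 by linarith)
  have hG := hg.slice ht
  obtain ⟨β, l, hβ, hβ0, hβ1, hrl, hlL, hβs, hβr, hβlev, hβcut⟩ :=
    exists_almost_constant_speed hG hγ hr hrL hγ1 (ε := d / (2 * (M * W))) (by positivity)
  rw [hγ0] at hβ0 hβs hβr
  have hwβ : w t β < m + d := by
    have h1 := mul_le_mul_of_nonneg_left hβcut hμ.le
    have h2 : M * W * (d / (2 * (M * W))) = d / 2 := by field_simp
    simp only [hw] at hv ⊢
    rw [hβ1]
    rw [mul_add, h2] at h1
    linarith
  have hβmem := hend t ht β hβ hβ0 hβlev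
  have htτ : t - a ^ 2 ∈ Icc 0 T := by
    refine ⟨?_, by linarith [ht.2]⟩
    by_contra! hlt
    have h1 := hinit₁ t ht (by linarith) _ hβmem
    have h2 := hinit₂ t ht.1 (by linarith)
    have h4 := mul_nonneg hμ.le (cutoff_nonneg (pathLevel (A * r) (fun y => g y t) β))
    simp only [hw] at hwβ
    linarith
  set σ := pathLevel (A * r) (fun y => g y t) β with hσ
  have hbneg := barrier_le_neg (κ := 2 / (n : ℝ) - δ) (K := K) (c := C * W) t
  set b := barrier (2 / (n : ℝ) - δ) K (C * W) t with hb
  set R := scalarCurv (fun y => g y t) (β 1) with hR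
  have hwβ' : R - b + M * W * cutoff σ < m + d := hwβ
  have hβS : ∀ s ∈ Icc (0 : ℝ) 1, β s ∈ S ∧ sqSpeed (fun y => g y t) β s ≤ l ^ 2 :=
    fun s hs => ⟨hSb t ht (hβs s hs).1, (hβs s hs).2⟩
  have hση : σ ≤ 1 - η := by
    refine hlev σ hβlev ?_
    rw [le_div_iff₀' hμ]
    have h2 := (abs_le.1 (hP _ (hβS 1 (by simp)).1 t ht)).1
    linarith only [h2, hwβ', hbneg, hC0, hd1, hm]
  have hsp := hspace t ht β hβ l hrl hlL hβS
    (fun s hs hsl => bil_ricci_le_of_posSemidef (G := fun y => g y t)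
      (hric t ht _ (hβr s hs hsl)) _) hση a ha.le haa d
    (fun α hα hα0 hαlev => by
      have := hmin t ht α hα (hα0.trans hβ0) hαlev
      simp only [hw, ← hb] at this
      linarith only [this, hwβ'])
  have hl0 : 0 ≤ l := hr.le.trans hrl
  obtain ⟨hlev', hti⟩ := htime t ht β hβ
    (fun s hs => ⟨(hβS s hs).1, (hβS s hs).2.trans (by gcongr)⟩) hση (a ^ 2) hτ.le ha1 htτ
  have hm' := hmin _ htτ β hβ hβ0 hlev'
  have hba := hbar t (a ^ 2) hτ.le ha2 htτ.1
  simp only [hw] at hm'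
  rw [← hσ] at hsp hti
  rw [← hb] at hba
  rw [← hR] at hti
  have hp₁ : 8 / (A * r) ^ 2 * (6 * n * l / r) ≤ 48 * n * W := by
    calc 8 / (A * r) ^ 2 * (6 * n * l / r) ≤ 8 / (A * r) ^ 2 * (6 * n * (A * r) / r) := by gcongr
      _ = 48 * n * W := by
        rw [hW]
        field_simp
        norm_num
  have hp₂ : 256 * n / (A * r) ^ 2 ≤ 256 * n * W := by
    rw [hW, div_eq_mul_one_div]
    refine mul_le_mul_of_nonneg_left (one_div_le_one_div_of_le (by positivity) ?_) (by positivity)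
    rw [mul_pow]
    gcongr
    nlinarith
  have hbr := barrier_bracket_le hn1 hδ0 hW0 (cutoff_nonneg σ) hM hC hbneg
    (show R ≤ b - M * W * cutoff σ by linarith) (hG.scalarCurv_sq_le (β 1))
    (cutoffDeriv_le hβlev).1 (cutoffDeriv_le hβlev).2 (cutoffDeriv_nonneg hβlev)
    (cutoffDerivTwo_nonneg hβlev) hp₁ hp₂
  have hbr' := mul_le_mul_of_nonneg_left hbr hτ.le
  have hτW : 0 < a ^ 2 * W ^ 2 := by positivity
  linarith only [hsp, hti, hba, hm', hwβ', hbr', hd2, hτW]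

/-- Local lower bound for the scalar curvature along the Ricci flow
(Proposition 2.1 (i)). -/
theorem stmt_2 (n : ℕ) (hn : 2 ≤ n) (δ : ℝ) (hδ0 : 0 < δ) (hδ : δ < 2/(n:ℝ)) :
    ∃ C > (0:ℝ), ∀ (T : ℝ) (g : (Fin n → ℝ) → ℝ → Matrix (Fin n) (Fin n) ℝ)
      (x₀ : Fin n → ℝ) (r₀ A K : ℝ), 0 < r₀ → 2 ≤ A → 0 < K →
      SmoothMetricFamily g (Icc 0 T) → IsRicciFlow g (Icc 0 T) →
      (∀ t ∈ Icc (0:ℝ) T, IsCompact (closure (rBall (fun y => g y t) x₀ (A*r₀)))) →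
      (∀ t ∈ Icc (0:ℝ) T, ∀ x ∈ rBall (fun y => g y t) x₀ r₀,
        Matrix.PosSemidef (Matrix.of fun j k =>
          ((n:ℝ)-1)/r₀^2 * g x t j k - ricci (fun y => g y t) x j k)) →
      (∀ x ∈ rBall (fun y => g y 0) x₀ (A*r₀), -K ≤ scalarCurv (fun y => g y 0) x) →
      ∀ t ∈ Icc (0:ℝ) T, ∀ x ∈ rBall (fun y => g y t) x₀ (3*A/4*r₀),
        min (-(1/((2/(n:ℝ) - δ)*t + 1/K))) (-(C/(A*r₀^2)))
          ≤ scalarCurv (fun y => g y t) x := by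
  set M : ℝ := 152 * (n : ℝ) ^ 2 * 8704 with hM
  set C : ℝ := 304 * (n : ℝ) * 8704 * M / δ + 1 / δ + 1 with hC
  refine ⟨C, by positivity, fun T g x₀ r₀ A K hr hA hK hg hflow hc hric hR0 t ht x hx => ?_⟩
  have hL : 0 < A * r₀ := by positivity
  rw [show 3 * A / 4 * r₀ = 3 / 4 * (A * r₀) by ring] at hx
  rcases (ht.1.trans ht.2).eq_or_lt with hT | hT
  · obtain rfl : t = 0 := le_antisymm (hT ▸ ht.2) ht.1
    refine (min_le_left _ _).trans ?_
    rw [mul_zero, zero_add, one_div_one_div]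
    exact hR0 x (lt_of_lt_of_le hx (show 3 / 4 * (A * r₀) ≤ A * r₀ by linarith))
  · obtain ⟨γ, hγ, hγ0, hγ1, hlev, hcut⟩ := exists_path_cutoff_eq_zero (hg.slice ht) hL hx
    have h := barrier_le_scalarCurv_add_cutoff (by lia) hδ0 hδ hT hr (by linarith) hK hg hflow hc
      hric hR0 hM hC rfl ht hγ hγ0 hlev
    rwa [hcut, mul_zero, add_zero, hγ1, mul_one_div] at h

end
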